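/- Let d, x, y, z be non-negative integers with 9 ≤ d ≤ 13. Then the linear system L_3(d; 4^{×x}, 3^{×y}, 2^{×z}) is non-special; that is, there exist pairwise linearly independent points p_1,...,p_{x+y+z} ∈ ℚ^4 \ {0} such that the space of homogeneous polynomials of degree d in 4 variables over ℚ vanishing to order ≥ 4 at the first x points, ≥ 3 at the next y points, and ≥ 2 at the last z points has dimension exactly max(C(d+3,3) − 20x − 10y − 4z, 0). -/

import Mathlib

open MvPolynomial

/-- The differential operator `∂₀^{ν 0} ∂₁^{ν 1} ∂₂^{ν 2} ∂₃^{ν 3}` on polynomials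
in 4 variables over `ℚ`. -/
noncomputable def diffOp (ν : Fin 4 → ℕ) :
    Module.End ℚ (MvPolynomial (Fin 4) ℚ) :=
  ((pderiv (0 : Fin 4)).toLinearMap ^ ν 0) * ((pderiv (1 : Fin 4)).toLinearMap ^ ν 1) *
    ((pderiv (2 : Fin 4)).toLinearMap ^ ν 2) * ((pderiv (3 : Fin 4)).toLinearMap ^ ν 3)

/-- Polynomials all of whose partial derivatives of order `< m` (including order 0)
vanish at the point `pt : ℚ⁴`. -/
noncomputable def vanishingSpace (m : ℕ) (pt : Fin 4 → ℚ) :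
    Submodule ℚ (MvPolynomial (Fin 4) ℚ) :=
  ⨅ (ν : Fin 4 → ℕ) (_ : ∑ j, ν j < m),
    LinearMap.ker ((aeval pt).toLinearMap ∘ₗ
      (diffOp ν : MvPolynomial (Fin 4) ℚ →ₗ[ℚ] MvPolynomial (Fin 4) ℚ))

/-- `V(d; m_1,…,m_r; p_1,…,p_r)`: homogeneous polynomials of degree `d` in 4 variables
over `ℚ` vanishing to order `≥ ms[i]` at `pts i` for each `i`. -/
noncomputable def systemSpace (d : ℕ) (ms : List ℕ) (pts : Fin ms.length → Fin 4 → ℚ) :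
    Submodule ℚ (MvPolynomial (Fin 4) ℚ) :=
  homogeneousSubmodule (Fin 4) ℚ d ⊓ ⨅ i, vanishingSpace (ms.get i) (pts i)

/-- The virtual dimension `vdim L_3(d; m_1,…,m_r) = C(d+3,3) − Σ C(m_i+2,3) − 1`. -/
def vdim (d : ℕ) (ms : List ℕ) : ℤ :=
  ((d + 3).choose 3 : ℤ) - (ms.map fun m => ((m + 2).choose 3 : ℤ)).sum - 1

/-- The linear system `L_3(d; m_1,…,m_r)` is non-special: there exist pairwise linearly
independent points of `ℚ⁴ \ {0}` at which the space of degree-`d` homogeneous polynomials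
with the prescribed multiplicities has dimension `max (vdim + 1) 0`
(the expected dimension). -/
noncomputable def nonSpecial (d : ℕ) (ms : List ℕ) : Prop :=
  ∃ pts : Fin ms.length → Fin 4 → ℚ,
    (∀ i, pts i ≠ 0) ∧
    (∀ i j, i ≠ j → LinearIndependent ℚ ![pts i, pts j]) ∧
    (Module.finrank ℚ (systemSpace d ms pts) : ℤ) = max (vdim d ms + 1) 0


/-! ## Combinatorial data: monomials coded as numbers in base 256 -/

/-- The exponent vector coded by a number. -/
def ex (a : ℕ) : Fin 4 → ℕ := ![a % 256, a / 256 % 256, a / 65536 % 256, a / 16777216 % 256]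

/-- The coefficient produced by differentiating a monomial. -/
def qf (ν e : Fin 4 → ℕ) : ℚ := ∏ j, ((e j).descFactorial (ν j) : ℚ)

/-- Evaluation of a monomial. -/
def mon (p : Fin 4 → ℚ) (e : Fin 4 → ℕ) : ℚ := ∏ j, p j ^ e j

/-- The pairing of a weight and an exponent vector. -/
def dotw (w : Fin 4 → ℕ) (a : ℕ) : ℕ := ∑ j, w j * ex a j

/-- The fat points impose independent conditions dual to the monomials in `S`. -/
def Ker (S : Finset ℕ) (pts : List (ℕ × (Fin 4 → ℚ))) : Prop :=
  ∀ c : ℕ → ℚ, (∀ t ∈ pts, ∀ ν : Fin 4 → ℕ, ∑ j, ν j < t.1 →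
    ∑ a ∈ S, c a * (qf ν (ex a) * mon t.2 (ex a)) = 0) → ∀ a ∈ S, c a = 0

/-- Two points of projective space are distinct. -/
def PDist (p q : Fin 4 → ℚ) : Prop := ∃ i j, p i * q j ≠ p j * q i

/-- There are fat points of the given multiplicities in general position for `S`. -/
def PP (S : Finset ℕ) (ms : Multiset ℕ) : Prop :=
  ∃ pts : List (ℕ × (Fin 4 → ℚ)), ((pts.map Prod.fst : List ℕ) : Multiset ℕ) = ms ∧
    (∀ t ∈ pts, ∀ j, t.2 j ≠ 0) ∧ pts.Pairwise (fun s t => PDist s.2 t.2) ∧ Ker S pts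

/-- The rows of the linear system. -/
def rowSet (pts : List (ℕ × (Fin 4 → ℚ))) : Set ((ℕ × (Fin 4 → ℚ)) × (Fin 4 → ℕ)) :=
  {x | x.1 ∈ pts ∧ ∑ j, x.2 j < x.1.1}

theorem rowSet_finite (pts : List (ℕ × (Fin 4 → ℚ))) : (rowSet pts).Finite := by
  have h1 : ({t | t ∈ pts} : Set (ℕ × (Fin 4 → ℚ))).Finite := List.finite_toSet pts
  have h2 : ∀ m : ℕ, ({ν : Fin 4 → ℕ | ∑ j, ν j < m}).Finite := by
    intro m
    refine Set.Finite.subset (Set.Finite.pi' (fun _ : Fin 4 => Set.finite_Iio m)) ?_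
    intro ν hν j
    exact lt_of_le_of_lt (Finset.single_le_sum (f := ν) (fun i _ => Nat.zero_le _) (Finset.mem_univ j)) hν
  refine Set.Finite.subset (Set.Finite.biUnion h1 (fun t _ => (h2 t.1).image (fun ν => (t, ν)))) ?_
  rintro ⟨t, ν⟩ ⟨h, h'⟩
  simp only [Set.mem_iUnion, Set.mem_image]
  exact ⟨t, h, ν, h', rfl⟩

open Polynomial in
/-- If a polynomial matrix is injective at `0`, it is injective at almost all points. -/
theorem inj_cofinite {κ ι : Type} [Fintype κ] [Fintype ι] [DecidableEq κ] [DecidableEq ι]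
    (A : Matrix κ ι ℚ[X])
    (h0 : ∀ c : ι → ℚ, (∀ k, ∑ a, (A k a).eval 0 * c a = 0) → c = 0) :
    ∀ᶠ s : ℚ in Filter.cofinite, ∀ c : ι → ℚ, (∀ k, ∑ a, (A k a).eval s * c a = 0) → c = 0 := by
  let A0 : Matrix κ ι ℚ := A.map (Polynomial.eval 0)
  have hinj : LinearMap.ker (Matrix.toLin' A0) = ⊥ := by
    rw [LinearMap.ker_eq_bot']
    intro c hc
    apply h0
    intro k
    have := congrFun hc k
    simpa [A0, Matrix.toLin'_apply, Matrix.mulVec, dotProduct] using this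
  obtain ⟨g, hg⟩ := LinearMap.exists_leftInverse_of_injective _ hinj
  let B : Matrix ι κ ℚ := LinearMap.toMatrix' g
  have hB : B * A0 = 1 := by
    have := congrArg LinearMap.toMatrix' hg
    rw [LinearMap.toMatrix'_comp, LinearMap.toMatrix'_toLin', LinearMap.toMatrix'_id] at this
    exact this
  let G : ℚ[X] := ((B.map Polynomial.C) * A).det
  have hG : ∀ s : ℚ, G.eval s = (B * A.map (Polynomial.eval s)).det := by
    intro s
    have := RingHom.map_det (Polynomial.evalRingHom s) ((B.map Polynomial.C) * A)
    rw [Polynomial.coe_evalRingHom] at this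
    rw [this]
    congr 1
    ext i j
    simp [Matrix.mul_apply, Polynomial.eval_finsetSum]
  have hG0 : G ≠ 0 := by
    intro h
    have h1 := hG 0
    rw [h, show A.map (Polynomial.eval 0) = A0 from rfl, hB] at h1
    simp at h1
  have hfin : {s : ℚ | G.eval s = 0}.Finite := by
    refine Set.Finite.subset (Finset.finite_toSet G.roots.toFinset) ?_
    intro s hs
    simp only [Finset.mem_coe, Multiset.mem_toFinset]
    exact (Polynomial.mem_roots hG0).2 hs
  have : ∀ᶠ s : ℚ in Filter.cofinite, G.eval s ≠ 0 := by
    rw [Filter.eventually_cofinite]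
    simpa using hfin
  filter_upwards [this] with s hs c hc
  rw [hG] at hs
  apply Matrix.eq_zero_of_mulVec_eq_zero hs
  rw [← Matrix.mulVec_mulVec]
  have : (A.map (Polynomial.eval s)).mulVec c = 0 := by
    ext k
    simpa [Matrix.mulVec, dotProduct] using hc k
  rw [this, Matrix.mulVec_zero]

theorem poly_cofinite (G : Polynomial ℚ) (h : G ≠ 0) :
    ∀ᶠ s : ℚ in Filter.cofinite, G.eval s ≠ 0 := by
  rw [Filter.eventually_cofinite]
  refine Set.Finite.subset (Finset.finite_toSet G.roots.toFinset) ?_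
  intro s hs
  simp only [Finset.mem_coe, Multiset.mem_toFinset]
  exact (Polynomial.mem_roots h).2 (by simpa using hs)

/-- Move a point by a one-parameter subgroup. -/
def mv (w : Fin 4 → ℕ) (s : ℚ) (t : ℕ × (Fin 4 → ℚ)) : ℕ × (Fin 4 → ℚ) :=
  (t.1, fun j => s ^ w j * t.2 j)

theorem mon_mv (w : Fin 4 → ℕ) (s : ℚ) (t : ℕ × (Fin 4 → ℚ)) (a : ℕ) :
    mon (mv w s t).2 (ex a) = s ^ dotw w a * mon t.2 (ex a) := by
  simp only [mon, mv, mul_pow, Finset.prod_mul_distrib, dotw, ← pow_mul, Finset.prod_pow_eq_pow_sum]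

theorem glue {S1 S2 : Finset ℕ} {ms1 ms2 : Multiset ℕ} (w : Fin 4 → ℕ) (c : ℕ)
    (hw : ∃ i j, w i ≠ w j) (h1 : ∀ a ∈ S1, dotw w a ≤ c) (h2 : ∀ a ∈ S2, c < dotw w a)
    (H1 : PP S1 ms1) (H2 : PP S2 ms2) : PP (S1 ∪ S2) (ms1 + ms2) := by
  classical
  obtain ⟨pts1, e1, n1, d1, k1⟩ := H1
  obtain ⟨pts2, e2, n2, d2, k2⟩ := H2
  have hdisj : Disjoint S1 S2 := by
    rw [Finset.disjoint_left]
    intro a ha hb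
    exact absurd (h1 a ha) (not_le.2 (h2 a hb))
  -- the finite sets of rows
  let K1 := (rowSet_finite pts1).toFinset
  let K2 := (rowSet_finite pts2).toFinset
  have hK1 : ∀ x, x ∈ K1 ↔ x.1 ∈ pts1 ∧ ∑ j, x.2 j < x.1.1 := fun x => Set.Finite.mem_toFinset _
  have hK2 : ∀ x, x ∈ K2 ↔ x.1 ∈ pts2 ∧ ∑ j, x.2 j < x.1.1 := fun x => Set.Finite.mem_toFinset _
  let val : ((ℕ × (Fin 4 → ℚ)) × (Fin 4 → ℕ)) → ℕ → ℚ := fun x a => qf x.2 (ex a) * mon x.1.2 (ex a)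
  let A : Matrix (K1 ⊕ K2) (S1 ⊕ S2) (Polynomial ℚ) :=
    Sum.elim
      (fun x => Sum.elim (fun a => Polynomial.C (val x.1 a.1))
        (fun a => Polynomial.C (val x.1 a.1) * Polynomial.X ^ (dotw w a.1 - c)))
      (fun x => Sum.elim (fun a => Polynomial.C (val x.1 a.1) * Polynomial.X ^ (c - dotw w a.1))
        (fun a => Polynomial.C (val x.1 a.1)))
  -- extension of coefficient functions by zero
  have key0 : ∀ v : (S1 ⊕ S2) → ℚ, (∀ k, ∑ a, (A k a).eval 0 * v a = 0) → v = 0 := by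
    intro v hv
    have hz1 : ∀ a : S1, v (Sum.inl a) = 0 := by
      let cc : ℕ → ℚ := fun a => if h : a ∈ S1 then v (Sum.inl ⟨a, h⟩) else 0
      have := k1 cc (by
        intro t ht ν hν
        have := hv (Sum.inl ⟨(t, ν), (hK1 _).2 ⟨ht, hν⟩⟩)
        rw [Fintype.sum_sum_type] at this
        have hz : ∀ a : S2, (Polynomial.eval 0 (A (Sum.inl ⟨(t, ν), (hK1 _).2 ⟨ht, hν⟩⟩) (Sum.inr a))) = 0 := by
          intro a
          have : dotw w a.1 - c ≠ 0 := by have := h2 a.1 a.2; omega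
          simp [A, this]
        simp only [hz, zero_mul, Finset.sum_const_zero, add_zero] at this
        rw [← this, ← Finset.sum_coe_sort S1]
        refine Finset.sum_congr rfl fun a _ => ?_
        simp [A, cc, val, mul_comm])
      intro a
      have := this a.1 a.2
      simpa [cc] using this
    have hz2 : ∀ a : S2, v (Sum.inr a) = 0 := by
      let cc : ℕ → ℚ := fun a => if h : a ∈ S2 then v (Sum.inr ⟨a, h⟩) else 0
      have := k2 cc (by
        intro t ht ν hν
        have := hv (Sum.inr ⟨(t, ν), (hK2 _).2 ⟨ht, hν⟩⟩)
        rw [Fintype.sum_sum_type] at this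
        simp only [hz1, mul_zero, Finset.sum_const_zero, zero_add] at this
        rw [← this, ← Finset.sum_coe_sort S2]
        refine Finset.sum_congr rfl fun a _ => ?_
        simp [A, cc, val, mul_comm])
      intro a
      have := this a.1 a.2
      simpa [cc] using this
    funext a
    cases a with
    | inl a => exact hz1 a
    | inr a => exact hz2 a
  have ev1 := inj_cofinite A key0
  have ev2 : ∀ᶠ s : ℚ in Filter.cofinite, s ≠ 0 := by
    rw [Filter.eventually_cofinite]; simp
  have ev3 : ∀ᶠ s : ℚ in Filter.cofinite, ∀ t ∈ {t | t ∈ pts1}, ∀ u ∈ {u | u ∈ pts2},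
      PDist (mv w s t).2 u.2 := by
    rw [Filter.eventually_all_finite (List.finite_toSet pts1)]
    intro t ht
    rw [Filter.eventually_all_finite (List.finite_toSet pts2)]
    intro u hu
    obtain ⟨i, j, hij⟩ := hw
    let G : Polynomial ℚ := Polynomial.C (t.2 i * u.2 j) * Polynomial.X ^ w i -
      Polynomial.C (t.2 j * u.2 i) * Polynomial.X ^ w j
    have hG : G ≠ 0 := by
      intro h
      have := congrArg (fun p => Polynomial.coeff p (w i)) h
      simp only [G, Polynomial.coeff_sub, Polynomial.coeff_C_mul, Polynomial.coeff_X_pow, if_pos, if_neg hij,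
        mul_one, mul_zero, sub_zero, Polynomial.coeff_zero] at this
      exact mul_ne_zero (n1 t ht i) (n2 u hu j) this
    filter_upwards [poly_cofinite G hG] with s hs
    refine ⟨i, j, fun h => hs ?_⟩
    simp only [mv] at h
    simp only [G, Polynomial.eval_sub, Polynomial.eval_mul, Polynomial.eval_C, Polynomial.eval_pow,
      Polynomial.eval_X]
    linear_combination h
  obtain ⟨s, g1, s0, g3⟩ := (ev1.and (ev2.and ev3)).exists
  refine ⟨pts1.map (mv w s) ++ pts2, ?_, ?_, ?_, ?_⟩
  · rw [List.map_append, List.map_map, ← Multiset.coe_add, e2, ← e1]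
    rfl
  · intro t ht j
    rcases List.mem_append.1 ht with h | h
    · obtain ⟨t', h', rfl⟩ := List.mem_map.1 h
      exact mul_ne_zero (pow_ne_zero _ s0) (n1 t' h' j)
    · exact n2 t h j
  · rw [List.pairwise_append]
    refine ⟨?_, d2, ?_⟩
    · rw [List.pairwise_map]
      refine d1.imp ?_
      rintro t u ⟨i, j, hij⟩
      refine ⟨i, j, fun h => hij ?_⟩
      simp only [mv] at h
      have hs : s ^ w i * s ^ w j ≠ 0 := mul_ne_zero (pow_ne_zero _ s0) (pow_ne_zero _ s0)
      apply mul_left_cancel₀ hs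
      linear_combination h
    · intro t ht u hu
      obtain ⟨t', h', rfl⟩ := List.mem_map.1 ht
      exact g3 t' h' u hu
  · intro cf hcf
    let v : (S1 ⊕ S2) → ℚ := Sum.elim (fun a => cf a.1 * (s ^ (c - dotw w a.1))⁻¹) (fun a => cf a.1)
    have hv : v = 0 := by
      apply g1
      intro k
      rw [Fintype.sum_sum_type]
      cases k with
      | inl x =>
        obtain ⟨⟨t, ν⟩, hx⟩ := x
        have hx' := (hK1 _).1 hx
        have := hcf (mv w s t) (List.mem_append_left _ (List.mem_map.2 ⟨t, hx'.1, rfl⟩)) ν hx'.2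
        rw [Finset.sum_union hdisj, ← Finset.sum_coe_sort S1, ← Finset.sum_coe_sort S2] at this
        have hs : s ^ c ≠ 0 := pow_ne_zero _ s0
        apply mul_left_cancel₀ hs
        rw [mul_zero, ← this, mul_add, Finset.mul_sum, Finset.mul_sum]
        congr 1
        · refine Finset.sum_congr rfl fun a _ => ?_
          have hle := h1 a.1 a.2
          have : s ^ c = s ^ dotw w a.1 * s ^ (c - dotw w a.1) := by
            rw [← pow_add]; congr 1; omega
          rw [mon_mv]
          simp only [A, v, val, Sum.elim_inl, Polynomial.eval_C]
          rw [this]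
          have := pow_ne_zero (c - dotw w a.1) s0
          field_simp
        · refine Finset.sum_congr rfl fun a _ => ?_
          have hle := h2 a.1 a.2
          have : s ^ dotw w a.1 = s ^ c * s ^ (dotw w a.1 - c) := by
            rw [← pow_add]; congr 1; omega
          rw [mon_mv, this]
          simp only [A, v, val, Sum.elim_inl, Sum.elim_inr, Polynomial.eval_C, Polynomial.eval_mul,
            Polynomial.eval_pow, Polynomial.eval_X]
          ring
      | inr x =>
        obtain ⟨⟨t, ν⟩, hx⟩ := x
        have hx' := (hK2 _).1 hx
        have := hcf t (List.mem_append_right _ hx'.1) ν hx'.2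
        rw [Finset.sum_union hdisj, ← Finset.sum_coe_sort S1, ← Finset.sum_coe_sort S2] at this
        rw [← this]
        congr 1
        · refine Finset.sum_congr rfl fun a _ => ?_
          simp only [A, v, val, Sum.elim_inl, Sum.elim_inr, Polynomial.eval_C, Polynomial.eval_mul,
            Polynomial.eval_pow, Polynomial.eval_X]
          have := pow_ne_zero (c - dotw w a.1) s0
          field_simp
        · refine Finset.sum_congr rfl fun a _ => ?_
          simp only [A, v, val, Sum.elim_inr, Polynomial.eval_C]
          ring
    intro a ha
    rcases Finset.mem_union.1 ha with h | h
    · have := congrFun hv (Sum.inl ⟨a, h⟩)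
      simp only [v, Sum.elim_inl, Pi.zero_apply, mul_eq_zero, inv_eq_zero] at this
      rcases this with h | h
      · exact h
      · exact absurd h (pow_ne_zero _ s0)
    · exact congrFun hv (Sum.inr ⟨a, h⟩)

theorem PP_empty_zero : PP ∅ 0 := ⟨[], rfl, by simp, List.Pairwise.nil, by intro c _ a ha; simp at ha⟩

theorem PP_single {S : Finset ℕ} {m : ℕ} (h : ∀ c : ℕ → ℚ, (∀ ν : Fin 4 → ℕ, ∑ j, ν j < m →
    ∑ a ∈ S, c a * qf ν (ex a) = 0) → ∀ a ∈ S, c a = 0) : PP S {m} := by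
  refine ⟨[(m, fun _ => 1)], rfl, by simp, by simp, ?_⟩
  intro c hc
  apply h
  intro ν hν
  have := hc (m, fun _ => 1) (by simp) ν hν
  simpa [mon] using this

theorem PP_empty (ms : Multiset ℕ) : PP ∅ ms := by
  induction ms using Multiset.induction_on with
  | empty => exact PP_empty_zero
  | cons m ms ih =>
    have := glue (S1 := ∅) (S2 := ∅) (ms1 := {m}) (fun j => j.val) 0 ⟨0, 1, by simp⟩ (by simp) (by simp)
      (PP_single (by intro c _ a ha; simp at ha)) ih
    simpa using this

/-- Evaluate the number `n` before handing it to `f` (helps kernel evaluation). -/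
noncomputable def forceN {α : Type} (n : ℕ) (f : ℕ → α) : α :=
  Nat.rec (f 0) (fun k _ => f (Nat.succ k)) n
noncomputable def part {α : Type} (w c : ℕ) (l : List ℕ) :
    List ℕ → List ℕ → (List ℕ → List ℕ → α) → α :=
  List.rec (fun D R k => k D R) (fun a _ ih D R k =>
    Bool.rec (ih D (List.cons a R) k) (ih (List.cons a D) R k)
      (Nat.ble (Nat.mod (Nat.div (Nat.mul a w) 16777216) 256) c)) l
noncomputable def lenGe (l : List ℕ) : ℕ → Bool :=
  List.rec (fun n => Nat.beq n 0) (fun _ _ ih n => Nat.rec true (fun k _ => ih k) n) l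
noncomputable def lenEq (l : List ℕ) : ℕ → Bool :=
  List.rec (fun n => Nat.beq n 0) (fun _ _ ih n => Nat.rec false (fun k _ => ih k) n) l
/-- The base for packing vectors into numbers. -/
noncomputable def BB : ℕ := 411376139330301510538742295639337626245683966408394965837152256
noncomputable def cns (x t : ℕ) : ℕ := Nat.add x (Nat.mul BB t)
noncomputable def vec2 (a b c : ℕ) : ℕ := cns (Nat.add a (Nat.add (Nat.mul 256 b) (Nat.mul 65536 c))) (cns 1 (cns b c))
noncomputable def vec3 (a b c : ℕ) : ℕ :=
  cns (Nat.add a (Nat.add (Nat.mul 256 b) (Nat.mul 65536 c))) (cns 1 (cns b (cns c (cns (Nat.mul a (Nat.sub a 1)) (cns (Nat.mul a b) (cns (Nat.mul a c)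
  (cns (Nat.mul b (Nat.sub b 1)) (cns (Nat.mul b c) (Nat.mul c (Nat.sub c 1))))))))))
noncomputable def vec4 (a b c : ℕ) : ℕ :=
  cns (Nat.add a (Nat.add (Nat.mul 256 b) (Nat.mul 65536 c))) (cns 1 (cns b (cns c (cns (Nat.mul a (Nat.sub a 1)) (cns (Nat.mul a b) (cns (Nat.mul a c)
  (cns (Nat.mul b (Nat.sub b 1)) (cns (Nat.mul b c) (cns (Nat.mul c (Nat.sub c 1))
  (cns (Nat.mul (Nat.mul a (Nat.sub a 1)) (Nat.sub a 2))
  (cns (Nat.mul (Nat.mul a (Nat.sub a 1)) b) (cns (Nat.mul (Nat.mul a (Nat.sub a 1)) c)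
  (cns (Nat.mul a (Nat.mul b (Nat.sub b 1))) (cns (Nat.mul (Nat.mul a b) c)
  (cns (Nat.mul a (Nat.mul c (Nat.sub c 1)))
  (cns (Nat.mul (Nat.mul b (Nat.sub b 1)) (Nat.sub b 2))
  (cns (Nat.mul (Nat.mul b (Nat.sub b 1)) c) (cns (Nat.mul b (Nat.mul c (Nat.sub c 1)))
  (Nat.mul (Nat.mul c (Nat.sub c 1)) (Nat.sub c 2))))))))))))))))))))
noncomputable def vecP (v : ℕ → ℕ → ℕ → ℕ) (a : ℕ) : ℕ :=
  forceN (Nat.mod a 256) fun x => forceN (Nat.mod (Nat.div a 256) 256) fun y =>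
    forceN (Nat.mod (Nat.div a 65536) 256) fun z => v x y z
noncomputable def vecs (v : ℕ → ℕ → ℕ → ℕ) (l : List ℕ) : List ℕ → (List ℕ → Bool) → Bool :=
  List.rec (fun acc k => k acc)
    (fun a _ ih acc k => forceN (vecP v a) fun r => ih (List.cons r acc) k) l
/-- Find a digit of `v` that is nonzero mod 251; hand over the power of the base and the digit. -/
noncomputable def piv (v : ℕ) (n : ℕ) : ℕ → (ℕ → ℕ → Bool) → Bool :=
  Nat.rec (fun _ _ => false) (fun _ ih q k =>
    forceN (Nat.mod (Nat.mod (Nat.div v q) BB) 251) fun e =>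
      Nat.rec (forceN (Nat.mul q BB) fun q' => ih q' k) (fun _ _ => k q e) e) n
noncomputable def elimAll (v q e : ℕ) (l : List ℕ) : List ℕ → (List ℕ → Bool) → Bool :=
  List.rec (fun acc k => k acc) (fun u _ ih acc k =>
    forceN (Nat.add (Nat.mul e u)
      (Nat.mul (Nat.sub 251 (Nat.mod (Nat.mod (Nat.div u q) BB) 251)) v)) fun r =>
      ih (List.cons r acc) k) l
noncomputable def indepF (n : ℕ) : List ℕ → Bool :=
  Nat.rec (fun _ => false) (fun _ ih rows =>
    List.rec true (fun v us _ => piv v 20 1 fun q e => elimAll v q e us [] ih) rows) n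
noncomputable def indepL (v : ℕ → ℕ → ℕ → ℕ) (D : List ℕ) : Bool :=
  vecs v D [] (indepF 21)
noncomputable def spread (t : ℕ) : ℕ :=
  Nat.add (Nat.mul (Nat.mod t 16) 16777216) (Nat.add (Nat.mul (Nat.mod (Nat.div t 16) 16) 65536)
    (Nat.add (Nat.mul (Nat.mod (Nat.div t 256) 16) 256) (Nat.mod (Nat.div t 4096) 16)))
noncomputable def cutA (s : ℕ) (R : List ℕ) (k : List ℕ → List ℕ → Bool) : Bool :=
  Bool.rec
    (forceN (spread s) fun w => forceN (Nat.mod (Nat.div s 65536) 1024) fun c => part w c R [] [] k)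
    false (Nat.beq (Nat.mod s 65536) (Nat.mul (Nat.mod s 16) 4369))
noncomputable def nextS (s : ℕ) (k : ℕ → Bool) : Bool := forceN (Nat.div s 67108864) k
noncomputable def andB (a b : Bool) : Bool := Bool.rec false b a
/-- doubles -/
noncomputable def chkE (n : ℕ) : List ℕ → ℕ → Bool :=
  Nat.rec (fun _ _ => false) (fun _ ih R s =>
    Bool.rec (indepL vec2 R)
      (cutA s R fun D R' => andB (lenEq D 4) (andB (indepL vec2 D) (nextS s (ih R')))) (lenGe R 5)) n
noncomputable def chkUE (n : ℕ) : List ℕ → ℕ → Bool :=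
  Nat.rec (fun _ _ => false) (fun _ ih R s =>
    Bool.rec (chkE 6 R s)
      (cutA s R fun D R' => andB (lenEq D 20) (andB (nextS s (chkE 5 D))
        (forceN (Nat.div s 1361129467683753853853498429727072845824) (ih R')))) (lenGe R 24)) n
noncomputable def chkUB (l : List (ℕ × ℕ)) : List ℕ → Bool :=
  List.rec (fun R => List.rec true (fun _ _ _ => false) R) (fun st _ ih R =>
    Prod.rec (fun s t =>
    cutA s R fun D R' => Nat.rec
        (andB (lenEq D 20) (andB (lenGe R' 26) (nextS s fun s1 => andB (cutA s1 D fun D1 D2 =>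
          andB (lenEq D1 10) (andB (lenEq D2 10) (andB (indepL vec3 D1) (indepL vec3 D2))))
          (andB (nextS s1 (chkE 5 D)) (ih R')))))
        (fun u _ => andB (Bool.rec (lenEq R' 0) true (lenEq D 10))
          (andB (indepL vec3 D) (andB (chkUE 30 R u) (ih R')))) t) st) l
noncomputable def chkUA (l : List (ℕ × List (ℕ × ℕ))) : List ℕ → Bool :=
  List.rec (fun R => List.rec true (fun _ _ _ => false) R) (fun su _ ih R =>
    Prod.rec (fun s u =>
    andB (chkUB u R) (cutA s R fun D R' => andB (Bool.rec (lenEq R' 0) true (lenEq D 20))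
      (andB (indepL vec4 D) (ih R')))) su) l
noncomputable def forceL (l : List ℕ) : List ℕ → (List ℕ → Bool) → Bool :=
  List.rec (fun acc k => k acc) (fun a _ ih acc k => forceN a fun r => ih (List.cons r acc) k) l
def simplexL (d : ℕ) : List ℕ :=
  (List.range (d+1)).flatMap fun a => (List.range (d+1-a)).flatMap fun b =>
    (List.range (d+1-a-b)).map fun c => a + 256*b + 65536*c + 16777216*(d-a-b-c)
noncomputable def chk (d : ℕ) (c : List (ℕ × List (ℕ × ℕ))) : Bool :=
  forceL (simplexL d) [] (chkUA c)

/-! ## Soundness of the elimination -/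

theorem forceN_eq {α : Type} (n : ℕ) (f : ℕ → α) : forceN n f = f n := by
  cases n <;> rfl

theorem lenGe_iff (l : List ℕ) (n : ℕ) : lenGe l n = true ↔ n ≤ l.length := by
  induction l generalizing n with
  | nil =>
    change Nat.beq n 0 = true ↔ _
    simp
  | cons a l ih =>
    cases n with
    | zero =>
      change true = true ↔ _
      simp
    | succ k =>
      change lenGe l k = true ↔ _
      rw [ih]; simp

theorem lenEq_iff (l : List ℕ) (n : ℕ) : lenEq l n = true ↔ l.length = n := by
  induction l generalizing n with
  | nil =>
    change Nat.beq n 0 = true ↔ _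
    rw [Nat.beq_eq, List.length_nil]
    exact eq_comm
  | cons a l ih =>
    cases n with
    | zero =>
      change false = true ↔ _
      simp
    | succ k =>
      change lenEq l k = true ↔ _
      rw [ih]; simp

theorem andB_iff (a b : Bool) : andB a b = true ↔ a = true ∧ b = true := by
  cases a <;> cases b <;> decide

/-- Pack the first `n` entries of a vector. -/
noncomputable def pkf : ℕ → (ℕ → ℕ) → ℕ
  | 0, _ => 0
  | n + 1, v => v 0 + BB * pkf n (fun k => v (k + 1))

theorem BB_eq : BB = 2 ^ 208 := by
  unfold BB; norm_num

theorem BB_pos : 0 < BB := by rw [BB_eq]; positivity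

theorem pkf_lin (n e f : ℕ) (u v : ℕ → ℕ) :
    pkf n (fun k => e * u k + f * v k) = e * pkf n u + f * pkf n v := by
  induction n generalizing u v with
  | zero => simp [pkf]
  | succ n ih =>
    simp only [pkf]
    rw [ih (fun k => u (k + 1)) (fun k => v (k + 1))]
    ring

theorem pkf_digit (n : ℕ) (v : ℕ → ℕ) (hv : ∀ k, v k < BB) (k : ℕ) (hk : k < n) :
    pkf n v / BB ^ k % BB = v k := by
  induction n generalizing v k with
  | zero => omega
  | succ n ih =>
    cases k with
    | zero => simp [pkf, Nat.mod_eq_of_lt (hv 0)]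
    | succ k =>
      simp only [pkf]
      rw [pow_succ', ← Nat.div_div_eq_div_mul, Nat.add_mul_div_left _ _ BB_pos,
        Nat.div_eq_of_lt (hv 0), zero_add]
      exact ih (fun k => v (k + 1)) (fun k => hv (k + 1)) k (by omega)

/-- Linear independence modulo 251 of a list of labelled vectors. -/
def LI (L : List (ℕ × (ℕ → ℕ))) : Prop :=
  ∀ c : ℕ → ℤ, (∀ k, k < 20 → (251 : ℤ) ∣ (L.map fun x => c x.1 * (x.2 k : ℤ)).sum) →
    ∀ x ∈ L, (251 : ℤ) ∣ c x.1

theorem piv_sound (v n : ℕ) (q : ℕ) (k : ℕ → ℕ → Bool) (i : ℕ) (hq : q = BB ^ i)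
    (h : piv v n q k = true) : ∃ j, i ≤ j ∧ j < i + n ∧ v / BB ^ j % BB % 251 ≠ 0 ∧
      k (BB ^ j) (v / BB ^ j % BB % 251) = true := by
  induction n generalizing q i with
  | zero => exact absurd h (by change ¬ (false = true); simp)
  | succ n ih =>
    have h' : forceN (v / q % BB % 251) (fun e =>
      Nat.rec (forceN (q * BB) fun q' => piv v n q' k) (fun _ _ => k q e) e) = true := h
    rw [forceN_eq] at h'
    rcases he : v / q % BB % 251 with _ | e
    · rw [he] at h'
      change forceN (q * BB) (fun q' => piv v n q' k) = true at h'
      rw [forceN_eq] at h'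
      obtain ⟨j, h1, h2, h3⟩ := ih (q * BB) (i + 1) (by rw [hq, pow_succ]) h'
      exact ⟨j, by omega, by omega, h3⟩
    · rw [he] at h'
      change k q (e + 1) = true at h'
      subst hq
      refine ⟨i, le_refl _, by omega, by omega, ?_⟩
      have hfin := h'
      rw [he]
      exact hfin

/-- The elimination step. -/
noncomputable def elim1 (v q e u : ℕ) : ℕ := e * u + (251 - u / q % BB % 251) * v

theorem elimAll_eq (v q e : ℕ) (l acc : List ℕ) (k : List ℕ → Bool) :
    elimAll v q e l acc k = k ((l.map (elim1 v q e)).reverse ++ acc) := by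
  induction l generalizing acc with
  | nil => rfl
  | cons u l ih =>
    change forceN (elim1 v q e u) (fun r => elimAll v q e l (r :: acc) k) = _
    rw [forceN_eq, ih]
    simp

theorem vecs_eq (v : ℕ → ℕ → ℕ → ℕ) (l acc : List ℕ) (k : List ℕ → Bool) :
    vecs v l acc k = k ((l.map (vecP v)).reverse ++ acc) := by
  induction l generalizing acc with
  | nil => rfl
  | cons u l ih =>
    change forceN (vecP v u) (fun r => vecs v l (r :: acc) k) = _
    rw [forceN_eq, ih]
    simp

theorem LI_step (x : ℕ × (ℕ → ℕ)) (L : List (ℕ × (ℕ → ℕ))) (j : ℕ) (hj : j < 20)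
    (hne : x.2 j % 251 ≠ 0)
    (h : LI ((L.map fun y => (y.1, fun k => x.2 j % 251 * y.2 k +
      (251 - y.2 j % 251) * x.2 k)).reverse)) : LI (x :: L) := by
  intro c hc
  have hp : Prime (251 : ℤ) := by
    exact Int.prime_iff_natAbs_prime.2 (by norm_num)
  have dv : ∀ z : ℤ, (251 : ℤ) ∣ z ↔ (z : ZMod 251) = 0 := fun z =>
    (ZMod.intCast_zmod_eq_zero_iff_dvd z 251).symm
  have hdj := hc j hj
  have e1 : ∀ n : ℕ, ((n % 251 : ℕ) : ZMod 251) = n := fun n => ZMod.natCast_mod n 251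
  have hsum : ∀ k, k < 20 → ((L.map fun y => c y.1 * (y.2 k : ℤ)).sum : ZMod 251) =
      - (c x.1 * x.2 k) := by
    intro k hk
    have := hc k hk
    rw [dv] at this
    rw [List.map_cons, List.sum_cons] at this
    push_cast at this
    push_cast
    linear_combination this
  have hL : ∀ y ∈ L, (251 : ℤ) ∣ c y.1 := by
    have := h c (by
      intro k hk
      rw [List.map_reverse, List.sum_reverse, List.map_map, dv]
      have key : ∀ M : List (ℕ × (ℕ → ℕ)),
          (((M.map ((fun y : ℕ × (ℕ → ℕ) => c y.1 * (y.2 k : ℤ)) ∘ fun y => (y.1, fun k =>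
            x.2 j % 251 * y.2 k + (251 - y.2 j % 251) * x.2 k))).sum : ℤ) : ZMod 251) =
          (x.2 j : ZMod 251) * ((M.map fun y => c y.1 * (y.2 k : ℤ)).sum : ℤ) -
          (x.2 k : ZMod 251) * ((M.map fun y => c y.1 * (y.2 j : ℤ)).sum : ℤ) := by
        intro M
        induction M with
        | nil => simp
        | cons y M ih =>
          simp only [List.map_cons, List.sum_cons, Function.comp_apply]
          rw [Int.cast_add, ih]
          have hs : ((251 - y.2 j % 251 : ℕ) : ZMod 251) = - (y.2 j : ZMod 251) := by
            rw [Nat.cast_sub (Nat.mod_lt _ (by norm_num)).le, e1]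
            have : ((251 : ℕ) : ZMod 251) = 0 := ZMod.natCast_self 251
            rw [this, zero_sub]
          have hx := e1 (x.2 j)
          clear ih
          generalize x.2 j % 251 = E at hx ⊢
          push_cast [hs, hx]
          ring
      rw [key, hsum k hk, hsum j hj]
      ring)
    intro y hy
    have h3 := this _ (List.mem_reverse.2 (List.mem_map.2 ⟨y, hy, rfl⟩))
    exact h3
  intro y hy
  rcases List.mem_cons.1 hy with rfl | hy
  · have h0 : (251 : ℤ) ∣ (L.map fun y => c y.1 * (y.2 j : ℤ)).sum := by
      apply List.dvd_sum
      intro z hz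
      obtain ⟨y, hy, rfl⟩ := List.mem_map.1 hz
      exact Dvd.dvd.mul_right (hL y hy) _
    rw [List.map_cons, List.sum_cons] at hdj
    have h1 := (dvd_add_left h0).1 hdj
    rcases hp.dvd_or_dvd h1 with h2 | h2
    · exact h2
    · exfalso; apply hne; omega
  · exact hL y hy

theorem bound_aux {e f u v T : ℕ} (he : e ≤ 250) (hf : f ≤ 251) (hu : u < T) (hv : v < T) :
    e * u + f * v < 512 * T := by
  have f1 := Nat.mul_le_mul he hu.le
  have f2 := Nat.mul_le_mul hf hv.le
  omega

theorem indepF_sound (n : ℕ) (hn : n ≤ 21) (rows : List ℕ) (L : List (ℕ × (ℕ → ℕ)))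
    (hr : rows = L.map fun x => pkf 20 x.2) (hb : ∀ x ∈ L, ∀ k, x.2 k < 2 ^ (213 - 9 * n))
    (h : indepF n rows = true) : LI L := by
  induction n generalizing rows L with
  | zero => exact absurd h (by change ¬ (false = true); simp)
  | succ n ih =>
    cases L with
    | nil => intro c _ x hx; simp at hx
    | cons x L =>
      subst hr
      have h' : piv (pkf 20 x.2) 20 1 (fun q e => elimAll (pkf 20 x.2) q e
        (L.map fun x => pkf 20 x.2) [] (indepF n)) = true := h
      obtain ⟨j, -, hj, hne, hk⟩ := piv_sound _ _ _ _ 0 (by simp) h'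
      have hB : ∀ y ∈ x :: L, ∀ k, y.2 k < BB := by
        intro y hy k
        refine lt_of_lt_of_le (hb y hy k) ?_
        rw [BB_eq]
        exact Nat.pow_le_pow_right (by norm_num) (by omega)
      have hj' : j < 20 := by omega
      rw [pkf_digit 20 x.2 (hB x (by simp)) j hj'] at hne hk
      rw [elimAll_eq, List.append_nil] at hk
      apply LI_step x L j hj' hne
      refine ih (by omega) _ _ ?_ ?_ hk
      · rw [List.map_reverse, List.map_map, List.map_map]
        refine congrArg List.reverse (List.map_congr_left ?_)
        intro y hy
        simp only [Function.comp, elim1]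
        rw [pkf_digit 20 y.2 (hB y (List.mem_cons_of_mem _ hy)) j hj', pkf_lin]
      · intro z hz k
        obtain ⟨y, hy, rfl⟩ := List.mem_map.1 (List.mem_reverse.1 hz)
        have b1 := hb x (by simp) k
        have b2 := hb y (List.mem_cons_of_mem _ hy) k
        have e1 : x.2 j % 251 ≤ 250 := by have := Nat.mod_lt (x.2 j) (show 0 < 251 by norm_num); omega
        have e2 : 251 - y.2 j % 251 ≤ 251 := by omega
        have e3 : 2 ^ (213 - 9 * n) = 512 * 2 ^ (213 - 9 * (n + 1)) := by
          rw [show 213 - 9 * n = 9 + (213 - 9 * (n + 1)) by omega, pow_add]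
          norm_num
        simp only
        rw [e3]
        exact bound_aux e1 e2 b2 b1

/-- Independence modulo 251 implies independence over the rationals. -/
theorem LI_rat {L : List (ℕ × (ℕ → ℕ))} (h : LI L) (c : ℕ → ℚ)
    (hc : ∀ k, k < 20 → (L.map fun x => c x.1 * (x.2 k : ℚ)).sum = 0) : ∀ x ∈ L, c x.1 = 0 := by
  have hZ : ∀ n : ℕ, ∀ c : ℕ → ℤ, (∀ k, k < 20 → (L.map fun x => c x.1 * (x.2 k : ℤ)).sum = 0) →
      ∀ x ∈ L, (251 : ℤ) ^ n ∣ c x.1 := by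
    intro n
    induction n with
    | zero => simp
    | succ n ih =>
      intro c hc x hx
      have hd := h c (fun k hk => by rw [hc k hk]; exact dvd_zero _)
      have := ih (fun a => c a / 251) (by
        intro k hk
        have h1 := hc k hk
        have h2 : (L.map fun x => c x.1 * (x.2 k : ℤ)) =
            (L.map fun x => 251 * (c x.1 / 251 * (x.2 k : ℤ))) := by
          apply List.map_congr_left
          intro y hy
          obtain ⟨t, ht⟩ := hd y hy
          rw [ht, Int.mul_ediv_cancel_left _ (by norm_num)]
          ring
        rw [h2, List.sum_map_mul_left] at h1
        simpa using h1) x hx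
      obtain ⟨t, ht⟩ := hd x hx
      rw [ht, Int.mul_ediv_cancel_left _ (by norm_num)] at this
      rw [ht, pow_succ']
      exact mul_dvd_mul_left _ this
  let N : ℕ := (L.map fun x => (c x.1).den).prod
  have hN : N ≠ 0 := by
    apply List.prod_ne_zero
    intro h0
    obtain ⟨x, _, hx⟩ := List.mem_map.1 h0
    exact (c x.1).den_nz hx
  let c' : ℕ → ℤ := fun a => (N * c a).num
  have hc' : ∀ x ∈ L, ((c' x.1 : ℤ) : ℚ) = N * c x.1 := by
    intro x hx
    have hdvd : (c x.1).den ∣ N := List.dvd_prod (List.mem_map.2 ⟨x, hx, rfl⟩)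
    obtain ⟨t, ht⟩ := hdvd
    have : (N : ℚ) * c x.1 = ((t * (c x.1).num : ℤ) : ℚ) := by
      rw [ht]
      push_cast
      have := Rat.den_mul_eq_num (c x.1)
      linear_combination (t : ℚ) * this
    simp only [c']
    rw [this, Rat.num_intCast]
  intro x hx
  have h0 : c' x.1 = 0 := by
    have hall : ∀ n : ℕ, (251 : ℤ) ^ n ∣ c' x.1 := by
      intro n
      refine hZ n c' ?_ x hx
      intro k hk
      have : (((L.map fun x => c' x.1 * (x.2 k : ℤ)).sum : ℤ) : ℚ) = 0 := by
        rw [Int.cast_list_sum, List.map_map]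
        have h2 : (L.map ((fun z : ℤ => (z : ℚ)) ∘ fun x => c' x.1 * (x.2 k : ℤ))) =
            (L.map fun x => (N : ℚ) * (c x.1 * (x.2 k : ℚ))) := by
          apply List.map_congr_left
          intro y hy
          simp only [Function.comp]
          push_cast
          rw [hc' y hy]
          ring
        rw [h2, List.sum_map_mul_left, hc k hk, mul_zero]
      exact_mod_cast this
    by_contra hne
    have h1 := Int.natAbs_dvd_natAbs.2 (hall (c' x.1).natAbs)
    rw [Int.natAbs_pow] at h1
    have h2 := Nat.le_of_dvd (Int.natAbs_pos.2 hne) h1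
    have h3 : (c' x.1).natAbs < 251 ^ (c' x.1).natAbs := Nat.lt_pow_self (by norm_num)
    simp at h2
    omega
  have := hc' x hx
  rw [h0] at this
  have hN' : (N : ℚ) ≠ 0 := by exact_mod_cast hN
  simpa [hN'] using this.symm

/-! ## Soundness of the checker -/

/-- Products of falling factorials of the first three exponents. -/
def FF (a : ℕ) (t : ℕ × ℕ × ℕ) : ℕ :=
  (a % 256).descFactorial t.1 * (a / 256 % 256).descFactorial t.2.1 *
    (a / 65536 % 256).descFactorial t.2.2

/-- The digits of the packed vectors. -/
def dig (nus : List (ℕ × ℕ × ℕ)) (a : ℕ) : ℕ → ℕ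
  | 0 => a % 256 + 256 * (a / 256 % 256) + 65536 * (a / 65536 % 256)
  | k + 1 => (nus.map (FF a)).getD k 0

theorem qf_FF (a i j l : ℕ) : qf ![i, j, l, 0] (ex a) = (FF a (i, j, l) : ℚ) := by
  simp [qf, Fin.prod_univ_four, ex, FF]

theorem FF_lt (a : ℕ) (t : ℕ × ℕ × ℕ) (ht : t.1 + t.2.1 + t.2.2 ≤ 3) : FF a t < 2 ^ 24 := by
  have h : ∀ x i : ℕ, (x % 256).descFactorial i ≤ 255 ^ i := by
    intro x i
    refine (Nat.descFactorial_le_pow _ _).trans (Nat.pow_le_pow_left ?_ _)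
    have := Nat.mod_lt x (show 0 < 256 by norm_num)
    omega
  have h1 := Nat.mul_le_mul (Nat.mul_le_mul (h a t.1) (h (a / 256) t.2.1)) (h (a / 65536) t.2.2)
  rw [← pow_add, ← pow_add] at h1
  refine lt_of_le_of_lt h1 (lt_of_le_of_lt (Nat.pow_le_pow_right (by norm_num) ht) (by norm_num))

theorem indepL_sound (v : ℕ → ℕ → ℕ → ℕ) (m : ℕ) (hm2 : 2 ≤ m) (hm4 : m ≤ 4)
    (nus : List (ℕ × ℕ × ℕ)) (hn : ∀ t ∈ nus, t.1 + t.2.1 + t.2.2 < m)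
    (hv : ∀ a, vecP v a = pkf 20 (dig nus a)) (D : List ℕ) (hD : D.Nodup)
    (h : indepL v D = true) : PP D.toFinset {m} := by
  apply PP_single
  intro c hc
  have hF : ∀ t : ℕ × ℕ × ℕ, t.1 + t.2.1 + t.2.2 < m → ∑ a ∈ D.toFinset, c a * (FF a t : ℚ) = 0 := by
    rintro ⟨i, j, l⟩ ht
    have := hc ![i, j, l, 0] (by simpa [Fin.sum_univ_four] using ht)
    simpa only [qf_FF] using this
  unfold indepL at h
  rw [vecs_eq, List.append_nil, ← List.map_reverse] at h
  have hLI := indepF_sound 21 (le_refl _) _ (D.reverse.map fun a => (a, dig nus a)) (by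
    rw [List.map_map]
    exact List.map_congr_left fun a _ => hv a) (by
    intro x hx k
    obtain ⟨a, _, rfl⟩ := List.mem_map.1 hx
    cases k with
    | zero => simp only [dig]; omega
    | succ k =>
      simp only [dig]
      by_cases hk : k < nus.length
      · rw [List.getD_eq_getElem _ _ (by simpa using hk), List.getElem_map]
        have := hn _ (List.getElem_mem hk)
        exact FF_lt _ _ (by omega)
      · rw [List.getD_eq_default _ _ (by simpa using hk)]
        norm_num) h
  have := LI_rat hLI c (by
    intro k _
    rw [List.map_map, List.map_reverse, List.sum_reverse]
    have hs : (D.map ((fun x : ℕ × (ℕ → ℕ) => c x.1 * (x.2 k : ℚ)) ∘ fun a => (a, dig nus a))).sum =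
        ∑ a ∈ D.toFinset, c a * (dig nus a k : ℚ) := by
      rw [List.sum_toFinset _ hD]
      rfl
    rw [hs]
    cases k with
    | zero =>
      have h1 := hF (1, 0, 0) (by simp; omega)
      have h2 := hF (0, 1, 0) (by simp; omega)
      have h3 := hF (0, 0, 1) (by simp; omega)
      have : ∑ a ∈ D.toFinset, c a * (dig nus a 0 : ℚ) =
          ∑ a ∈ D.toFinset, c a * (FF a (1, 0, 0) : ℚ) +
          256 * ∑ a ∈ D.toFinset, c a * (FF a (0, 1, 0) : ℚ) +
          65536 * ∑ a ∈ D.toFinset, c a * (FF a (0, 0, 1) : ℚ) := by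
        rw [Finset.mul_sum, Finset.mul_sum, ← Finset.sum_add_distrib, ← Finset.sum_add_distrib]
        refine Finset.sum_congr rfl fun a _ => ?_
        simp only [dig, FF, Nat.descFactorial_one, Nat.descFactorial_zero]
        generalize a % 256 = x
        generalize a / 256 % 256 = y
        generalize a / 65536 % 256 = z
        push_cast
        ring
      rw [this, h1, h2, h3]
      ring
    | succ k =>
      by_cases hk : k < nus.length
      · rw [← hF _ (hn _ (List.getElem_mem hk))]
        refine Finset.sum_congr rfl fun a _ => ?_
        simp only [dig]
        rw [List.getD_eq_getElem _ _ (by simpa using hk), List.getElem_map]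
      · apply Finset.sum_eq_zero
        intro a _
        simp only [dig]
        rw [List.getD_eq_default _ _ (by simpa using hk)]
        simp)
  intro a ha
  exact this (a, dig nus a) (List.mem_map.2 ⟨a, by simpa using ha, rfl⟩)

theorem raw_mod (a b : ℕ) : Nat.mod a b = a % b := rfl

theorem raw_div (a b : ℕ) : Nat.div a b = a / b := rfl

theorem vec2_sound (D : List ℕ) (hD : D.Nodup) (h : indepL vec2 D = true) : PP D.toFinset {2} := by
  refine indepL_sound vec2 2 (by norm_num) (by norm_num) [(0, 0, 0), (0, 1, 0), (0, 0, 1)]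
    (by decide) ?_ D hD h
  intro a
  simp only [vecP, forceN_eq, vec2, cns, pkf, dig, FF, List.map, Nat.add_eq, Nat.mul_eq, Nat.sub_eq,
    List.getD_cons_zero, List.getD_cons_succ, List.getD_nil, Nat.descFactorial, Nat.sub_zero, raw_mod, raw_div]
  ring

theorem vec3_sound (D : List ℕ) (hD : D.Nodup) (h : indepL vec3 D = true) : PP D.toFinset {3} := by
  refine indepL_sound vec3 3 (by norm_num) (by norm_num) [(0, 0, 0), (0, 1, 0), (0, 0, 1),
    (2, 0, 0), (1, 1, 0), (1, 0, 1), (0, 2, 0), (0, 1, 1), (0, 0, 2)]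
    (by decide) ?_ D hD h
  intro a
  simp only [vecP, forceN_eq, vec3, cns, pkf, dig, FF, List.map, Nat.add_eq, Nat.mul_eq, Nat.sub_eq,
    List.getD_cons_zero, List.getD_cons_succ, List.getD_nil, Nat.descFactorial, Nat.sub_zero, raw_mod, raw_div]
  ring

theorem vec4_sound (D : List ℕ) (hD : D.Nodup) (h : indepL vec4 D = true) : PP D.toFinset {4} := by
  refine indepL_sound vec4 4 (by norm_num) (by norm_num) [(0, 0, 0), (0, 1, 0), (0, 0, 1),
    (2, 0, 0), (1, 1, 0), (1, 0, 1), (0, 2, 0), (0, 1, 1), (0, 0, 2),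
    (3, 0, 0), (2, 1, 0), (2, 0, 1), (1, 2, 0), (1, 1, 1), (1, 0, 2), (0, 3, 0), (0, 2, 1),
    (0, 1, 2), (0, 0, 3)]
    (by decide) ?_ D hD h
  intro a
  simp only [vecP, forceN_eq, vec4, cns, pkf, dig, FF, List.map, Nat.add_eq, Nat.mul_eq, Nat.sub_eq,
    List.getD_cons_zero, List.getD_cons_succ, List.getD_nil, Nat.descFactorial, Nat.sub_zero, raw_mod, raw_div]
  ring

/-- A valid list of monomial codes. -/
def VL (R : List ℕ) : Prop :=
  R.Nodup ∧ ∀ a ∈ R, ∃ x y z t : ℕ, x + y + z + t ≤ 13 ∧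
    a = x + 256 * y + 65536 * z + 16777216 * t

/-- The list `R` is cut into `D` and `R'` by a half space. -/
def CutL (R D R' : List ℕ) : Prop :=
  (D ++ R').Perm R ∧ ∃ (w : Fin 4 → ℕ) (c : ℕ), (∃ i j, w i ≠ w j) ∧
    (∀ a ∈ D, dotw w a ≤ c) ∧ (∀ a ∈ R', c < dotw w a)

theorem part_eq {α : Type} (w c : ℕ) (l D R : List ℕ) (k : List ℕ → List ℕ → α) :
    part w c l D R k =
      k ((l.filter fun a => Nat.ble (a * w / 16777216 % 256) c).reverse ++ D)
        ((l.filter fun a => !Nat.ble (a * w / 16777216 % 256) c).reverse ++ R) := by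
  induction l generalizing D R with
  | nil => rfl
  | cons a l ih =>
    have h : part w c (a :: l) D R k = Bool.rec (part w c l D (a :: R) k) (part w c l (a :: D) R k)
      (Nat.ble (a * w / 16777216 % 256) c) := rfl
    rw [h]
    cases hb : Nat.ble (a * w / 16777216 % 256) c
    · simp only [ih, List.filter_cons, hb]
      simp
    · simp only [ih, List.filter_cons, hb]
      simp

theorem dot_eq (s x y z t : ℕ) (h : x + y + z + t ≤ 13) :
    (x + 256 * y + 65536 * z + 16777216 * t) * spread s / 16777216 % 256 =
      dotw ![s % 16, s / 16 % 16, s / 256 % 16, s / 4096 % 16]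
        (x + 256 * y + 65536 * z + 16777216 * t) := by
  have e0 : (x + 256 * y + 65536 * z + 16777216 * t) % 256 = x := by omega
  have e1 : (x + 256 * y + 65536 * z + 16777216 * t) / 256 % 256 = y := by
    have : (x + 256 * y + 65536 * z + 16777216 * t) / 256 = y + 256 * z + 65536 * t := by
      rw [Nat.div_eq_iff (by norm_num)]
      omega
    omega
  have e2 : (x + 256 * y + 65536 * z + 16777216 * t) / 65536 % 256 = z := by
    have : (x + 256 * y + 65536 * z + 16777216 * t) / 65536 = z + 256 * t := by
      rw [Nat.div_eq_iff (by norm_num)]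
      omega
    omega
  have e3 : (x + 256 * y + 65536 * z + 16777216 * t) / 16777216 % 256 = t := by
    have : (x + 256 * y + 65536 * z + 16777216 * t) / 16777216 = t := by
      rw [Nat.div_eq_iff (by norm_num)]
      omega
    omega
  have hd : dotw ![s % 16, s / 16 % 16, s / 256 % 16, s / 4096 % 16]
        (x + 256 * y + 65536 * z + 16777216 * t) =
      s % 16 * x + s / 16 % 16 * y + s / 256 % 16 * z + s / 4096 % 16 * t := by
    simp [dotw, Fin.sum_univ_four, ex, e0, e1, e2, e3]
  rw [hd]
  have hs : spread s = s % 16 * 16777216 + (s / 16 % 16 * 65536 + (s / 256 % 16 * 256 + s / 4096 % 16)) := rfl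
  rw [hs]
  have b0 : s % 16 ≤ 15 := by omega
  have b1 : s / 16 % 16 ≤ 15 := by omega
  have b2 : s / 256 % 16 ≤ 15 := by omega
  have b3 : s / 4096 % 16 ≤ 15 := by omega
  clear e0 e1 e2 e3 hd hs
  generalize s % 16 = w0 at *
  generalize s / 16 % 16 = w1 at *
  generalize s / 256 % 16 = w2 at *
  generalize s / 4096 % 16 = w3 at *
  have m0 : ∀ u, w0 * u ≤ 15 * u := fun u => Nat.mul_le_mul_right u b0
  have m1 : ∀ u, w1 * u ≤ 15 * u := fun u => Nat.mul_le_mul_right u b1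
  have m2 : ∀ u, w2 * u ≤ 15 * u := fun u => Nat.mul_le_mul_right u b2
  have m3 : ∀ u, w3 * u ≤ 15 * u := fun u => Nat.mul_le_mul_right u b3
  have hp : (x + 256 * y + 65536 * z + 16777216 * t) * (w0 * 16777216 + (w1 * 65536 + (w2 * 256 + w3))) =
      (w3 * x + 256 * (w2 * x + w3 * y) + 65536 * (w1 * x + w2 * y + w3 * z)) +
      16777216 * (w0 * x + w1 * y + w2 * z + w3 * t) +
      4294967296 * ((w0 * y + w1 * z + w2 * t) + 256 * (w0 * z + w1 * t) + 65536 * (w0 * t)) := by ring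
  rw [hp]
  have := m0 x
  have := m1 x
  have := m2 x
  have := m3 x
  have := m1 y
  have := m2 y
  have := m3 y
  have := m2 z
  have := m3 z
  have := m3 t
  clear m0 m1 m2 m3 hp
  generalize w0 * x = a0 at *
  generalize w1 * x = a1 at *
  generalize w2 * x = a2 at *
  generalize w3 * x = a3 at *
  generalize w1 * y = a4 at *
  generalize w2 * y = a5 at *
  generalize w3 * y = a6 at *
  generalize w2 * z = a7 at *
  generalize w3 * z = a8 at *
  generalize w3 * t = a9 at *
  generalize w0 * y + w1 * z + w2 * t + 256 * (w0 * z + w1 * t) + 65536 * (w0 * t) = H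
  have hL : a3 + 256 * (a2 + a6) + 65536 * (a1 + a5 + a8) < 16777216 := by omega
  have hM : a0 + a4 + a7 + a9 < 256 := by omega
  generalize a3 + 256 * (a2 + a6) + 65536 * (a1 + a5 + a8) = L at *
  generalize a0 + a4 + a7 + a9 = M at *
  have : (L + 16777216 * M + 4294967296 * H) / 16777216 = M + 256 * H := by
    rw [Nat.div_eq_iff (by norm_num)]
    omega
  omega

theorem VL_perm {R D R' : List ℕ} (h : VL R) (hp : (D ++ R').Perm R) : VL D ∧ VL R' := by
  have hn := hp.nodup_iff.2 h.1
  refine ⟨⟨(List.nodup_append.1 hn).1, fun a ha => h.2 a (hp.subset (List.mem_append_left _ ha))⟩,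
    ⟨(List.nodup_append.1 hn).2.1, fun a ha => h.2 a (hp.subset (List.mem_append_right _ ha))⟩⟩

theorem cutA_sound (s : ℕ) (R : List ℕ) (k : List ℕ → List ℕ → Bool) (hR : VL R)
    (h : cutA s R k = true) : ∃ D R', k D R' = true ∧ CutL R D R' ∧ VL D ∧ VL R' := by
  unfold cutA at h
  cases hb : Nat.beq (Nat.mod s 65536) (Nat.mul (Nat.mod s 16) 4369)
  · rw [hb] at h
    simp only [forceN_eq] at h
    rw [part_eq] at h
    simp only [List.append_nil] at h
    refine ⟨_, _, h, ?_⟩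
    have hperm : ∀ p : ℕ → Bool, ((R.filter p).reverse ++ (R.filter fun a => !p a).reverse).Perm R := by
      intro p
      exact ((List.reverse_perm _).append (List.reverse_perm _)).trans (List.filter_append_perm p R)
    have hdot : ∀ a ∈ R, a * spread s / 16777216 % 256 =
        dotw ![s % 16, s / 16 % 16, s / 256 % 16, s / 4096 % 16] a := by
      intro a ha
      obtain ⟨x, y, z, t, h1, rfl⟩ := hR.2 a ha
      exact dot_eq s x y z t h1
    refine ⟨⟨hperm _, ![s % 16, s / 16 % 16, s / 256 % 16, s / 4096 % 16], Nat.mod (Nat.div s 65536) 1024,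
      ?_, ?_, ?_⟩, VL_perm hR (hperm _)⟩
    · by_contra hcon
      push Not at hcon
      have h1 := hcon 0 1
      have h2 := hcon 0 2
      have h3 := hcon 0 3
      simp at h1 h2 h3
      have hb' : ¬ (s % 65536 = s % 16 * 4369) := by
        intro hh
        have : Nat.beq (Nat.mod s 65536) (Nat.mul (Nat.mod s 16) 4369) = true := by
          rw [Nat.beq_eq]; exact hh
        rw [hb] at this
        exact absurd this (by simp)
      apply hb'
      have q1 : s / 256 = s / 16 / 16 := by rw [Nat.div_div_eq_div_mul]
      have q2 : s / 4096 = s / 16 / 16 / 16 := by rw [Nat.div_div_eq_div_mul, Nat.div_div_eq_div_mul]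
      have q3 : s / 65536 = s / 16 / 16 / 16 / 16 := by
        rw [Nat.div_div_eq_div_mul, Nat.div_div_eq_div_mul, Nat.div_div_eq_div_mul]
      rw [q1] at h2
      rw [q2] at h3
      have h4 := Nat.div_add_mod s 65536
      rw [q3] at h4
      omega
    · intro a ha
      have ha' := List.mem_filter.1 (List.mem_reverse.1 ha)
      rw [← hdot a ha'.1]
      exact Nat.le_of_ble_eq_true ha'.2
    · intro a ha
      have ha' := List.mem_filter.1 (List.mem_reverse.1 ha)
      rw [← hdot a ha'.1]
      by_contra hcon
      have := Nat.ble_eq_true_of_le (not_lt.1 hcon)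
      have h2 := ha'.2
      rw [this] at h2
      exact absurd h2 (by simp)
  · rw [hb] at h
    exact absurd h (by simp)

/-- The number of conditions imposed by fat points. -/
def wt (ms : Multiset ℕ) : ℕ := (ms.map fun m => (m + 2).choose 3).sum

theorem wt_add (a b : Multiset ℕ) : wt (a + b) = wt a + wt b := by simp [wt]

theorem wt_nsmul (n m : ℕ) : wt (n • ({m} : Multiset ℕ)) = n * (m + 2).choose 3 := by
  simp [wt, Multiset.nsmul_singleton]

/-- The fat points impose the expected number of conditions on the monomials in `R`. -/
def QL (R : List ℕ) (ms : Multiset ℕ) : Prop :=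
  ∃ D ⊆ R.toFinset, PP D ms ∧ min R.length (wt ms) ≤ D.card

theorem QL_zero (R : List ℕ) : QL R 0 := ⟨∅, by simp, PP_empty_zero, by simp [wt]⟩

theorem QL_nil (ms : Multiset ℕ) : QL [] ms := ⟨∅, by simp, PP_empty ms, by simp⟩

theorem QL_sub {R D R' : List ℕ} {ms : Multiset ℕ} (hsub : D.toFinset ⊆ R.toFinset)
    (hw : wt ms ≤ D.length) (h : QL D ms) (_ : R' = R') : QL R ms := by
  obtain ⟨E, h1, h2, h3⟩ := h
  refine ⟨E, h1.trans hsub, h2, ?_⟩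
  rw [min_eq_right hw] at h3
  exact (min_le_right _ _).trans h3

theorem QL_full {D : List ℕ} {ms : Multiset ℕ} (hw : D.length ≤ wt ms) (h : QL D ms) :
    PP D.toFinset ms := by
  obtain ⟨E, h1, h2, h3⟩ := h
  rw [min_eq_left hw] at h3
  have : E = D.toFinset := Finset.eq_of_subset_of_card_le h1 ((List.toFinset_card_le D).trans h3)
  rwa [← this]

theorem QL_cut {R D R' : List ℕ} {ms1 ms2 : Multiset ℕ} (hR : VL R) (hcut : CutL R D R')
    (hP : PP D.toFinset ms1) (hl : wt ms1 ≤ D.length ∨ R' = []) (hQ : QL R' ms2) :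
    QL R (ms1 + ms2) := by
  obtain ⟨hp, w, c, hw, h1, h2⟩ := hcut
  obtain ⟨E, e1, e2, e3⟩ := hQ
  have hE2 : ∀ a ∈ E, c < dotw w a := fun a ha => h2 a (by simpa using e1 ha)
  have hn := hp.nodup_iff.2 hR.1
  have hlen := hp.length_eq
  rw [List.length_append] at hlen
  refine ⟨D.toFinset ∪ E, ?_, glue w c hw (fun a ha => h1 a (by simpa using ha)) hE2 hP e2, ?_⟩
  · intro a ha
    rcases Finset.mem_union.1 ha with h | h
    · exact List.mem_toFinset.2 (hp.subset (List.mem_append_left _ (by simpa using h)))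
    · exact List.mem_toFinset.2 (hp.subset (List.mem_append_right _ (by simpa using e1 h)))
  · have hdis : Disjoint D.toFinset E := by
      rw [Finset.disjoint_left]
      intro a ha hb
      exact absurd (h1 a (by simpa using ha)) (not_le.2 (hE2 a hb))
    rw [Finset.card_union_of_disjoint hdis, List.toFinset_card_of_nodup (List.nodup_append.1 hn).1, wt_add]
    rcases hl with hl | hl
    · omega
    · subst hl
      simp at hlen
      omega

theorem CutL_self {R : List ℕ} : CutL R R [] := by
  refine ⟨by simp, ![1, 0, 0, 0], 256, ⟨0, 1, by simp⟩, ?_, by simp⟩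
  intro a _
  simp [dotw, Fin.sum_univ_four, ex]
  omega

theorem QL_self {R : List ℕ} {ms1 ms2 : Multiset ℕ} (hR : VL R) (hP : PP R.toFinset ms1) :
    QL R (ms1 + ms2) := QL_cut hR CutL_self hP (Or.inr rfl) (QL_nil _)

theorem CutL_sub {R D R' : List ℕ} (h : CutL R D R') :
    D.toFinset ⊆ R.toFinset ∧ R'.toFinset ⊆ R.toFinset := by
  constructor
  · intro a ha
    exact List.mem_toFinset.2 (h.1.subset (List.mem_append_left _ (by simpa using ha)))
  · intro a ha
    exact List.mem_toFinset.2 (h.1.subset (List.mem_append_right _ (by simpa using ha)))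

theorem chkE_sound (n : ℕ) (R : List ℕ) (s : ℕ) (hR : VL R) (h : chkE n R s = true) (z : ℕ) :
    QL R (z • {2}) := by
  induction n generalizing R s z with
  | zero => exact absurd h (by change ¬ (false = true); simp)
  | succ n ih =>
    cases z with
    | zero => rw [zero_smul]; exact QL_zero R
    | succ z =>
      rw [succ_nsmul']
      have h' : Bool.rec (indepL vec2 R)
        (cutA s R fun D R' => andB (lenEq D 4) (andB (indepL vec2 D) (nextS s (chkE n R')))) (lenGe R 5) = true := h
      cases hb : lenGe R 5
      · rw [hb] at h'
        exact QL_self hR (vec2_sound R hR.1 h')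
      · rw [hb] at h'
        obtain ⟨D, R', hk, hc, v1, v2⟩ := cutA_sound _ _ _ hR h'
        simp only [andB_iff, lenEq_iff, nextS, forceN_eq] at hk
        obtain ⟨k1, k2, k3⟩ := hk
        exact QL_cut hR hc (vec2_sound D v1.1 k2) (Or.inl (by rw [k1]; simp [wt])) (ih _ _ v2 k3 z)

theorem chkE_full {n : ℕ} {D : List ℕ} {s : ℕ} (hD : VL D) (hl : D.length = 20)
    (h : chkE n D s = true) : PP D.toFinset (5 • {2}) := by
  apply QL_full _ (chkE_sound n D s hD h 5)
  rw [hl, wt_nsmul]; decide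

theorem chkUE_sound (n : ℕ) (R : List ℕ) (s : ℕ) (hR : VL R) (h : chkUE n R s = true) (z : ℕ) :
    QL R (z • {2}) := by
  induction n generalizing R s z with
  | zero => exact absurd h (by change ¬ (false = true); simp)
  | succ n ih =>
    have h' : Bool.rec (chkE 6 R s)
      (cutA s R fun D R' => andB (lenEq D 20) (andB (nextS s (chkE 5 D))
        (forceN (Nat.div s 1361129467683753853853498429727072845824) (chkUE n R')))) (lenGe R 24) = true := h
    cases hb : lenGe R 24
    · rw [hb] at h'
      exact chkE_sound 6 R s hR h' z
    · rw [hb] at h'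
      obtain ⟨D, R', hk, hc, v1, v2⟩ := cutA_sound _ _ _ hR h'
      simp only [andB_iff, lenEq_iff, nextS, forceN_eq] at hk
      obtain ⟨k1, k2, k3⟩ := hk
      by_cases hz : 5 ≤ z
      · obtain ⟨z, rfl⟩ := Nat.exists_eq_add_of_le hz
        rw [add_nsmul]
        exact QL_cut hR hc (chkE_full v1 k1 k2)
          (Or.inl (by rw [k1, wt_nsmul]; decide)) (ih _ _ v2 k3 z)
      · refine QL_sub (R' := []) (CutL_sub hc).1 ?_ (chkE_sound _ _ _ v1 k2 z) rfl
        rw [k1, wt_nsmul, show Nat.choose (2 + 2) 3 = 4 by decide]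
        omega

theorem chkUB_sound (l : List (ℕ × ℕ)) (R : List ℕ) (hR : VL R) (h : chkUB l R = true) (y z : ℕ) :
    QL R (y • {3} + z • {2}) := by
  induction l generalizing R y z with
  | nil =>
    cases R with
    | nil => exact QL_nil _
    | cons a R => exact absurd h (by change ¬ (false = true); simp)
  | cons st l ih =>
    obtain ⟨s, t⟩ := st
    have h' : (cutA s R fun D R' => Nat.rec
        (andB (lenEq D 20) (andB (lenGe R' 26) (nextS s fun s1 => andB (cutA s1 D fun D1 D2 =>
          andB (lenEq D1 10) (andB (lenEq D2 10) (andB (indepL vec3 D1) (indepL vec3 D2))))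
          (andB (nextS s1 (chkE 5 D)) (chkUB l R')))))
        (fun u _ => andB (Bool.rec (lenEq R' 0) true (lenEq D 10))
          (andB (indepL vec3 D) (andB (chkUE 30 R u) (chkUB l R')))) t) = true := h
    obtain ⟨D, R', hk, hc, v1, v2⟩ := cutA_sound _ _ _ hR h'
    cases t with
    | zero =>
      change andB _ (andB _ _) = true at hk
      simp only [andB_iff, lenEq_iff, lenGe_iff, nextS, forceN_eq] at hk
      obtain ⟨k1, k2, k3, k4, k5⟩ := hk
      obtain ⟨D1, D2, hk', hc', v1', v2'⟩ := cutA_sound _ _ _ v1 k3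
      simp only [andB_iff, lenEq_iff] at hk'
      obtain ⟨l1, l2, l3, l4⟩ := hk'
      have c3 : Nat.choose (3 + 2) 3 = 10 := by decide
      have c2 : Nat.choose (2 + 2) 3 = 4 := by decide
      by_cases hy : 2 ≤ y
      · obtain ⟨y, rfl⟩ := Nat.exists_eq_add_of_le hy
        rw [add_nsmul, add_assoc]
        have hPD : PP D.toFinset (2 • {3}) := by
          apply QL_full
          · rw [k1, wt_nsmul]; decide
          · have := QL_cut (ms2 := {3} + 0) v1 hc' (vec3_sound D1 v1'.1 l3)
              (Or.inl (by rw [l1]; simp [wt]; decide)) (QL_self v2' (vec3_sound D2 v2'.1 l4))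
            rwa [add_zero, ← two_nsmul] at this
        exact QL_cut hR hc hPD (Or.inl (by rw [k1, wt_nsmul]; decide)) (ih _ v2 k5 y z)
      · by_cases hz : 5 ≤ z
        · obtain ⟨z, rfl⟩ := Nat.exists_eq_add_of_le hz
          rw [add_nsmul, add_left_comm]
          exact QL_cut hR hc (chkE_full v1 k1 k4)
            (Or.inl (by rw [k1, wt_nsmul]; decide)) (ih _ v2 k5 y z)
        · refine QL_sub (R' := []) (CutL_sub hc).2 ?_ (ih _ v2 k5 y z) rfl
          rw [wt_add, wt_nsmul, wt_nsmul, c3, c2]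
          omega
    | succ u =>
      change andB _ (andB _ (andB _ _)) = true at hk
      simp only [andB_iff] at hk
      obtain ⟨k1, k2, k3, k4⟩ := hk
      cases y with
      | zero =>
        rw [zero_smul, zero_add]
        exact chkUE_sound _ _ _ hR k3 z
      | succ y =>
        rw [succ_nsmul', add_assoc]
        refine QL_cut hR hc (vec3_sound D v1.1 k2) ?_ (ih _ v2 k4 y z)
        cases hb : lenEq D 10
        · rw [hb] at k1
          right
          exact List.eq_nil_of_length_eq_zero ((lenEq_iff _ _).1 k1)
        · left
          rw [(lenEq_iff _ _).1 hb]; simp [wt]; decide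

theorem chkUA_sound (l : List (ℕ × List (ℕ × ℕ))) (R : List ℕ) (hR : VL R) (h : chkUA l R = true)
    (x y z : ℕ) : QL R (x • {4} + (y • {3} + z • {2})) := by
  induction l generalizing R x y z with
  | nil =>
    cases R with
    | nil => exact QL_nil _
    | cons a R => exact absurd h (by change ¬ (false = true); simp)
  | cons su l ih =>
    obtain ⟨s, u⟩ := su
    have h' : andB (chkUB u R) (cutA s R fun D R' => andB (Bool.rec (lenEq R' 0) true (lenEq D 20))
      (andB (indepL vec4 D) (chkUA l R'))) = true := h
    rw [andB_iff] at h'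
    obtain ⟨D, R', hk, hc, v1, v2⟩ := cutA_sound _ _ _ hR h'.2
    simp only [andB_iff] at hk
    obtain ⟨k1, k2, k3⟩ := hk
    cases x with
    | zero =>
      rw [zero_smul, zero_add]
      exact chkUB_sound _ _ hR h'.1 y z
    | succ x =>
      rw [succ_nsmul', add_assoc]
      refine QL_cut hR hc (vec4_sound D v1.1 k2) ?_ (ih _ v2 k3 x y z)
      cases hb : lenEq D 20
      · rw [hb] at k1
        right
        exact List.eq_nil_of_length_eq_zero ((lenEq_iff _ _).1 k1)
      · left
        rw [(lenEq_iff _ _).1 hb]; simp [wt]; decide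

theorem forceL_eq (l acc : List ℕ) (k : List ℕ → Bool) : forceL l acc k = k (l.reverse ++ acc) := by
  induction l generalizing acc with
  | nil => rfl
  | cons a l ih =>
    change forceN a (fun r => forceL l (r :: acc) k) = _
    rw [forceN_eq, ih]
    simp

theorem mem_simplexL (d a : ℕ) : a ∈ simplexL d ↔ ∃ x y z t : ℕ, x + y + z + t = d ∧
    a = x + 256 * y + 65536 * z + 16777216 * t := by
  simp only [simplexL, List.mem_flatMap, List.mem_map, List.mem_range]
  constructor
  · rintro ⟨x, hx, y, hy, z, hz, rfl⟩
    exact ⟨x, y, z, d - x - y - z, by omega, rfl⟩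
  · rintro ⟨x, y, z, t, h, rfl⟩
    refine ⟨x, by omega, y, by omega, z, by omega, ?_⟩
    rw [show d - x - y - z = t by omega]

theorem simplexL_nodup (d : ℕ) (hd : d ≤ 13) : (simplexL d).Nodup := by
  unfold simplexL
  rw [List.nodup_flatMap]
  refine ⟨fun x hx => ?_, ?_⟩
  · rw [List.nodup_flatMap]
    refine ⟨fun y hy => ?_, ?_⟩
    · refine List.Nodup.map_on ?_ List.nodup_range
      intro z hz z' hz' he
      rw [List.mem_range] at *
      omega
    · refine List.nodup_range.imp_of_mem ?_
      intro y y' hy hy' hne b hb hb'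
      simp only [List.mem_map, List.mem_range] at *
      obtain ⟨z, hz, rfl⟩ := hb
      obtain ⟨z', hz', he⟩ := hb'
      omega
  · refine List.nodup_range.imp_of_mem ?_
    intro x x' hx hx' hne b hb hb'
    simp only [List.mem_flatMap, List.mem_map, List.mem_range] at *
    obtain ⟨y, hy, z, hz, rfl⟩ := hb
    obtain ⟨y', hy', z', hz', he⟩ := hb'
    omega

theorem chk_sound (d : ℕ) (hd : d ≤ 13) (c : List (ℕ × List (ℕ × ℕ))) (h : chk d c = true)
    (x y z : ℕ) : QL (simplexL d).reverse (x • {4} + (y • {3} + z • {2})) := by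
  unfold chk at h
  rw [forceL_eq, List.append_nil] at h
  refine chkUA_sound c _ ⟨List.nodup_reverse.2 (simplexL_nodup d hd), ?_⟩ h x y z
  intro a ha
  obtain ⟨x, y, z, t, h1, h2⟩ := (mem_simplexL d a).1 (List.mem_reverse.1 ha)
  exact ⟨x, y, z, t, by omega, h2⟩

noncomputable def cert9 : List (ℕ × List (ℕ × ℕ)) := [
  (200976, [
    (135440, 7902029587943689870081807879404133316862822977725549314424292185874715277859413099178728143097214455414415031068887910573363429686059178558920727411568698765153530886636183460129830632328011578894161579394122594453173678466354318116408255721367768270469499681447993725581083935528957681823069543538284470702762211896048833502309473460843203833895000057561034108225611530154481323148053581848078799267563825660139151231368),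
    (135425, 8453537754509747593933621801058500094416501991891271585669597203194994132770008902290070695310905247652843102255630954121327232128988282027457051611284352701390844120371300545103982526301330387541483689070120881692944457814683204452097687740899273733486114951757296241414757002479458889490309689321800313989333039536392259116063541608930080358934245303360998430580471382371730260475200438137830104582353013),
    (135185, 11436473447652625293491497863893493725064124331732728718782035363471322094287942050305282344129970475090419953261442220591047076522832224800678294719860151209496715360392277803669020028544922706665748510725344212516778493318236197132554812466333100491822420776362637386710357443736896602630927390031587133187910495314344139511259678197948283153167273692745383277077112670800040470769),
    (131345, 5834533487662810658151609213177313290060931840465415648840504481874808303754281654476252909783114013338548260571705860302035243566626288511242307490760403543689735316505219042580213808247625398736305776879280414904444401652159300552094620805667027773905848855336977514007738933907219472951322060295939411287472678436394503902564428062887085149607551078913463458989431),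
    (5710961707792724907957275749070438668017157680, 0),
    (1892906490512800868956979521479668524751009904, 0),
    (3250367674514095973266164391621582309659636464, 0),
    (3146517625465188045311789329299325700098666631, 0),
    (8178101441874060370036076389103417289254109560, 0),
    (4119953877987493473698450818401732450777302612, 0),
    (3390547710355149676301563748242016142324248669, 0),
    (2373248, 773520031702254338005674268461931331648031384560419559220952582504590),
    (3749824, 167991669868393483487718573965888019307510162954084391),
    (2755119, 578971810858074151602216834317),
    (2578695, 373878853207674)]),
  (200961, [
    (135425, 10666493851212707790498762928449406110589676714169840400854526161401208583585052567112341545951931804721370570208109991315509062994264817787132666876571890811069557623404622337982606428926652974650986638780863473314885678474855970752938642297802440515711475678251347228705803061994402785436222712673709910955833440096860670027789976085734237998793813290828045644217035335181222151545),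
    (135185, 2401505536019699296700785918208385847061269712368731092228738991224705162439764771439206205856546510989772187116098596082199554348262016278773790053879335515443104346658758875950629345963537802363494591988863530935087300241943253844602104949595144838899465785802368052913741308690837471159036662748826717539785173379715832188013375577503476253778135089899830580114033),
    (131345, 13809526829306450460611060558886680509321946606557060170431246561852385763562637205982213206321834948752656691770985403761927195199464979167770474646235694289086191674235004373092504168218150192336605337819622647895020245601004389419431224946014082076426931540983937509713609613214903913825329667590031846000246618428274367935021857099382742028),
    (6178591346813896650414852198765910863998505992, 0),
    (4849584545966131999951043091570281601841142529, 0),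
    (2365773729822973888010932951918815469390312544, 0),
    (4105845696837660784118878038897477829287702534, 0),
    (4642950128726176983430270096926515383757710339, 0),
    (4768025664425779456624191465045992579277723918, 0),
    (9611663449388819075442751364160297338445767952, 0),
    (2252889, 229421505753590118639435690117462502344669619787532370),
    (2713616, 1111558950939457155504965525651),
    (3158539, 114391556972629)]),
  (200721, [
    (135185, 11640805272639585838362608100169741061323974054798973559523961867456346541277286471884269856834881595153074636835537937312254727237578291128110446018121888976742649897705950317716425959883007672599506087450655841197525148068873883223576519182328054316379486881540752799613368576281132252476214379195570450753041847892069665816775145244685621665),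
    (131345, 1988503325030550095927978100495416784974430691913377193552437009808731878206675615358718587189788134996844108225136348074303069255544672201592142277330297248006747896947313712154801502893369569789692439256702774649458852565724469922639984523696099495352977090133531669548155323911089547777048360610089979965262673363311716500488),
    (5127690563954618453987798716069958686983803232, 0),
    (3596052358667958964704646341363495436400067862, 0),
    (4915229128779722057447999585901924440448962746, 0),
    (4065363008212642074019847808437856941997532864, 0),
    (4217993266439910924382543443444515163919353116, 0),
    (4194708423120945790801988540442494991892103173, 0),
    (3965143, 1664795634021124597975490185112102538089027030487140594249495397434513),
    (1807619, 359497435741327580900619384458733866396299122508828635),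
    (3312133, 500515550768166722175406850818),
    (2175060, 84220018532552)]),
  (463362, [
    (131345, 7901729936341646209749476356615615332022957634240974264408011048063344513409781220399257335907280971657183880138439911093772694205593163772438268798742445975021167160205019411616173167692191840786433742942411407781606844766968620662574198556239370864053296248027071208654997484752039764733454214516477960),
    (2901644975313460068318002111545148114931791872, 0),
    (5630603445387253188935422210595472584175718501, 0),
    (1252024078658308084763650111063885010922308726, 0),
    (4226067498668913681238162293095500093942554192, 0),
    (3147897800728829548164172989244293897937030168, 0),
    (5426408072993740809838809066421177578245747088, 0),
    (3492240, 276886602857141488986202448713688172407302544249437448),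
    (1868553, 788669364319288588348152906506),
    (5569792, 171907145142123)]),
  (3104972, [
    (1895673640054445831082203525056253853937082379, 0),
    (1966892057678409295633758845217581068676238124, 0),
    (4529853904728597941510721304975674098252088847, 0),
    (1517568200677984071659767091784451202745305482, 0),
    (2973142353452464451829393188968951634083316327, 0),
    (4130636, 982826967026337776239025021546347370917109975218378035791857553543243),
    (1069664, 335270582143530069199748737506589787324340421997625617),
    (1507442, 794196589033707576968625087753),
    (1775632, 114453565463361)]),
  (2316704, [
    (2955003951917325999465751373677618375936996640, 0),
    (5710292076134713277132026030598264838867631881, 0),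
    (4464447525709999583151728870167210464853778511, 0),
    (4666576593617522193935158042140959890821416299, 0),
    (2392087, 1144134551294983324270290059401018377882731926647312773840918332403748),
    (2689879, 203691222779616516513134938652913453960844947492393761),
    (3428426, 836620196241526973754391789914),
    (1644608, 303650431108243)]),
  (2929166, [
    (5711997551043731255692332882255735018765402637, 0),
    (2788856317845871722911308361558862407153053818, 0),
    (8925063446723196237929813617599842668229054992, 0),
    (5431389, 593938292785200120254898340389903959023849136469076581698641071208708),
    (3821807, 48035819389358416856100847784577315410851010114839153),
    (2949263, 1559575683866254581983891728321),
    (5513437, 219961183535191)]),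
  (3437581, [
    (6021348351769724871750572514638863338408381498, 0),
    (994475289380210847202798114824670066538235909, 0),
    (2273380, 925277506641249812774150800407471125450637561051892490433673869633377),
    (2056337, 309955362369086345524381860545094202983399706118992257),
    (3771907, 939944676013841767233922597707),
    (5886984, 163099237893025)]),
  (3738765, [
    (2861471257694269746199003787011984987404329079, 0),
    (2668292, 1141272597031278524889110395776241381162588739957943964306344249411921),
    (3118595, 228611559791059955044231050122529033810899938817081369),
    (1189168, 634944185131194471740750237022),
    (6272770, 221655143220871)]),
  (3383430, [
    (402176, 542590334105078667602930391188968836045218926359372747301282614722566),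
    (2908297, 367597442579902228733023796546076741225455255054977385),
    (2176261, 991224883015225047526245638921),
    (3747962, 62435941029378)]),
  (3812359, [
    (2690163, 832037458616446826610854854679),
    (4501547, 254262601675281)])]

noncomputable def cert10 : List (ℕ × List (ℕ × ℕ)) := [
  (200976, [
    (135440, 239203859635874151748584306652755102885719307578843885086849478035727710573037101084135557314431770345642027569783242174585828135720903699873459357565366578400036752957518452145836870548778065951310088969267399623143786936580370643903766301102437017811520793239791359972226628479353922322917422359902479378463928331134713351226499164845132657365342691495371715234230688175765106135333628829027083060648646168314914418578196298896501068923951719530276787438557139266625823173527286223072072356574388258438422340509234303547734161940006678879231779186142945),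
    (135425, 950090512685416664238198295054738742461735144205273687920493760939902773924901716935843596610676421864851242161996119425045301602969929207486422124337377396428685805054287008807041658762830558833800262064782230146792564148623645544798026551524321849944361382756549823823676988632489591974090584737869580692419576756241049541509190155616823731291097181712989942874997629759173742907851274346029676940799131234431687676657384624373528353591016419682036363880756226557584468262175927659206532520312423431039887320960224401615015838757),
    (135185, 287638790826365519296959342004063613401688538423078182380098876352868926980518980788254197199875718848021619216489665839234792909181349279845236835670257495890614054784435414663516016871479756013387890930447579021755074345980947986498883961066686118483316349012086761186637898983844157718771594479866795364509990558805571667905877253847239088384753643083717071789760978913614213189748594371436083174140294028670871429618750376387559865439546828652889811300030315321947307257094963556938803889193013983644119771603048),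
    (131345, 660933024002326196600745938965629834299724656996614238723293888582600198143015974125817557036266856127797015520378050129094338853192321382926301222586166034856366154586050657138557511786314198837540570145830648667545333913590949345805184816140333354603545908809254443144200649172256453788677724380819325579765060502779197279191070229718882729323196310637783557039517148800077548488756810908762382945507189022909929042647384357190374877012838158061641738574277090731155904971977919688766959780),
    (7086286408420363115977431577426603062682804996, 0),
    (3161298130029963704469597062771236877646196934, 0),
    (5835136259863280582677596162945496616879370366, 0),
    (10421700151127872723104273172548935374880421133, 0),
    (4237846697987370534954672821659582145898294798, 0),
    (7229192784961602369448162851283759671973172744, 0),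
    (5801313609307022116623402142630825347355625730, 0),
    (6158563693895888032502973253034097537497354451, 0),
    (3262187754485122237714050305928395139697588486, 0),
    (7736627332288876581102347654989448254579108097, 0),
    (4017304239997504923968937867190575666842274384, 0),
    (3912032, 1070923096446486810015891743630754247976669444),
    (6221905, 20568426094665770645260),
    (6136041, 725059)]),
  (200961, [
    (135425, 318267024567249262374513033689653959168677289524476990806018323096760899676249103671240064893562761631830063948115859742549542115381844414641018092543662700057208201213181962936827494580526278685328609185173014911433380629745640952686635729167755107994243721013813757027361749247972492001188881319882141464911129266887003419265933663885893981181477359867840949808899805354089634063800908307125914849777880423558445082927322606940490200717265032791607186814487292983766362794339544761686526121739997790241341699046151),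
    (135185, 692403036138429126649661757449330310208891104244045135537837798314674732594765352119953122620351061863846056114033326860567433145923247082575051384735695322091337309474711969980639400336353015483849036806296800320695043642492583983798326847708733554433558757701402813165171585399204681219792553694005045725456712216223304990537441806434046933385964360706839296871769439353743339201452666354850896712228494351189238541386483171891716513623064736352035961801147947787470573891005893369188039009),
    (131345, 91607017156385115840759466401921456739443171542034626503673678086670086046359292636112406073132170023763080510430625847166281399340327755428402022320183032228304462571062506772349007782438865562578848145939938045957048553378632196824521584087730411436812527116526421662624647945329415176131768696532659317937985550931518100410084633229039336743306981309056030315468342846497865897487646657819669601189692244645526875125898545433884496314314149664851231030594382189747296472301),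
    (5131784804220743842005854001092422799577202821, 0),
    (3929198374415982844608448774110360444501580295, 0),
    (3455925486279343229004621875400013204156025857, 0),
    (5799116686474596388549628660438068310670019075, 0),
    (625473143419141991912295205863878839117944067, 0),
    (3479754773484125861458657412664311063236759731, 0),
    (5575817902668758660897183461172452714489447166, 0),
    (2858269871949809781644894168197397849246796421, 0),
    (4627637473101676591490624046989035058297430164, 0),
    (6605705644465610306250456690722103451432370267, 0),
    (3627019, 25148227474209810403851652604455455413960243271492278432630196),
    (1705236, 2800140107390213573040470883997334772291930986),
    (4766432, 25530577564379473662929),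
    (2830529, 3868104)]),
  (200721, [
    (135185, 124622651684305421613135825571354520925542211608979058396999028484061280284230123838606755896697972627827425148532199941687732683078361968266136650721745272301715489891054612588230138771770563058113810606732055144328585577592420386213612069523541214580762929238521309025463881232111566603896986379848059347627698270887400332368367518686759611131189661000730050343874320011778046295814072599359941864587759474800357196224942638588850282866509838909529038882002984231652569189211),
    (131345, 780785875519460049380520751020163026106515169360665605403177276039777971672272456128406238490896988413243718798365118653276037391079081118989576535417859923881827960842241290483734054010583823920098438063003231015341456588082532539993744191655923082457966080523800634939388069982956571652117106653581591096035726492145671252985111539584338202579876108670607038988505735748062322021591731443239803570290525538285691304613704870941498029776416252858953843),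
    (4461322352498768296472449750772677637993898070, 0),
    (7831176793341435174719694965018840333126762620, 0),
    (4820514893455212672947036093957364483762110528, 0),
    (2787647649993101494213127694533421956233310363, 0),
    (2677223386226871484937093625675228280002614023, 0),
    (2960564259507179797852432076288613025600794696, 0),
    (3398903737362767008330256880987837359528136870, 0),
    (810166053608206645943274193358707399333163075, 0),
    (5436329410302957847951049781261371142656807058, 0),
    (7208837069855212857332022327415971102910691854, 0),
    (6158160, 2587064792223654439987794393339072242853874384),
    (7661323, 20241050351578907320422),
    (4358242, 3499524)]),
  (196881, [
    (131345, 105196986274197914421153319304148032488952356926528219647959345960018209151305255246737953286789032167092445880148244312941849961024671666221150530080174155317365126266202375073528421216612031163011178913290091451292129126511752970574857068056859846689613013189416109488895207997387488934975639880301406421540200325946201759691703596054026230431049515000628827504432803131976412437096031448540710946636176594436099593108116534036307118810),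
    (7370644046472098458702152380212112305446955265, 0),
    (3964480223156719610642560968985924303843808266, 0),
    (446104808100695657208079297050171638955706344, 0),
    (6401555374586232254163386914469560122812402392, 0),
    (3334120687412187844900540498381553466308429223, 0),
    (3873121153489186070587704274861923359458134914, 0),
    (3947711086174926750435743209994378099516639796, 0),
    (3590601063426079421371500200109802384281119856, 0),
    (825130314543719666210250576238943078524959239, 0),
    (4492368, 19660219877043832378808325934098300392863197089587115483988699),
    (2315152, 8149746424008245155796032853108268959377785907),
    (1705218, 12990980004885725712913),
    (6294154, 4590370)]),
  (3215062, [
    (3485892082069815919433432668883854722105446784, 0),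
    (4042106818814928670989781785899689620992556545, 0),
    (5165649719688572169772695771048519961966498592, 0),
    (4143425214066906235492458718700283142374248570, 0),
    (4107681880878133368511614957446689046412986393, 0),
    (4396078014927814462328584669423752825471049861, 0),
    (7140824179204026404774193668635082620043088107, 0),
    (5086282301511717242628788875166456943652701330, 0),
    (4729998470630509580205085773380629901050189059, 0),
    (3365440, 2785155425971093098921036524851013428484198419),
    (4482944, 27464365044955169292577),
    (5244322, 5099019)]),
  (2733504, [
    (7763003220668978507187478068430033314288715267, 0),
    (2337070243977747190973022228725605635990958180, 0),
    (5339294438394613639288899519688119408866265648, 0),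
    (7854595000979659718798675177511784099866254603, 0),
    (2209276528096041187848625463703390418509329776, 0),
    (7201764696651120870855582267382819790673743110, 0),
    (9013300019105825906971924031034544734866210894, 0),
    (3839999488585638023955334835047785650932942690, 0),
    (3971591, 3083124368618594189707320240103662443467478021),
    (3277181, 15850400981064023082150),
    (5769085, 2237446)]),
  (1652487, [
    (3233906215165682981402777629380034343013654666, 0),
    (1287933476233841387831456877395625833313443977, 0),
    (6783937386714427654319356031323164766001628692, 0),
    (6926319766641915881621458673407905068182014555, 0),
    (3144563028253736175063113164111515922586600607, 0),
    (10225232006986285567746025283655936879623292683, 0),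
    (6526123104764710371221395037996348028255045184, 0),
    (3061568, 8647048715517467081167028331468617995236049074),
    (1377824, 16533853767621411211334),
    (5047994, 3278392)]),
  (1802296, [
    (6769909571004285743529153665953661220948738696, 0),
    (1428033184106124203318289180347290974305666432, 0),
    (2278182380815151387727447558809062869940976390, 0),
    (3837624294957034224743338368291343070653604880, 0),
    (5015729510284819064981642936271752223293725449, 0),
    (5978687711232215274357757371017372636009273607, 0),
    (3372805, 4323208557293806555985420756023963667577858225),
    (2192192, 15739738788473703128068),
    (2887866, 4052081)]),
  (2033973, [
    (7294095478966719890436695010837115555372403159, 0),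
    (3126156460783326260422883482002552322669612182, 0),
    (1467711426912650887806123664849852775781709120, 0),
    (3672000686511248886947104198255455047275158539, 0),
    (3785607404838388916302659613823233755604281936, 0),
    (6602504, 2142291264801691383532934668740502423289532643),
    (2834590, 28643961304452470224140),
    (5508198, 4285963)]),
  (2863191, [
    (2242621472835679570265065899809814230050931233, 0),
    (6695512984052433673192361967652786887201984566, 0),
    (6336078156676044803189786366528791188703393968, 0),
    (1549926336828762954607769941158004521551155288, 0),
    (1573216, 4122512800231373058281893533526424530942668840),
    (1536005, 8976669621310558797879),
    (1966629, 3097217)]),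
  (2371721, [
    (6283501809621000712431792524595727577795625731, 0),
    (7153196905005426219737730619437424434795804176, 0),
    (2269211125127756707194826412846344913135747664, 0),
    (4642564, 4907815081910253679140995542117612365765914702),
    (2820416, 11816652854683508756583),
    (5835999, 3082279)]),
  (2515210, [
    (4928655304195901761840275018208586853057519692, 0),
    (9369315787916277852395059861570460601973987078, 0),
    (3874956, 5534449077240158358232501223660087122963335864),
    (1788176, 18602510429284601894147),
    (5791774, 2894209)]),
  (2359685, [
    (4641959231455691339794960868002046691087878618, 0),
    (1443137, 7515643800276738385910388104499916115453104394),
    (3780725, 12243305959432816300087),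
    (3783248, 1915953)]),
  (6606972, [
    (2205520, 2415950470953333777882300293782564758856499293),
    (2033188, 7398729884726806548594),
    (2377730, 4022363)]),
  (2766992, [
    (4979360, 3842180)])]

noncomputable def cert11 : List (ℕ × List (ℕ × ℕ)) := [
  (200976, [
    (135440, 4175995101407849849041643212281083273566875586830884317339040344904584689638985505280310330964829211291667631262134568643046168818816081295675146652418392662415760944387074859229275308692631699403819877763796085453663439429897696582791228405956194846441129281025270057076279284807973782755793595160379207358465974173364810249060407553890606016085192218193542598270700791328827763205502547774651122759845012290076356982867166303677543149531349935658209107892028672116293427142224385418783593290230842079913158473386322815452445576444273775598116208646727381217187498987479816730503395309884271808950450840806268129383033135489579581841251835899001895961067979318015027117815086716169468713645401326946443),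
    (135425, 4142649573963335671997594237215957651932039289870652013866709675704593247278829957429798686514299317467263686477946635325433812296117235655995664633460480802358995801836349163296318927963910606051487181901394191232065217266887486923426683481929287148978770985371173332884472075656075014988939970549695289745714624469885363621001503516589178393796626658508826349971610477470585667610393841051000217205272895891731125322448560008138481336696107184981532765025483255813317297716114820646967685657849849319160942258515458072007630074597833317327783140267235545036991145508680058374625239142536400738244991360160847510086290956547415834527895911387383875155953491820456881811010034577604808757),
    (135185, 4985987524076626201187077554909794190526289373443481766673578769588851168260594181607653593996533710468474066998682543596675881141148852731003476888754828505632497456287121583332128423472387711703759635139097291586654292319779203321624227425232580178965210502906379639038092439645889388212359625811998207153868382487564435711729722743045618869637333814406231973456372954064026390738478268691164033363789333437436221444614176244575856267196505090378662787097103478464316272127036973700946713779373248945607442379933806422429378720414005577783888100526118556781653262508510620883948193719968252874730402393697889142839499621434568438176014782920639483517649087846666),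
    (131345, 1025488909260951376080105329585381425046504208560991349785889596846514516102099620049056954455686003395858470530589786450501692719286051156945114741025586041972861142702158320891484697680681018825330216282242898153106749432828014029582409562410042114402633051078227746071304490796354122875864062689292830672564544353420055028420983776064465548027557177844052221274066180247208578076281503600471114975865430671981383020859386633112441138071674188327873864397961567089783050115805669521176941889408826688459173751510039737218010463210231535546738722430046655085953652359946674476415452457981147634981551266599904220768708616151708155430060369988399248),
    (2325614974165430504716874622173380858418606859, 0),
    (3659693357302016164500526291564374798364574923, 0),
    (1787025574173229783776357764601598002699830642, 0),
    (5378595738162691060856101057617357098536142569, 0),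
    (2349256421536958915513657330940721251422025485, 0),
    (5533271712185755551847911651090141321144451952, 0),
    (9542636525521058525396892460694254542258046870, 0),
    (7583466229647383270811315909649108635778439328, 0),
    (5212897216105919924735045152739290663901567008, 0),
    (4997163656854675189968395386866605265228604256, 0),
    (1159648337215454983895647285413433362739832582, 0),
    (3514460835757339483821829038511477182576265537, 0),
    (6088394836587879196540243899597642474082381744, 0),
    (6821676042916541051655946806200527494832150240, 0),
    (2163794, 78929338383677316812816156846671924703836810194812374620298220744455099052195),
    (1463042, 32000763171788471835996799628209715914933684985566134036629281),
    (1114880, 108389319409210188861320524885086569218),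
    (5441688, 33033547651194979910417),
    (3241223, 1)]),
  (200961, [
    (135425, 22701783273755551343389517089190020258481031132849579455544119620047936971257280384533952869986643761776818877487694220054372068850959994513292451219717927482531713005647449985598923256998813444335991437864791591507975126574307266229405302920901650817955493820168247105392816892754728240258573553999993578027801590250613460140628367071014408132351546634906135564587618011566340099403677700250672854035544400930441627412443006186821133653019284636011141454068755275013193732378005390825044403318405013469483642083033848899113922136281802011745166490236212715270085976001036432707231729634653732636693243054758297493069204739897760875272704538019530134509505381634121),
    (135185, 3408014458647289685041858214934303612873006375166462193879253730397673919888382293608759966488846982061526454535749457354847275198636574366092508308216965946452185355243325046805598232623793680575780819595062097115473276929406659562367917134738967880232033347187951902744396348269955479241716735745222825481264440956531319103102229422563644572710305225616442415577929513101492870593716896372967488223895876025848816252333256826484437520351709173834532493470258054291535575966112648506603710901155968986197994862001463813229540783769321021528975340183676343315920015383205231258838892696340462256978990986948352165829254940091615917149149637634482334),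
    (131345, 11306488858549823337628502340353568701250635422224913878152164712381233870606944066287991788930674088514578549892627834405990763730183742622072239627234843323820665840023932093179611970315293023928613252519321682524637412807037304561198957080356339261477122165723554748319172048741950330208587596122761981881509228954346605550138780729375775777675059310139739929653080786867613625452488817059568355541275564796585986870357962466446473493836891949839865743624000064502201613662122017659195350304748411920125282424525694848573123510745743021130583272374148558336690111200901253482959490235917426421099879338267362043461643939961),
    (3252433881598599613899126356717436027954840587, 0),
    (1109617391333841916627604637261023689184071846, 0),
    (6917420633763728901520915455325884985183522873, 0),
    (5264857011622191135400306984375291552944317488, 0),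
    (2465473761425353517556792796174907857626312822, 0),
    (731744648632072887202976745929029288753858053, 0),
    (2587654229630338749151406931813198654659743104, 0),
    (4463701650111771817977550959299262788646310224, 0),
    (6378260912659274566796009995923842516407988293, 0),
    (6783382034867737954557651658883385853868243824, 0),
    (6540586553274192738573991649306781532783662082, 0),
    (7632593458963460220006610453575538045839891600, 0),
    (5588536283040331839994774082672918941664538768, 0),
    (6337209268033028632187235599514731347143971840, 0),
    (5817424, 22915510229923018050046281676842330682704078001345934735930801),
    (1847379, 50927387784176881421936105943125082891),
    (3428448, 6207707731638930882640),
    (4273584, 1)]),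
  (200721, [
    (135185, 5467450127229851485216013608907040012295260524153977037722745851965424737629813842314631154521323549438979658714127114167671667469946012978106386344381095180687748234236958539009009490762900976605827839372065732554184684683822616448980341126418195933548190734254535637955899144512909851382434820396412898301086847344057933004599575830124160197507532899227356892310166749028968730357933308822413336448794604271037929093859239926978443652901947931417342134265691411232309313621013673768494075978392491598875921674825325643239303140636578187802922363570358638067374031784399466706267635483185162545985873318614938076238004314198),
    (131345, 1656032070754713762556732954199062403291715457827888423380899971463199688601065809591423071801255173292371086927846769457685953168829717794803818780864724988625484115415955266250441175277141991776511111015212255054853180683401195449835309604595257831250960881692779813516160166928399222098764207042891594666714180666974323764176760052601091535394576481768105559585895457637173677410994715137925281084334149754795550715637007964484302111070599725480226056542066293568758259792193270459060282137822661047895261018124627612271092850630908473959437595609877169184757964790491150909047820710129144423493118670276118),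
    (5533727705138372558103227807764895853818863695, 0),
    (2537760616795891888927202860180380963185922119, 0),
    (2594567335962938353818205505496581838870069516, 0),
    (3392013641705423214094030973837854034773608646, 0),
    (2414144235782319788444343365974667687478094594, 0),
    (4255304530270699843070527559559791821477648256, 0),
    (5547454732987153848129584789756141811041952960, 0),
    (8726565822782701578395962963264820529644832196, 0),
    (2945510098696875116054067092862273350138200213, 0),
    (4602011453841188501032435378680443748661153845, 0),
    (6308677270395774284795414170646410960273962176, 0),
    (3494335236076590456686543353052810222286181408, 0),
    (9801274247272917942885318777778671850704339540, 0),
    (5244653, 114959905432520338472545726878175938332614246141395186537983155466390691355662),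
    (2510930, 31973104846105779864541774565992792943877023431237688571562257),
    (2909504, 65642316727658018315471858581375286797),
    (5352528, 23206404971832588120277),
    (4210828, 1)]),
  (196881, [
    (131345, 4925155059750573144545143902126029694506781268708699461469548103820843956951548425359823329076994480617867849919199174921228516899843075377875002302948773327020228088079311047808848581632724854823353074163739563358317307650542299754583064667566069973175225304709424175156762866079563927484710214233531930061681621442621119859167779530038226363265709185684892180557571537170721517722865746136127199017607868589404787369168679869523024482784056929175397619673421801914979691779044402423165196599734096335721926738762178803666679871788290949412999267175332365921832676945667757191331564295),
    (6907714380423649553585392723790531335272204486, 0),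
    (1160699109059507282625391099704886575323482486, 0),
    (8842523180260645000025017710059353606089939465, 0),
    (7047510542212591934524749692671384975290468819, 0),
    (6896734206190589850491526143300492828755113824, 0),
    (8724483322482646180033773937057521050546865459, 0),
    (5502849137304719227783040476576820909842497980, 0),
    (3569261271448526942628894382444291130497501265, 0),
    (2141662407459327507419895260648363011237086590, 0),
    (10151725641713849761962613751939424820090462375, 0),
    (5036309742736657220266953218671219649210544310, 0),
    (8922995844834726531622125344308466516342802477, 0),
    (5888350962657029241410974324026064488441839928, 0),
    (2688114, 22501001199144625066639141952672964143942835420566325522532931),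
    (3624544, 25862872471246491660560343311723544693),
    (4983593, 17020940783253235970497),
    (2106192, 1)]),
  (2099604, [
    (6127848435627482459808972380663692537205755725, 0),
    (2590075612702378622300304762295743243247775239, 0),
    (2591575692060866330816911522677766616530028891, 0),
    (6387432201935187532660677925157305406617553191, 0),
    (8507965749058556471306455410710892169317182731, 0),
    (3481152691614754012000723215986117263692333737, 0),
    (3124246773906729420343174985263000484672701563, 0),
    (7876709247463558814509988755327098594668227872, 0),
    (7882627443783173857352870392075959508194792199, 0),
    (3796930603627166058108713105618074894991708315, 0),
    (3674099575797006385834164208179526473865011431, 0),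
    (4111525705983171764058896026701936574033666124, 0),
    (2789637, 67623063520221995542488331558900820524934736909631012515206112134958457816869),
    (7006219, 36106208555269296844645619608692080249591169856025621545914392),
    (4460557, 119700555435924297331534025682301168143),
    (2165682, 11887787523293942022146),
    (4465672, 1)]),
  (2870022, [
    (4380789843925596331520781110491969416537375740, 0),
    (2499564635667028325799035080552601036348328312, 0),
    (3212490170429732490983480389505918170300746281, 0),
    (3390961467511535539630811504805534513245980816, 0),
    (7719389926747124748998027385006736305994678475, 0),
    (5764921010322057934804173905029716327447004563, 0),
    (4282946400367556505296361627741507585879186272, 0),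
    (7752654637091090667946514168379913820417237108, 0),
    (5251878659425297170721492931006985523504876632, 0),
    (1701629642184467765709630424036572233053667537, 0),
    (7633410113273886623357554491179800145316517899, 0),
    (2050051, 157450782517941284353073644728695426299363670828423401742452674215765137295933),
    (3289283, 24518666141380755741077461481058769174378810238119863929144851),
    (5491584, 42884803359657354586905075140341085553),
    (4917365, 21701874055893942405688),
    (2118155, 1)]),
  (2069632, [
    (2230843578615763032828513861872141827975077965, 0),
    (4957043014451389828220072821885585312995350416, 0),
    (2354132107313634505587541839553215012699625227, 0),
    (9061437725163581328802034619780619291355793008, 0),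
    (6447899075858736755447676087157333237685637174, 0),
    (11054788718028826640499601349386768221756675850, 0),
    (3682127573278240878726364922682570618679370416, 0),
    (1531107365564812523373947540610218318645937409, 0),
    (6271540204428404093569841364311969138504750343, 0),
    (2977506231483220992128026703121328613695869015, 0),
    (5368068, 83275341761650744443997274902324388043213028954510240261126566801010274603034),
    (2906384, 9671475382256449256010320938989654409908435903903083655332407),
    (4672524, 81749793966161779278646912432696001859),
    (5751049, 19530202373227033688582),
    (5940482, 1)]),
  (992259, [
    (5305150538557784676170417453307674841594661223, 0),
    (4400390109452826826279837514148002682650362455, 0),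
    (5133356923441417767966744497703317637442258640, 0),
    (8363323969071795197674028531236662749914139671, 0),
    (7388014765416473584101425088441573963175298883, 0),
    (7050947432878482459244577927972486151386982448, 0),
    (4287495342383338761469614996280651394357152263, 0),
    (9604661844714975649716886122723732628074385554, 0),
    (2320719015929580349341353960328993540210794000, 0),
    (4511756, 166531879412012796742535050862463392774150506452192657287467839367925616689154),
    (3899597, 40888648783699345862368662314002049704072234183809325583583490),
    (4524559, 38574568416557861972857310086220024156),
    (6819824, 23068851624092527495763),
    (5816526, 1)]),
  (3628553, [
    (5085714659780309386405542091918288525434967984, 0),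
    (4863478994059073378225922038061082045933757856, 0),
    (4997657818815360003096433749407918636870539531, 0),
    (2464820476059259793877140458196391054133584256, 0),
    (4348652193804576235863904780259725974743768208, 0),
    (4553319785858430052344781752152867563570283872, 0),
    (7887865107462980423236082602271351762815485607, 0),
    (4284557970646253792733965309834952188002898848, 0),
    (4845774, 65861876753603317049885863273945631785219440756376929813636269943304337272854),
    (5743840, 4092768686660977098092958146072944668056717646222215049195540),
    (1470727, 117890370679983518536846043370447378703),
    (8129533, 16676388268155566820169),
    (4130407, 1)]),
  (3647243, [
    (6517640599227968019890516636653122990294733856, 0),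
    (9993147203304102633062887642971283372414969353, 0),
    (9370570635331319560332540574978227150520504358, 0),
    (9253429154534019655016729600977541270546636208, 0),
    (6916033633779536915414852247958779577120550999, 0),
    (1087531599841506384003280704023397989611910864, 0),
    (3213181627866232394038966364797991290368989698, 0),
    (4297920, 47273954237520921450357932444399888832376689398466028399867755404623695577766),
    (3692808, 6032301410136546066322707229554357254673492702287120358449282),
    (1049633, 49266723634019538956777563427384594198),
    (4065670, 14924641166503288636291),
    (4850862, 1)]),
  (2908363, [
    (6259196073930489189292048853292658420156244464, 0),
    (3908750101015662435400428667270849251832871072, 0),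
    (6805407810459306673362552925216397441398665318, 0),
    (3608544868349267676883632969443364138220113155, 0),
    (7662400808466308766545826143832133001261033152, 0),
    (6484306551272397357092118955760863144394453280, 0),
    (4000491, 41842473024313973407397844621590710397130279282190348321939735209869213961700),
    (3109012, 9644240373477017555855500567942006533211407271052290610367362),
    (2230578, 44144989892609276979330189940425006342),
    (3215572, 12692175291134470485057),
    (3719178, 1)]),
  (2065968, [
    (7228264477633866959331687156419876996752831136, 0),
    (4758431129761080984994429275761712863465639307, 0),
    (7405431887678683953618191431897709661471000448, 0),
    (2347244708955386880051119793885541503399305380, 0),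
    (4606848943231827328833672584946795060616569039, 0),
    (2491943, 167763455744843539059888414532011867612870758215445594702589000697867128689745),
    (2812417, 31355760179194589462202042754366771676304918812303152616206500),
    (1999109, 59868846595466233782114704443135689871),
    (5310183, 18078566030608246097537),
    (3320067, 1)]),
  (2588867, [
    (7199024672900380865887924633075273218626881318, 0),
    (7674474028189325900766761125544623740969062579, 0),
    (3083774987131414051421346457620378330997212430, 0),
    (7835927103695292006238472544160646321621304682, 0),
    (2920968, 68893123331747962554142325296401441087217573210434223411566815105787647758450),
    (4665500, 14478239679834189555129609475311967905057809035585132644139097),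
    (2904838, 118607922038567795957160091723010759685),
    (4014293, 20180994849549476183052),
    (3377984, 1)]),
  (3870282, [
    (2165611486035003058202424321727262311455500293, 0),
    (3327692095529827245865355449640994096901213442, 0),
    (4795749171801875527401662056964077611338743048, 0),
    (4309144, 50709975262514699503315582888682108126137784271169313759557867491200748408972),
    (5170976, 40771437194940006108821376262176005033547451402679551710860353),
    (2689335, 116582824560627187966738132335033581835),
    (3240083, 7729641139769661475121),
    (5415178, 1)]),
  (3477393, [
    (8478080753491887963803121205844224025528533262, 0),
    (5603421645151633148348228451689757499930589446, 0),
    (4130478, 89787276115714115626352263836125908451659515626441003647029903589029132832917),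
    (4496752, 20891531073765120573865751646462839380093688274577516719681624),
    (1704563, 154252695120516205534706281598525018227),
    (6098325, 25143970775399665842401),
    (1835525, 1)]),
  (2950743, [
    (4461747050480893019818738397723710660493283402, 0),
    (1442104, 110061322372608016020930208295295651180906275124422865792979153278960713543585),
    (3589637, 25348561785836866757649645885366300575984513306755822062932093),
    (2828292, 45863640788659037724784165916757292549),
    (3981334, 22032361715823847469273),
    (2500000, 1)]),
  (3306251, [
    (1589287, 68307634331335226248354860684459974599767266853481365860567578547628044566588),
    (2424936, 19911389909548553067715570746244374293147774531640013297514321),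
    (4563127, 44281287748096403168303253856955692033),
    (4886722, 9740056702087230864129),
    (3574560, 1)]),
  (5817584, [
    (2244662, 110211795875053508805295909069952802971),
    (4164448, 29087110776723824316721),
    (3680261, 1)]),
  (4744718, [
    (3366967, 1)])]

noncomputable def cert12 : List (ℕ × List (ℕ × ℕ)) := [
  (200976, [
    (135440, 24502044894056292815870109961228205728505422641737242872829938839714921425954435778631970354841633670770450820303528581026624540861378120023662104264235104520593368118425902036340615376429222956511007583288282821791907086162463993743273936211219695790405497165299472754647491306466880754194430521117954939633044314423040968369343984316600612401752732117896738182283835803917703443314787604302249578916264666405712413660761978051632051426054336085244616084949511237242956582469168661157361716341889195033070704002945771375396160435694194827067027147587105967564076094700388922052575477006082880862489376193130705142838758906790607766823054576946320228660557299143969628163327822552558406602260051507101574469792727957445772628173177514038900838140500940641269259151134592883630604276549155925139427202436284445463828519673926418432929232897996004462143019598625978450071202323142938328),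
    (135425, 4014375471523423039874936149255009410988516874945302841355059690817134140383924802071823016165183844154637742920800226979563228086181382011825596532206933839973042088205203071846583149615682868274738446867339620322788374877713408453189460124431015296711359365799178382619491381664118076341154001490179385312416421222526138583308961754573322134270511417128202161615586371743823653159656474925423599233158826311617872801326892330430932829191336167984880876068803362034771933761136478051688600965561039588563096903008332282668909544354329597209297560664897318917723767279203949385985793584179269134957658807097285759922743456142415972237937375270521220910535023171760170428977710486098721830545423170216268734533944012665923572102319096739589589474449651097946757237647576214280599045076823582505070342452982960367971790951484499347785251768257495767131708109956777233420),
    (135185, 12753139497924812131032305435856553259402679706964756194630200090518584487754119566780883411791655637676608737330942618127075909167732559744009357270871434716897146529939113374704765622604168156028878193416865056575275959295738991276733344393640263042231766957354069190055414648070863046405507327446461524520784631781471311952745455192899002910924295664058943357394328247224789948599646914690233520464077606212505243453941605129776823986824182375601729683016031791177345332390893884725597981869721284684353149257928567686409128555127279285588927700129665276550008919805334807658629984676151606147379692871113901660410578604714379202970881045089339481683621750136183597679088379681498316454587439742118877208826740236233969217553608755920645131095987200740662029057693472796484196049027963065274489248535155709721494610487324898984426230589546651),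
    (131345, 2229487443183602966090739898250054254083472303402064788397067505411380692521587891298205773707098955372365338763458949560861166992429543280877893273153241013963300906440459777125316608596165354346244412642762407201097627801407086130560026980001196466149114623262856489226171270125717101963522824418251143984519829481354185235182977077456566392398768768912337240560233659367823659974643477530217947703499496407387860030136766421715936787480663654368702756036478520748439437696672246653423910491402020587849153977066312233750939857214799958776858679404528842069082520562186507635529602410460925103383425474943083702537721099907685531870568725914758240411760788929121825431952728390671177925010720900338146499790303618535531427351037241807248370359235517543135313496091871730141997195004447299576654995734938256082703391630870528067),
    (2270502852164398365491581287653401703267078922, 0),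
    (8727268179295568253584371425204319284026753888, 0),
    (6960456770273571328531900098215810160077660285, 0),
    (4395381085856612159181289206314666750498812013, 0),
    (3752179451763407371326324800380716409411854546, 0),
    (2859177710036789086565860683462904449844372928, 0),
    (4909227955864888940247959803056047631684471097, 0),
    (6358167971717714079635750222709741631764958068, 0),
    (6603601353369457770234120411819304907220956528, 0),
    (4165363899412708514385783094609169139518299536, 0),
    (4215058663153388106796816403355087046983420810, 0),
    (4488275539461789906511666066830801019882614898, 0),
    (5760082181603899808889472962141624684489101479, 0),
    (10141508956234052332820329123338381074419660297, 0),
    (3421444025423789890453470797082737023694323975, 0),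
    (3301339349811056266824421041148275768195447308, 0),
    (7918176197396511315306836251782862408128401442, 0),
    (2058877180178947284756769332457116991445993700, 0),
    (10141534857117242656636546060461143673066895887, 0),
    (3117109, 17332684332216133612653230673410405972598786574570438704933665),
    (4292358, 5087534518413518454102443087779401579312055589),
    (3088455, 27283221289675920941060),
    (3438595, 7259406)]),
  (200961, [
    (135425, 14670269623281128819062896396502882367411910009051779289558667221691488210711120480427453969403383626197342708935599083649060768002181098432374402501553299119301396314678942877349416976981583031818606181335765511183681152086187633765096025226989011411381147454735039219607626795334794028393849053643438962186200471281841597576885792626463908017993238405432651326044776474424608180122888063171388533085530246460024152987843114703139457452635859758265407468214541187647301836528446544731348579425170074381662887168896306953823855275241236762756848239011466768706333166774652669662164016132388805766476868151887270775998776976511602584952310164513615925187139915336004833555245067156876456101132287238332182706008853746914525729862549465781064853378932832683182620861731922876825639154930412635264799166519304112649971834082442898566568511972804869),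
    (135185, 2909979446680752649495821289971273892266524527332785702356348836732181478450624767132768714118812061113405744207221502797006392300109931472342671462295045145582280090374467979837910978646989077583229005049552100196288143893321761247156012308858784867420282424207276658148054824692971747390223086357974424182877572375989166229537990376621038863677496343572579046382102792411369689856542037279483365831456534332479085784030047090007711832466783747410736363237544977884695915260540957318560472439028038014942843320457913496077905271015912050238693211775544896987264595516106790588862022864647973641456500614450670765856414557717900142673286932102188404301793706535057526280921781464535941071875204590368643634459690240189333349946369070688011758744613509361451727823339722237450251073764253111983621106060774322373444759771994484791),
    (131345, 13305915543742991495428209403240934779747526034991513748293553647687418718270261112408647921048644491382269643643892897188670759515925991488336657749960375657216630510687364104029340338709693400980036969692717404476994218820428827836451591151918678677154184535307193249722938135533456372045740110714657804321897637101595840348664599717234260142231753346369257970263749387275246635927141151415607554347328218452188162868261628594850719866102156571514806893935693085519009554906643872458612582022530541881363728348985329636916166187209946500637130775273209959454194955039234475714856280210773053972526236150001691132069969127260484011202684702912324602777520473361836929411822375045507732444437494706795617982830930606256112977087067926402997212159118358650759327125665273690672282624197786017254540981898907),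
    (3084124787338752299486356491036996985573313632, 0),
    (5171351485050438040269561046875765063127937283, 0),
    (7365626942349009864274708218609441947977910585, 0),
    (1455474893258435093877469598002019582950740052, 0),
    (5547496892432363739368892658760253220371206784, 0),
    (6380116111954170043038170011206379109900210358, 0),
    (8952442549145332316123363059376294835019391059, 0),
    (2053157677796437993400551294510161556561790600, 0),
    (10602131467688687437950230342394418167904451854, 0),
    (5677565079306436389810571476290545784252838020, 0),
    (3947483805177493161358277581300786639913320682, 0),
    (6812485734282083160825286597562567228822326346, 0),
    (6073642873553722065066418322689388641706934302, 0),
    (5140844501130486790391070798761606329888279474, 0),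
    (4074851477953675513971940469003371813994788144, 0),
    (9870823825505106969008139927506348213866616582, 0),
    (4673061085237275498731925168426457487050606156, 0),
    (6158424852625825456606336557581351434176486407, 0),
    (5591277, 3431951638073748962628342284374290410663302601225056357377275450390087949973116909318),
    (2495751, 30758037891099947586193692053453467333467615851722204124525697),
    (5245577, 3423319582409999682659450791144211278272597302),
    (3549189, 6828178020142507296265),
    (3998631, 6451310)]),
  (200721, [
    (135185, 16388696795040483442531630102376424987559133225443541939262023378868290567654183766207891891722290259356879821052806667426663777850488728738143738184074880185990388708505523368958833160320006055829728699821181902603776775463089684023335734007475158240782267360059524617591042206416897631593196693814849616297470386623036556685858585468447939037622970775101503245270577261683279163525917852883151958781898603488488577808582502211412520091039474416408520840433217451915579757221349398662161732107504189662231718011219915180786860952786877310271120824714126526176631865835892938579792941169365887520641060334910855787861023395924672339811294121741265712561335051564698400783929600755129926537558920791841748360224982971082934801004324846975026041149479172930230622652916694818506925784739621107270425899911177),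
    (131345, 1768374471456496044632146395335864847634994209734888280384485075887029229979217481669224652430493797600876226545343295074784659916760695430015919647478910359816614823723431896095969389721577241530978823960167756853471759518571437229739949683397944254199392443390350049632285788719625474050751806109629700744970064761743866671648498617242758560144069146155481760160825177270086947829900453401102486092302465023483414192338453338874664418538725404495384674354809522383605571052737219489987389260388858583606350199364938631771386445763328600832538040935211247441077712102786962129246613812253640037132179724561477283285744832938485458082947003444642080281032252906120272853519902475966831242944862952768806187865133877701901455138401153056860479422284378238974930364534500723221746777689464074),
    (6645876679394149122209239117426791481752945851, 0),
    (2142688709756304705837944297901302545205888667, 0),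
    (4200249589804336465165394845756649283184128039, 0),
    (5846475858000469319362424087882516125923870969, 0),
    (7188788986738768158985740600981899083718361259, 0),
    (8835204395770232848115642863059235659620554624, 0),
    (6934146215619293320242504110420885159482296138, 0),
    (3685908684632198874172889919610958678534463574, 0),
    (3425610372784920725162498053563427648394626618, 0),
    (2588332012231065032836068473115132774902403016, 0),
    (4228190889460068690044972960204319746216430072, 0),
    (2587367070347190120422044363962524382387765610, 0),
    (10314345203213589078525185589292889229729269850, 0),
    (7675444494273682873408574574729152697460924473, 0),
    (3147083906083882450101723920086708240162687140, 0),
    (5954422907910543211137542648249753030546378916, 0),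
    (7586922121646924645815940004854991758045104906, 0),
    (3875298985163903657714765083573187158777201845, 0),
    (4274384, 47817876278625500079845462918574912164248067296131907043068435),
    (5390519, 7975323110621901642050120450857258128290713783),
    (3635808, 18765671214721166878897),
    (4616311, 3155720)]),
  (196881, [
    (131345, 7812874784024853016991026040359237314536321557573732666362827426926892701454631539037516109543646090548105476454015461673542358040410643653016403981916498205789046417246750570004104086158624984871115707694899449909146687293365053432828882267822505094675033477959861312015733320751289220999673458179073350771299424447899013227949512967864548517578512177102340460503980114314093096025084339605176350825221912326738968423145421591670948830075763289961068169295573924829696890461235739053874347486454325892830315987202099122165521247573674475563761915436877456893838325875197049238063293384276402120814936543628929337662488125615583495833798056984687120222093315030472075358740901008256785533353286972514395678434047240223835528023940782308318333818543527489445112250949),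
    (3947306818503927290630503530278880802784740931, 0),
    (9254905997991274365927663777988425607036210297, 0),
    (11690048234063035897519635184140098543961612375, 0),
    (6606395717709394037188519863787987967862245815, 0),
    (7956033218368999333605276670345466610135993884, 0),
    (4371041416410714106223223020221224529021909696, 0),
    (1756537691225624487479538559488551695849714955, 0),
    (9513598112157499131945958754131193276923672845, 0),
    (6784600213502282218959373605633047816607763828, 0),
    (5085669818852671590755007077067025972437302794, 0),
    (10056954206697658733898154452730608852606688096, 0),
    (981624901914075779508347606816286786338586892, 0),
    (6423149591615724817610960516220173167880927312, 0),
    (7015338920071046003562191431088699999327095621, 0),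
    (6783070468524472915377064828558113160963579991, 0),
    (3306794673486008161575350135965311474054963461, 0),
    (8805670623894907561670696343609044983944709023, 0),
    (3061504, 6802459223529955123929239012545091221891575491574799332822250074030528378056724840715),
    (3016563, 24009325893972229312651359946856219564989379962907824776005641),
    (2949798, 5025336310409306050738274941002811160323828232),
    (3846662, 20781914717321461303335),
    (5683056, 2306897)]),
  (2069512, [
    (10926254516415100774438532665606458856404242554, 0),
    (2726622786251536610594442772039433230836994172, 0),
    (1344326412162825471860946204039171010346065944, 0),
    (6100659910379615743201864283159355897841639593, 0),
    (5297864478189425100216310610425917851833733223, 0),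
    (2159731475301039760442241821900372613577922057, 0),
    (3089699955823248921630948484909262436793485837, 0),
    (4395694134842923024746182601616629563908128879, 0),
    (5441616032186332104463110409227494232854063627, 0),
    (4936141639878151613469218351248429375069522691, 0),
    (5419390173931111210092567374689147559935844443, 0),
    (1784454468402669053905048248944836556085376368, 0),
    (4916974100390075520327047920077537896783958042, 0),
    (3480727986077878405118531034443982376219238484, 0),
    (4934137911064392517222352708402577879628144711, 0),
    (9156213131459815924454020825788884553101869660, 0),
    (3213841782688104736276662589472453582224425288, 0),
    (5669387, 10454629667587437416008990112514377176518806704905021244793097),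
    (5180377, 4214911665204237739736799093682242875949785864),
    (4540423, 9152337021896546228833),
    (2593808, 6445578)]),
  (992004, [
    (6021413675080654121604031913305365119375049950, 0),
    (3339728541480271985107272905109349173830971551, 0),
    (3248874639162026412876745018212329553967152800, 0),
    (6288965415301895023391698691414391393741048193, 0),
    (8565824683033676256690987887637410844054110989, 0),
    (5828860120362265724461437872637985854871851124, 0),
    (7153064809855796732920714108036402504064534352, 0),
    (720245793505026032755057211842884912432580144, 0),
    (10440750549481926854720146514515273637848723808, 0),
    (3083427914611698856239883960604620657673088960, 0),
    (2152177159342300907753071314270188561256809349, 0),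
    (3391119381083400660696453729617576146590352416, 0),
    (3796707385051538114097627414927169045195823664, 0),
    (535567739238331849193716232602168389603752848, 0),
    (3222540732775623377849082694811335966802059329, 0),
    (8370116001417504886674456328289699787761131605, 0),
    (5931189, 23991089196360897805155751192190329646895945780650610434118737),
    (3114245, 7196607372075371845664078701073116741809931949),
    (4757258, 13881913656181666335246),
    (2113552, 5753347)]),
  (2033796, [
    (7228059036583868056745515993115188746955158537, 0),
    (12043420652263260835806517502317766860121937159, 0),
    (5822594814573253248137960067292776175375597592, 0),
    (1250982969737671112338966853284584140012587292, 0),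
    (2464367144524049494054622061801444237015822455, 0),
    (3876670981237578958513166132752004402554706464, 0),
    (4048985975027968781884479569621948572653178904, 0),
    (5898690174208231072935926097757140166568088176, 0),
    (4772709318983965439641454014595067281647501519, 0),
    (4028834415651206489801682653693173598172549190, 0),
    (4945352366801926694289736754314768419096727768, 0),
    (803610890929037785690002759475901679983658856, 0),
    (4196035585218353889574439703462537809767547003, 0),
    (3757810398865539550627245941835663872826737961, 0),
    (1786215716769275515976226090210224976007643653, 0),
    (1459008, 32953000627986284614197457305071804121043868970881080249342929),
    (4263017, 4423563338360895662447996544402344928264032454),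
    (6291934, 20968656365946058457186),
    (1572899, 1771540)]),
  (3135168, [
    (1344011955371643876211525733065478967023049225, 0),
    (2076061447188466919983789160764383789738828548, 0),
    (2326603284021923993512853355202860462015645851, 0),
    (5949426209449021855359799323097107539292657840, 0),
    (5424855033580496731993973592096816411129610990, 0),
    (4312763289159350066166019251700007229880404052, 0),
    (2113090967919388282749404409728394020690608133, 0),
    (11215489121562039779356837688761076465119200829, 0),
    (5174566488405415963366908832023198856581306377, 0),
    (8207166994577053214691959361239304520940686720, 0),
    (2631618629023576685741182223757787911454804880, 0),
    (5326437194155108467653278104289010646295713856, 0),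
    (5980116939897327747946815870795832262130555655, 0),
    (10787484633113330894824930707176007099804222391, 0),
    (5440846, 16195351935397807807880294878488070234776179849482413544763480),
    (2097285, 8528815571781370555184684427743793735940297185),
    (3416329, 20518575944420182655769),
    (1975632, 5181089)]),
  (2049424, [
    (2936097945644458812058444471657745912309597552, 0),
    (6363966359020416967639319483643507405349392010, 0),
    (1739501701753758700408576230132395873208408580, 0),
    (7855761520356900971385141901663712599767058460, 0),
    (5447162608892143355127271839174284431159372944, 0),
    (2705424604023228485820270436698335312859376496, 0),
    (4823102401722115519629619216578994266838049287, 0),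
    (1697298545841277553539640417290507754900384773, 0),
    (2677510479791911567716804627378716034445254160, 0),
    (2776500080302305077560727633658286209699326214, 0),
    (2051746157432300006014739472842359303090909960, 0),
    (5467254234893854895225165550011690290915227536, 0),
    (1873445017685630994512043867764922322807279637, 0),
    (3364656, 26741214021126478730215761583763184442376226612122561026272337),
    (3698859, 5292256569646297260776867596170064369206896673),
    (3802841, 9746163546436085024854),
    (1835575, 1901665)]),
  (2032774, [
    (8031972003881653358508119875392704563164596493, 0),
    (5576940912229132700965009854648501981104178454, 0),
    (2511972679639821663036078135491178043054426822, 0),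
    (4997126898105628064979702947886932313392090020, 0),
    (5981162307928805114514265478371581991927118096, 0),
    (3530490870639468024664047312621256853294234114, 0),
    (2320126883022706951039574394583217688042895168, 0),
    (2688415857666615879064469730210107161163007843, 0),
    (7811123255195843582660119952612004126415482121, 0),
    (5639431695083842289493745457729880224835961394, 0),
    (6790380980011798456125198564119634822253185600, 0),
    (3852621204004645577308379641178548916583421600, 0),
    (2249312, 16724062694426473466377148675143818369790336619079628062771469),
    (4338880, 9927185496183410434757060315633171363607152714),
    (2794249, 9795743851809536290934),
    (4240396, 6490790)]),
  (3803591, [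
    (8703191182467105283518932578795896090963085502, 0),
    (4914888816880336190850772459601936122302267419, 0),
    (6515412464010295225026334618350325198861222560, 0),
    (4600726528763406667227076490600596983996240056, 0),
    (7006624986140651379453184389359650660548043277, 0),
    (7614441428981499881468864204456079174884852166, 0),
    (2693686198155453701852661018644993312465619331, 0),
    (2142274994494068870493607343256700701170354699, 0),
    (2962667128120044197981133857574464557405582656, 0),
    (3660122087792739982970626986041410511029667903, 0),
    (5235256551105940544224616235371491267937633725, 0),
    (3887299, 6831172840655747706689027796410937311051214992952016352196897),
    (1796353, 7350898270675636494404140859475480213849114139),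
    (3504389, 20329046337587257017942),
    (2716000, 5965885)]),
  (4878064, [
    (5040047441717947619431342441105142149035658287, 0),
    (3803327910557409219535025695788312848506669200, 0),
    (7418634797560914845488145540055831580058404620, 0),
    (5172040180568085205933162277593000569737677323, 0),
    (6433995083566195487098258240605773468076937988, 0),
    (6720892642577829151564831603485272928632045997, 0),
    (1339852354346952132995337692905684028042996784, 0),
    (7513972372473988615253851661600128235627051021, 0),
    (4221475038643672694687391244403294097600503929, 0),
    (2862204867916596530844732941026035444013350930, 0),
    (4623363, 15747090884512047839656830696679054661269663938406887718122433),
    (4336848, 4411083089268269776040031747293072135161581633),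
    (3559945, 12693787696630958195901),
    (5871366, 3753697)]),
  (3083079, [
    (987507658092245764994811671664948595055634693, 0),
    (714669305493061721579597674576716056916752720, 0),
    (2679278627838190953854234660583138440587052612, 0),
    (1806712979350163608745219012427829256524270391, 0),
    (3414126546132355963860144703190571027165182220, 0),
    (4242790340168380750086803636264975025108289595, 0),
    (4729432327263711976841737401254733608731869257, 0),
    (5264447335541486781920933800664251911772481282, 0),
    (5103800084594289939205655752146330437886521446, 0),
    (4525156, 19040018868819518200504437087525078551891490173730350779847172),
    (2568265, 6514437844975118512915360120671081367238151404),
    (3753648, 22848621368778065264740),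
    (2756754, 8035344)]),
  (2295874, [
    (7178139511628558813215368373696664984867123435, 0),
    (3391546734337928410418183446427900538785703685, 0),
    (6734863186838299086965947915545767886939819539, 0),
    (5798819912555986842391854593591597294701617301, 0),
    (5623408471528492904425598858464467741274540837, 0),
    (5891451586289292406288867016155853733096720357, 0),
    (2698463716787234845239939231063747814008113675, 0),
    (10150541392981419170427511079388797128535011528, 0),
    (4432024, 9692072427744639491611211112024006429441294260282884918888257),
    (4064584, 9191451474436840235005203030076161749236423175),
    (6095484, 13349687228619328922129),
    (2117683, 8651997)]),
  (3951882, [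
    (2946226028187903958582965663515502573211389216, 0),
    (1439446161766927756579813147228415139121486087, 0),
    (3073322889589078999655012413344615898017267737, 0),
    (4122511447906600743206803865270594459178133515, 0),
    (1706705297764500361265242870540961006705459226, 0),
    (4160137172996542295565641599149085813750038974, 0),
    (6069688761340779188539962201423034875646983175, 0),
    (6642698, 28261375893421009840443019653334924600796011048294613486622469),
    (3299200, 5104104948401585797855159196831671580193072017),
    (1590032, 48127532881919376841569),
    (4917552, 7687777)]),
  (2229110, [
    (7247175998381070402461812966989865150921966417, 0),
    (4644405247433349275347115306116167339638747233, 0),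
    (6449292801807374501049795483834287254728269360, 0),
    (3630158239559432892910852580992592262198093572, 0),
    (7049956540045626793152044047570285822613357572, 0),
    (3272682037712647693578154265941453613336338504, 0),
    (3092635, 30955993455271173103755547774717737290936768027507788351570102),
    (3756199, 4571749461154546917215897615138835669276397669),
    (4563090, 9835587127738879184862),
    (3752097, 5246314)]),
  (2188040, [
    (13023304474888617962675611617148719859044911528, 0),
    (4461052940887122726383132441099403027157905927, 0),
    (8834783779753417142305238648001988264668516535, 0),
    (6605768248360671072991406097156096291447243107, 0),
    (4309779684879054263495069421260917884224086263, 0),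
    (2874625, 17085094245674848223110543968743477864952560172954514625618013),
    (2208005, 4033998546004831796935675415416204887045653537),
    (4825236, 33355154243551129661550),
    (3670858, 4951297)]),
  (3147305, [
    (3333264574987568920162458676762287987639400193, 0),
    (2269147145169045826279693932631390893776983872, 0),
    (11122278915132444069738156653050565730740273831, 0),
    (10073534090178352438593314039933582075697365377, 0),
    (6221136, 29478330493826363385837172634986125050248676654657920943438129),
    (3156016, 1706077886922051345098489923896012083796314438),
    (3577120, 20965301230574957717393),
    (5339657, 2892881)]),
  (2691850, [
    (5424814228358391209782899786375599822893157168, 0),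
    (2943839990171713440744764032194178353482173051, 0),
    (3540491068375982513412740166252205261175427286, 0),
    (5155280, 16253182346554555973982396687861077594519707778150311363032837),
    (3752029, 3893265960032889819817876585674761728314524428),
    (5328448, 8379438356613057219592),
    (5676290, 1163297)]),
  (1446736, [
    (6692458558821231311792528000372422650781733044, 0),
    (7493648010346635548089653097503907615279523343, 0),
    (3607905, 10053171212024706938252165607868531345985065660234789379461246),
    (4217280, 3150176284618347334555841984693989229752303788),
    (2445728, 20379194125057168203841),
    (3022963, 2851873)]),
  (5001436, [
    (4337575281233522166716944443158914308305629404, 0),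
    (5156942, 29341650368321999422466905683970352728080946741778977215779016),
    (4113584, 8031419330759430163680911473270392804483627012),
    (4984465, 7378860050914512931797),
    (2711605, 1925171)]),
  (5152965, [
    (5683696, 17025952087899318851881401041214560663787720560735899290490145),
    (6393356, 10554041443035153977402228382864734727888701102),
    (5528720, 12306356615316596615686),
    (5865675, 5033217)]),
  (8749275, [
    (7537099, 6641044467864697339857),
    (2391298, 2568275)])]

noncomputable def cert13 : List (ℕ × List (ℕ × ℕ)) := [
  (200976, [
    (135440, 4269904359032011298762405984940559341749121754521900561992811557686634920141449369546611999767857496411209326541122046311028611068161053833303287759413439423251973151085023412835941952274354624309388075232313735902029451983553947559619114046983475937197887988241222275829138184987910188591140933748028729318938070430104992872280173305336388486693224176916893339963151304547925662884584965013528643045780224793291749023559166798259572634299655827188660123644313045367576454591641159034795666005166786641404961715939557395494272656353551684116149637356715625790917028289097845419022630691288362441622692925347611569650357518873347640306739113518648925213985473432601538576721431227447110164385773491986342739660100699612404914658225898532414384088588606002664445944690831946577506908888997588121777782427724075538867463305281912909751602237311429171605887662314282260324475727333029613496634258987174180103974439212000011905218986463207276654044171518259098362967793182683496808835764983229786220236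795523118652069452994451388168965248173428741076769977916030012901967653087381262421690378),
    (135425, 1905124055602950671070861585221948718624166408326780867571489755621684232474822504060230608633032897707227011698349716025970745091963837654611355218772783370612746099648963270892635325352354212899286033757686423137178416008083323781161288324027895824410260574535365996532745535583877412676225733829938950313550781296438639041956533818523913812158876036342330690857363803627406870285753869296505580181802096908105808634691545409223453721947089591996230643845458855099067386627176769495044939883163082177181355520307391691337694676690169909886272837478790810995193986675557122836851516981655269890613133352657126127113978667161247614684597253429973302000824182637498163710767827171388639853794648103272361790343525683448811605427871648007827851873441055164932342860031411585053986428991132659632168968902124520310941576794439078327992112081450597764339849047177332382858580707450146294735904138090907800086099019419163855432012456567671019830196969692055590814601472654360820581878713491795929673457772113921590200141070657132138901565700536373309874793471385208832130485365),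
    (135185, 4116646578527580173652982505675626132111038373900372128209130211400804488386981947880306566915309841053642662600063216426653114668485126992890964253535387225577353732616225333117246845081587852838950289925338392869994118271827488539299426822560297871481635597994414704721828457975814026132969149819022763977473650034442390395044810492224381566843993841771038982330890268021352964542357436602291468707128975888055834489066442364667588553657139045958640099137946033438070874112646755466469149431264786114610707273027253980627528678562616703945858429621529966314976490140222852537589047553890627570170952574287199408560445881835483271175794300448022899127108967097636338667117973920075550473497188989465075800718306697764120320447604916521614532592463183871192805426946207404246075521193460061248356389773960906922446120481490507541437835232388684684807202325391068811087163503139472134628093193304661342469188954334075634078059139927053305643252329284674757715389147041814957049292019746439272500674293930515387229840060030564771306036249963853709859),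
    (131345, 668722614409302609899575460186209467895090912223604765646248603051255926165054652332585420597466018314155663712448675292785393702742697119192969014050443772814039909704808451064572831047484763371886828760530186441094005016417401700936877958680924438981259910775014614813662603636666140727995681908119670138048866986784673238545661297070597519545688050785210447238277985994184027803006107121454586194439890960455252544502502570035841986138767280500626446092158717701278231079643426286860817850200470808419472492736626549843351568477276551214592551786219850759869687596268808998458667777504887390248445425746412919508202173232705490741471919050018888995356500264125058276157002923796000082047995200331771401601272415318478861029634698385359931569211791094953737142493123730978478798090373297895243367532946959348592684760083581744550937241832049167007077681661741199897778702490769439350708337464473379598161197921652547484469757526013833560579052313016529028913269337063719137649014623445833879701117768277613829020617877998970369797),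
    (10819709434849112281250105834532090993416171754, 0),
    (10191455559649761364053366185612749506296374688, 0),
    (4677652163921731875132997521647968048766810816, 0),
    (6335705220158160649289447951246997729065742516, 0),
    (4850956613595521941769345563469362734969388624, 0),
    (3509231417759178472334586657910978467011662528, 0),
    (5523398103657161566041808075163658413345331072, 0),
    (5812135862180421045632112823255511140331786296, 0),
    (5781481840402149922676299787867929695375413371, 0),
    (10351272562633718084601303085364763301877530661, 0),
    (2923500581326500375782270244961067270276748812, 0),
    (7920612578187881840102638781214046910126723131, 0),
    (8972739788446096256902771962706973509318969869, 0),
    (6762736534040525873096933986679914933620994248, 0),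
    (5491712477420292246913433136927229711202764803, 0),
    (8139086111728595126125643531785036944941932579, 0),
    (6024700791123026014321709453758073126222817036, 0),
    (1873766249416034587882949528126996538566432688, 0),
    (15783660072222981186086597825895150476254970969, 0),
    (11155922063243119182157843041158276330559672768, 0),
    (9280568668482661398864019403077284177855985928, 0),
    (9082220781840169452733627384028566129465049260, 0),
    (4427400345871606883786299353403630991835459337, 0),
    (11672009180779810567782773481222456591631647671, 0),
    (3279208, 1946492456272162574428637933222390076987266010260507390741268445692055),
    (459010, 150219267847150684900632722178717660737264165369311450),
    (4097856, 881423898480290848321868425153),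
    (2625800, 348511166945292)]),
  (200961, [
    (135425, 5061675523277982584055673654818103948963115091733005082832837965892460403220772970603857419097167176471007709093141166367446975822578720672981705279881124620530196203387259508257510357283390503195315048115764225974602243494719255212112867358551318650603847771575792857461283182478685982289503611214444220203326605874549723613850858858353953306532723173012809952789433462700635814850948660001586101397923075476430563640404169636462252498169842917681323724973279517650154889472037078835553094471481965863718319228148602067718094482070646529059575238799220336786562671334799747499697193932001976440377437877630939012629178625203545987256612824380110285911674429990049698719192482997142909636015812245503782892371469302360577118201199676047220316839151748771287633878928282521926467256888885799495544640633073372715381673763637686697603113033585433876535026296999558650196621206380138989488012319001311414113100570770512116458068377463719115019464594822819579336844747639877630065523690530937427892775233796436153790689542902127910310016265096468977761),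
    (135185, 946244321823975982737870023584977774450991307220765202807908882825213651962836711140474051466330161303996747243983204517624251480643929285248114144352680576080620194155659509609449003430445354875893607920112920884084332794289554075705708549929254136246746368711937338250763216931710160858505121905074322399669363574041236903086440337812508432623287781650630284147189333638611671691216520779310445703320462368052241024398783876612467676924834879495327585494583253137890980347952983874947388081150043946572833386392942237646569717321985661659697298402502928621837314475794338323148390523850359367754942421924291397422493441766667800887176056987623280461251389369350109826996833246550504002637843187217730143371159587642135853162851643110481524184851267831972990684634312532611761419868154262164796467177975093154567523324770667689307959795787250376733488861937717085020547026680814186569097228895804524284012495627263059944749641197603775531982013325214700680937982039801435559868539987486487012237082423151406839951997357528884678805),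
    (131345, 5455820605529001191452668842766232792697870429580003638156673185485885356323034420717922803945044455132187410690176602926377051807140234626413300515369656626054377359366230533702687343786524150515599014512278200804290203977797475498033428754637333207737614998899883966647315247523843179756826897456302867621878252379581906672404003636327085549041274183929286736482363980759393671434457400198336154046914663999208494975852122809567455730840685963441110889016766989758797407838600692804903789392955524385267874498757066926641887768634556234008695445956739487428410278716418679039303126808573052092350305367885138214055287993862049374662652093777451920655711378023881538250577530735579606676921069034607877183452340813512732025154644809606414124708859712324139111916018525767710797928721465111033744359970846479472088172516143792875392174200363846138425369038202078816568160896485535378543393215664630929042897730464302068964310116051569685085363922151016767977735896555158191695495260262116552456982472031048969),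
    (2174416596142112476453608106565089779809841247, 0),
    (6893500245008442183288273246018716620115554425, 0),
    (6184980489781942694967192904856107764828561593, 0),
    (8706437498897445644993266185625141369468506150, 0),
    (5263788499747263417959466201599173750484864096, 0),
    (8675213192617337849457876896034589995954237482, 0),
    (6445099302339478009496529004794035853081719328, 0),
    (8672916944556170385728613875969538511135396057, 0),
    (5296586284708876782392672798416173291592483239, 0),
    (7699434429469544328329642886696403878358979024, 0),
    (8502875083658524021731204541916997525566981799, 0),
    (1962905350313173332020958363525252502192458673, 0),
    (9191267747511801082351464066810356038485512393, 0),
    (4560562426159950774540615371877451992155161332, 0),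
    (10414547497408992605483808583848133446143117478, 0),
    (2336071176504635807220841934963739732469851120, 0),
    (3049697761946305569350437232142222548198598411, 0),
    (4998918213666330954171404794304177875949806208, 0),
    (3863760686154120759018571506089527407599165526, 0),
    (9330727681499358920436267651739292996682028256, 0),
    (1695255487737273315815664625917033876084494450, 0),
    (7940027763406012529297102634014676003875726160, 0),
    (4945289726038738278277117656040275481704968431, 0),
    (6495462409348196836843641225104631474264803783, 0),
    (4458868, 437013201657675278898622147766306236711453849522127457),
    (4558672, 2208532184852529254856756214225),
    (3318536, 312871191430977)]),
  (200721, [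
    (135185, 2888741303634291765332664823304542685821875578917691479897483958677502658336865411459965429900567923698765021083848278146831931131284991705128436213791713269596441717144512188379370187520426489677895556801722133102620197678236515437959945922786391633134267918861043938250924727397764426325969583315013126744384600605548988489245831706285934550947002960368970083167679675660972009480171851817047347350726531601254536094658934402678017025809467751285814073001797559499919648966721500596363334528902593570622079299672970562783002778624158224609992540493143591372891747990872725696339561128424037448630752900531080470631537420075902667414044896524523863746391635774072995671749942004966661504879737825699129010170892179681553512408786035507925251723558790597713478259331185232422706942354437177460054494412071556466600951156014358127741511550440495391345184321432191752346375733814883181623968796292655600492455109140986285792869679370787649738925575437564462843733568444594582438665128576049343276524435277808517),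
    (131345, 849960662025556400397516881569439215067874903560060037815446001161630779276943918807236713470361165414873496413028076040216079765423307983609835430780356513493401700376224278069725215085343688362706501471653174945856811025198831411698621497545123762979008582955523369682731278416010030918125537825073163034353089243546794004630430460677431359760060739755875582630912702941184134807839314418697152473228026309230888797502895146606625147746572690698459254144082207228809940330212834420295961386161103451523319355487117034839809329517787800069424863731218073573345012440648418101291172597714083663235067511277425269506830804071678168891485937272436432915889065664179765071690400951024502946837550945902922744789230982529043787573891016535571275438265438418043082864348423906697386117288800937968805622309313391601366764781513570780147185286105095953021380144378454202239869123848545779453794237871430949084949418065293698283511567368474642835103879469859821949292550648220882372888686495610528780),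
    (7261339891930854546255371373695312513424638172, 0),
    (9483619273941828782764421931364976132989475335, 0),
    (4502855856752977534950743057940661264600349072, 0),
    (8522630673330923537835600517930213387868179847, 0),
    (6088279054725475548451781014590857948542437131, 0),
    (4153584698305871661873161334892942460719757573, 0),
    (6991438891184673999835728300215399411057165861, 0),
    (11406951036716135612924187823877661645596984936, 0),
    (5353794590088732481818164133057463925933378049, 0),
    (5556130529740087079217055108140395771775683149, 0),
    (7413408041076318612957990284902214086973399814, 0),
    (4394771351605253329884360197702066312263981064, 0),
    (8859009194128740486734907187075513668108442848, 0),
    (11211307677881623330674942174386098848878038363, 0),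
    (4641542691193202873028722397415047324182381692, 0),
    (1455951238978428405353353482394127281569023088, 0),
    (2787711662652633694021565668284878805049163873, 0),
    (2949432899163644513944798665797620251336667160, 0),
    (3683913315437007094484557230143643286971305408, 0),
    (8216060691161277998557237629177814866549178556, 0),
    (6562187624473057741860792772604088633349272583, 0),
    (7298229287542221986900387942172514526763287954, 0),
    (8229248633083926422993686233541362213734189859, 0),
    (4040368, 1107122220657544365190111588628244503804124255921966913827726505620745),
    (5128412, 189694425768259930343365931781416217767314935604708268),
    (5483360, 1057258837669198653567710869393),
    (2819377, 181427003810307)]),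
  (196881, [
    (131345, 1300337943747996607161558633604553678028193873853431020827676190739476348375850465765472766619232282580479472546593167636664687334782266867992187368501663619288987849915651017029584840006920036407889200726216290562766262438654846047816569209339715775293839303147736130509318035038974097931876074284927185205290372821656476912350840364226118215540124175554105780742892898973586180697313254536393262548972163190817675942298698652615057010943264037847999997053855560925620633024001071289884951989110789811368950352051614470701577212883512891420277775917257541770792734174207212213043512461681414870092627829372108230854459241122792213058699435527534516626353724313281116737495925020252724768738784494380013374495255863573069374758161810607750553419608780363719164842741739937169790328851898265721404468863307860548085418318208306960268445157688435402629886141083648016033410428572813514758245343163648950142108660860091342411232718473931945856460674257981097260676699875233),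
    (7985415860411086301814333746344905457485808694, 0),
    (8890375196397944826794509597566283428296592308, 0),
    (3836127005114153654551962966309936087333067840, 0),
    (8351680868225747525237388560220169870172686499, 0),
    (5763631969555426449912669678758398797065444416, 0),
    (9504734515476590072784442910880489765322819205, 0),
    (7047547377769520753266950555928482047385058688, 0),
    (3681147513611241477593600295334699182036486227, 0),
    (4284532135672191719708896216195770640555639499, 0),
    (5642186623933034656211524178480302024009589504, 0),
    (6732392798381669565890381979093062836085090640, 0),
    (6450671687693838431567180222208801585093582144, 0),
    (8591535064228585507379795470358126189750377072, 0),
    (12346228332264416009001014519493661753534616328, 0),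
    (6273843254641338292353853625061238295078306848, 0),
    (8345377492988969482986871860485228728010659334, 0),
    (5774157588997381503841023887857163539045495809, 0),
    (11222458114284156278200970854449116915624166800, 0),
    (2447898830956854619134249767304774751503855797, 0),
    (4868882723784943855830985975471343482587216395, 0),
    (3590572460689173493485798713763843642430393189, 0),
    (6481155470357550178282065544472674203781566466, 0),
    (7615935910877536304535620615209479976530574256, 0),
    (4038851, 337117553399915962311369812919935012063924657356509239),
    (3543223, 1902168012145042442774697346700),
    (7138056, 419064257730058)]),
  (2863211, [
    (2701330253062648042348567982741215946453110496, 0),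
    (8358600820558553461812475353735890717471409389, 0),
    (2230092320380282886384928567998868442451543017, 0),
    (2767278450378046364605409501923091870207771749, 0),
    (9472489306154235482257945423768478455746054916, 0),
    (2359109699813538433654725903863416060530092848, 0),
    (1098443817111085452980805128014311468245819509, 0),
    (2280252614431090372909997267449632478572411312, 0),
    (6541958615300970256247238351927446688537211084, 0),
    (6019460407680683521380833237296967416559764913, 0),
    (3311824012394175354191718258314173601136713827, 0),
    (9706677115855022788871835616700864324886745712, 0),
    (1974748498930941241621419073221390316704316128, 0),
    (5425484011542431336612917914595469990631862362, 0),
    (7436275026585519209697211537263238999773873557, 0),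
    (5030221424446742355115654243885636751824354112, 0),
    (3765003979637584453315789087751877111590748855, 0),
    (3390852596769543316948988236287658118173951378, 0),
    (8922595701096038956489998147561841121731729161, 0),
    (9191574010928878650237629380300007112451072125, 0),
    (5979522125097812879583089636800475422528136608, 0),
    (4239241936936832148781630215076749509130914606, 0),
    (5703339, 2053635797568707572829351848602123829183031374035422606707929017196583),
    (4274544, 361923348823697731717822441823618682216856149905313817),
    (1709062, 1350210278929427441108231677009),
    (3698786, 176385853775955)]),
  (2065552, [
    (6590017310252393443453989020711845083869839882, 0),
    (8118207675602357141982816595804040804658917680, 0),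
    (5190539327442480101830107368243299858059747415, 0),
    (10190407492193327571786881019261306006667018326, 0),
    (6403102869717220878429944237983111208770412562, 0),
    (2154463954754323287596544846876494637700331328, 0),
    (5531529449148214878351272762852184108050339504, 0),
    (8049066373111410080543352957118852618599944258, 0),
    (4050730991257127934570748777849331242536886531, 0),
    (2054152652800815624206932241079127605714122502, 0),
    (4195378110798649752333203324470466550542879344, 0),
    (2884157196142324306253243394803857729106706482, 0),
    (3958449123939792134455370596009914250463573252, 0),
    (4315221473052300284843619503225266925846996999, 0),
    (9011870810800846622599893244559291941278666800, 0),
    (3315646146430304501568824993168320688902552128, 0),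
    (7058422722613699359497846932217610264689446033, 0),
    (9013946550260791115837507071328778951600829965, 0),
    (3133506700644969013457566632474031039778850665, 0),
    (8746159339831120411565696481112301270052139028, 0),
    (7738409013691407466356718877250157092657497593, 0),
    (4817930, 2218618186055320349846959438100463665481564925748691192880198787710273),
    (3302148, 281457085502214310889316297495115504190292383910608417),
    (6806336, 1416841734409871517580640717442),
    (7319714, 442966020432465)]),
  (2333189, [
    (3183528064075452126414797808117561597435887826, 0),
    (3973024048264604725590516217389356985102580491, 0),
    (2906769608893200530714557828028490737172316681, 0),
    (9611743701012309673281504476551629940420277440, 0),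
    (7440106591459736631082732621907629917012865078, 0),
    (6379417902447816539658575251755272411930329221, 0),
    (4299971377590924656253369528647573794722241030, 0),
    (11507792967480738227353850660936360522176877168, 0),
    (2944811863575258471492994455622035253256888582, 0),
    (3804024853931746641710292432281711585635370576, 0),
    (2945122236595205714709973816111171664813332993, 0),
    (4203930115777521802930831311048820493996642409, 0),
    (6050136140377367972644938068511197102881481994, 0),
    (8898121300715728574672159408191429051183773443, 0),
    (4483255704826448269058144235251070302385146139, 0),
    (3135280155035670217108720590203726362859221296, 0),
    (7524770220222600730076329147350798008794378258, 0),
    (4934395231929046771876880179845719462861590432, 0),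
    (4302105661855366197579907588026151207584860722, 0),
    (2683077549209140945340720879780934877701196804, 0),
    (5944326, 2716429817272963035466349659134879900513852980789086428131682382340229),
    (8105600, 390139101616979538975695839905381123930342496082783617),
    (3344997, 1136456474012907140788628454410),
    (8384688, 221061970609761)]),
  (3636747, [
    (7048660841251312136555083079979275663420372740, 0),
    (2588789393093089434362218846198989021241737523, 0),
    (1812047165563756504857468390030720064841961625, 0),
    (5246417907725093733566111922623138639222517865, 0),
    (3805077069846165224497517378591210057155519752, 0),
    (3498102794805518108797911029743980099548517902, 0),
    (7988675801734828781872326350950145765034209427, 0),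
    (10768839914501794369269693711515785669877139458, 0),
    (7496996407830863255672216762085324802802225240, 0),
    (7019340629799596359857059619681055989419636192, 0),
    (4588623438275670284549928513757768034591826137, 0),
    (5021506201033800665659423551915793494890500101, 0),
    (2321456704956568410980527211834534053124753024, 0),
    (5599686718694646835597017320548821862739645954, 0),
    (5977789405537675741706472636951592706650308944, 0),
    (7275283398048863936717227819716444464882379271, 0),
    (5711649142212206066993290337101504540360392761, 0),
    (7366570272733429442251483603749982580004192374, 0),
    (5846345165621371406287549261601283966682640752, 0),
    (6272608, 703018803241185060208534829227503724057616884663713171714940890481985),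
    (6594635, 317388379607121732826985167708721548390399216455791393),
    (4739148, 318175092817757013522818371705),
    (1969234, 322712369906577)]),
  (3271008, [
    (4560708120242474939709012547866599059378080280, 0),
    (2884266136366579824376219631162692267192841760, 0),
    (5442089646939867608434524433466851331995501920, 0),
    (7320441556626655950562824832856142140844710927, 0),
    (9636834796600420672259059865535734556421517444, 0),
    (6394959269449773973917927100162427291082679565, 0),
    (3339757140495031683194081843463188376196587625, 0),
    (6238818710557136965193236074839869160625070261, 0),
    (5480566075065792806526450612407074286998737154, 0),
    (6051059005662131264379782545227720624386774720, 0),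
    (5621012928874494501539936115146129727492360965, 0),
    (3864312039989485777501552796183164035630747802, 0),
    (7363431443378003276761591836552048040306597980, 0),
    (7381832567291868200770335745934515499230925328, 0),
    (2954925005952230976671357999065331316236527115, 0),
    (5302372515911704122445387206651066208732447131, 0),
    (7230157873432131610394752654768860607620248586, 0),
    (11111622714862353054881087699766934663248188418, 0),
    (4282886, 3179081899892652547456588915537458349677157700820155390231114403844171),
    (7792898, 413297600629541676839044653868661734457624652828180648),
    (1049874, 1312760767291202548840170457156),
    (2908176, 233154316424451)]),
  (2557355, [
    (4042365436302166149541018164662038118280772176, 0),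
    (1354820706310967253063761604572018656802271337, 0),
    (2492371015139614590014664872675539412043096215, 0),
    (10052361839568447331429228030180785777409094480, 0),
    (5952910678810532411976113786342619873190708560, 0),
    (1973640494297760790772398924166411669559873168, 0),
    (2051891820724847285251512471167700670405937570, 0),
    (2179965979441014732125051852342236376465059849, 0),
    (8340684331867772020864028937297479450678286344, 0),
    (2966434747821566705751077112355534656590355464, 0),
    (8963745403984977062832106853482217779940167252, 0),
    (4421303862145187686553439615477601468760113333, 0),
    (9037694243261650771807860843125223115976976390, 0),
    (4327398179782047951007376833175159202462154871, 0),
    (5203587181421935039807030535486357195380875445, 0),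
    (3665001834950916050118814553251812141673009191, 0),
    (12103043534399270017600148060326306604149899725, 0),
    (3542046, 2141691660423475304307534275101091913506177729512451740817244506284153),
    (3683594, 397131559710981274929584077046419157258542264553398442),
    (4297584, 535037957639583813531706352001),
    (6856870, 92434141765699)]),
  (2113641, [
    (5272427653590134282773303206998513403336905996, 0),
    (3964029625765875345764672192824393477628270341, 0),
    (4622032387666879174770546617398004539247317824, 0),
    (5939679120261838233757585810928831100221921543, 0),
    (4017172329364806915901691695037691008568200908, 0),
    (3083133847461557430559077214541879461024469766, 0),
    (2972641597071032069781874709223453470365704402, 0),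
    (2678558603648839373238702007415641116244229125, 0),
    (8435963424754504356637157289424134452245432752, 0),
    (4961970288758618483371584501707157258906952976, 0),
    (3802351945553601539301708301339260340939227173, 0),
    (10350876592633839158280871901768744336075957763, 0),
    (10017583599400500629375972369424892003132880720, 0),
    (1962951587526875090845193623952205611258773620, 0),
    (3213550583824346042874225825427221651102245053, 0),
    (2153089099790496721270344189616805261281067062, 0),
    (2884456, 1707981102895209990704460688485130220943117472109198476700906413877252),
    (4821514, 287556936141560504986478385416768372632072613348721297),
    (5124205, 1419390148271492066542689223985),
    (7451658, 256581686442529)]),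
  (3607543, [
    (7236820608302157528340589689138638948844016395, 0),
    (10230445166247289903218361567606441038618202308, 0),
    (3036743865785866018462354374491312637382392325, 0),
    (1806470647133877046012794784660518696052772939, 0),
    (3361886402666853517920224319755190766496366759, 0),
    (1524817636396417406399855898330476818748885259, 0),
    (2726701730073733434721151341958176881446131280, 0),
    (4043056908257607375330410434542668030124118270, 0),
    (6382199997415811769574687912063241094530177037, 0),
    (8475325904353235895229885183402674392473022472, 0),
    (5491920585687309435679731979098522931981707888, 0),
    (6361342125629558046081897314774078195914442869, 0),
    (2856086659912410824959469118107265417150027296, 0),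
    (2064648376140776679709700474375024029467711712, 0),
    (4820318970935153746632970202462819923663654965, 0),
    (7796495, 1624392354233380834546943369415071437660675031950447132105756149611889),
    (2295922, 299527006222293135701971741432738023606962554901049857),
    (5957891, 1439957925409125995635551409410),
    (2037056, 513816269049972)]),
  (2449495, [
    (5302112459684806065164167246287187760554115722, 0),
    (1834324852082969142296264282609806732076302549, 0),
    (5944195382437830490271521226505245555555369382, 0),
    (5634082395916530883050800346467979269236710512, 0),
    (6935757825672220500161257650542899495007232229, 0),
    (1696261363298021449520322999440243488179947589, 0),
    (5532687847560466383121187510406023454352776320, 0),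
    (13290874010056454183075872409969947814223093376, 0),
    (3223508614110649652700556942750684437150651840, 0),
    (5363408253171304377966144174822044224351671568, 0),
    (8134444620537528127786807669680989129696106244, 0),
    (13653252912046904922635488945201492853875564633, 0),
    (10942566297046181428562463919479798142955816018, 0),
    (9585748906481581665133514052394254526675633160, 0),
    (2897968, 2625020364900311713543621562682284591837614489052772433012142568845499),
    (3697168, 362180115390335950920374948405949297834322402701338641),
    (1982473, 2137385415138895322873159914225),
    (991235, 180396214167825)]),
  (2043990, [
    (9178505805326462070214546879179060785358379271, 0),
    (7357511928077775207828501072525722470840084608, 0),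
    (5675686736426487017202450307959581375637529350, 0),
    (7430351385653924031522475113167233733104435945, 0),
    (5354284548705205106840274538907991180965060864, 0),
    (5753753014215982212192539315046172295121883657, 0),
    (10935050167086996747557287410453891896405879696, 0),
    (5247382901179207250135782694774751939776465668, 0),
    (6393410333872704464163084481887679801082156368, 0),
    (7971482054345651070184993610543273781353336974, 0),
    (9069103709686582446860622297757277197884800261, 0),
    (8817374932206372502512770952213099515231296672, 0),
    (3837060784225444107380509592178765113642213528, 0),
    (3429504, 2006146521845111013992086129199396431270248120596298902683305439574561),
    (2375762, 511463828831144091568094938383814194599701316588683272),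
    (3384064, 1214463632204190696944398936929),
    (6929424, 474441689048841)]),
  (1902466, [
    (4791371748828965630767006358558976052370894993, 0),
    (4204045819759184432004334917694604064537349056, 0),
    (5843146481717807984501649231331431715879977913, 0),
    (9456810494132378710017675466571869945901905155, 0),
    (8162215810190109821998505210365423979466954576, 0),
    (1356512571051794581209205217216957778946062944, 0),
    (8657153795350174505011625136561768583398794336, 0),
    (6261098948374449050007677244342408976508721024, 0),
    (7985648697288035243410551076422755006711701538, 0),
    (7302814994645303939449694419785647562957415175, 0),
    (7181689358553058286780687360023896504468862475, 0),
    (3685249996639117260897020872110386685048369380, 0),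
    (2969625, 3300993253331116887674913099655769517070153462801870943336209612342673),
    (4326840, 981700886687821566296591781456566652895810513710315025),
    (2491701, 796538578446346418834482439569),
    (926208, 255815773390714)]),
  (3911772, [
    (6958265419569914183462978812987981987909038248, 0),
    (2141787654350811796739550945514240699743761552, 0),
    (10665584605180184661616764595404986085570219952, 0),
    (4747859275597829060246086120515735839269009536, 0),
    (5109788997898478691566535127085551877817049520, 0),
    (2905729731510717711990660076848344567282328585, 0),
    (8530949869863692157042477041539867686155650449, 0),
    (7989390388432580367109904206670743233492146950, 0),
    (5002531978197213728014683356632401812918120602, 0),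
    (5086161152513115418614767360013404184039458365, 0),
    (3569219083328127777404184773390836118630499242, 0),
    (3048200, 2054098168965708068949162441821427794738878082843960079981600099600282),
    (3362857, 269507115639384728098458838098630391005675085894816945),
    (6647963, 1371659938272598860555837904909),
    (5588912, 278116317706881)]),
  (3607403, [
    (6741795482041083261811586453133624692186613671, 0),
    (3571714066245046954210138974583148277727896324, 0),
    (5386784319614167905389720306466337106453596047, 0),
    (8023026699362369345261455298279408636178401022, 0),
    (2789400749792327523888520963641173045792016352, 0),
    (6046639411318990756438869008405782297556486190, 0),
    (7096876031349719196405447539529190272488928521, 0),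
    (5826322959935202377090896296436388438462416816, 0),
    (5486898081619116338560663020291075256724750904, 0),
    (4512460045983824821381884307873702317361070181, 0),
    (5768903, 1240519994869118014453576183891107104388942991957433334837867487036050),
    (2898528, 524028723929495921446443623583763154647537858057905233),
    (4174992, 2213493321765938759519055072265),
    (5123592, 444400807511626)]),
  (3362312, [
    (6959184158297538709734082784736072153470142237, 0),
    (2732016905339589814011116535250772625034854450, 0),
    (3183464200884967768841069843685507114181304362, 0),
    (5778658951015290945434323842610217365114619568, 0),
    (9282193902614755935632856957304922600258636551, 0),
    (4908370449813046432647920263500990533118810128, 0),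
    (6908369168162016522203976279247710908784742656, 0),
    (6486036504964776494486751985119519118382348039, 0),
    (5570323020204102455914250985716041155034527244, 0),
    (3576928, 1512982221178684508748638813901374495457992869933178282971352424838415),
    (2753400, 511666340309336672903811982764331864024180283789216132),
    (3244129, 1032301772551696872491414693425),
    (5205328, 362842600050058)]),
  (2756792, [
    (10604155503570431440488542597325375439017130500, 0),
    (11501835369447016979071491405998684175627460101, 0),
    (1071158569167626535700166460233488844857541739, 0),
    (6915339418376086568099334691901529807151894141, 0),
    (10262233062909712530707944070777023479569404087, 0),
    (7765287230686130087581191030481715232503956687, 0),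
    (5737573162080725682097963714838546698816043696, 0),
    (7139622349857111636087386869452810928195962337, 0),
    (3548816, 1793471237463999925682735828665912446233262546897464779547053044925308),
    (3016980, 284381919296827979518722071789333120123127646076536252),
    (4423845, 1638647892844648643768680650081),
    (8326777, 410823088975965)]),
  (3903685, [
    (8564462157079175488988717890601999135397345504, 0),
    (11676545846541159428731212123085293139332171731, 0),
    (5242421554052258989830790740973988474656794368, 0),
    (3691821452328497515475071689095299899935230585, 0),
    (4476184633075458495505893942692173636410805784, 0),
    (8032973785106750713341423647935058395819361542, 0),
    (4305938570042556810064916903392427975943216131, 0),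
    (3216139, 1760215989777297281750369069247884528414799668217410451301911550657797),
    (3256484, 305723497498559886766390070370285065856245135562444178),
    (5835143, 1093643881129510502767059013033),
    (8651726, 198194894433329)]),
  (2688372, [
    (6067045527502509010386577286001485651632374023, 0),
    (7138781129437492169051289562718058630536430246, 0),
    (7225893448381550104490378303175923113475838640, 0),
    (7942160567741561041587262608102940366729175392, 0),
    (3512378385124850688689525372837287297859555463, 0),
    (9714587982891754436856483884492168699835076843, 0),
    (6426494, 1546873865847316218378430962887136282546674394452016453407754906284091),
    (3408441, 287540498069070493714783063451596049745093566347248390),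
    (5701800, 1681357421698011037398074044937),
    (6291818, 145450145617105)]),
  (4287497, [
    (5308979420627566622259576896505166841689975664, 0),
    (2977283011645255638085101845264496641369425136, 0),
    (3927829080081448475997725894663774457679122651, 0),
    (4260901522231896255277630860286797580052619319, 0),
    (7537894255228040753473261368357692481966311246, 0),
    (4141221, 2130727272039614229022975287254131924855381356462454374947893815966081),
    (2951536, 347329246065063674899071571526074381714535622930479201),
    (3412069, 416262783986230077689541480589),
    (2753542, 545560976406609)]),
  (3044496, [
    (11869089887877710718732068524580972602311664397, 0),
    (2945944396017203291931625373342190054360156513, 0),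
    (7906877404388354390150811340842989743331017547, 0),
    (4114604629637130593785489732010931292960590925, 0),
    (5639495, 648831098714329034799266109066975340187172126228118046600610036011090),
    (1458226, 507223096823685862464250578290786948009205646415180290),
    (6720011, 1717999668841705060195473099421),
    (2949382, 363830977693602)]),
  (1913351, [
    (5452826278259006302184660644603186753910932054, 0),
    (4928626718642252590219296072711942239063339027, 0),
    (1963883957122331063965250470017129567085408518, 0),
    (1996289, 1058285704266004078993314039521113447364244417713525830484507679497484),
    (4472937, 471060072340771719709360089043428034533024447174879240),
    (2689378, 502613344254832688383094319875),
    (4482055, 265266983262337)]),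
  (2687589, [
    (3130597846134495957136344042481547804721509264, 0),
    (10671200601914401999912821771754371842402733104, 0),
    (4453382, 808926782410104314113204417344757490843392333513961762945316384892945),
    (5555600, 585919666789139470870148216240247222346586420790626425),
    (5591225, 1525956956802332707978215641287),
    (4459648, 421838806816261)]),
  (3806730, [
    (9903160250862291488265303252336852259971597699, 0),
    (1857552, 1860701203284055946062295904726516615540166206057867628656779921085700),
    (6950025, 748551728688560861194104027730688609795846122698915884),
    (5122824, 1081985605499422731905647284430),
    (5375050, 288141443500993)]),
  (3758341, [
    (2056784, 2982507054453294520637938215088445052561381695642040223758076013973658),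
    (4224520, 229406071215403032898025360829127767702606765880517634),
    (8050446, 376817368373712709612288524625),
    (3411265, 221578440474113)]),
  (6446416, [
    (5125643, 1118402982924382361440681987386),
    (4472919, 367193938657883)])]


/-! ## From the combinatorial statement to dimensions -/

/-- The exponent of the monomial coded by a number. -/
noncomputable def mc (a : ℕ) : Fin 4 →₀ ℕ := Finsupp.equivFunOnFinite.symm (ex a)

theorem mc_apply (a : ℕ) (j : Fin 4) : mc a j = ex a j := rfl

theorem pderiv_pow_monomial (i : Fin 4) (n : ℕ) (e : Fin 4 →₀ ℕ) (c : ℚ) :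
    ((pderiv i).toLinearMap ^ n : Module.End ℚ (MvPolynomial (Fin 4) ℚ)) (monomial e c) =
      monomial (e - Finsupp.single i n) (c * ((e i).descFactorial n : ℚ)) := by
  induction n with
  | zero => simp
  | succ n ih =>
    rw [pow_succ', Module.End.mul_apply, ih]
    change pderiv i _ = _
    rw [pderiv_monomial]
    refine congrArg₂ (fun (u : Fin 4 →₀ ℕ) (v : ℚ) => monomial u v) ?_ ?_
    · ext j
      by_cases h : i = j
      · subst h
        simp
        omega
      · simp [Finsupp.single_apply, h]
    · rw [Nat.descFactorial_succ]
      push_cast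
      simp
      ring

theorem diffOp_monomial (ν : Fin 4 → ℕ) (e : Fin 4 →₀ ℕ) (c : ℚ) :
    diffOp ν (monomial e c) = monomial (e - Finsupp.equivFunOnFinite.symm ν) (c * qf ν e) := by
  unfold diffOp
  simp only [Module.End.mul_apply, pderiv_pow_monomial]
  refine congrArg₂ (fun (u : Fin 4 →₀ ℕ) (v : ℚ) => monomial u v) ?_ ?_
  · ext j
    fin_cases j <;> simp
  · simp [qf, Fin.prod_univ_four]
    ring

theorem eval_diffOp_monomial (p : Fin 4 → ℚ) (ν : Fin 4 → ℕ) (e : Fin 4 →₀ ℕ) (c : ℚ) :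
    mon p ν * aeval p (diffOp ν (monomial e c)) = c * (qf ν e * mon p e) := by
  rw [diffOp_monomial, aeval_monomial]
  rw [Finsupp.prod_fintype _ _ (by simp)]
  by_cases h : ∀ j, ν j ≤ e j
  · have : mon p e = mon p ν * ∏ j, p j ^ ((e - Finsupp.equivFunOnFinite.symm ν : Fin 4 →₀ ℕ) j) := by
      unfold mon
      rw [← Finset.prod_mul_distrib]
      refine Finset.prod_congr rfl fun j _ => ?_
      rw [← pow_add]
      congr 1
      have := h j
      simp
      omega
    rw [this]
    simp
    ring
  · push Not at h
    obtain ⟨j, hj⟩ := h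
    have : qf ν e = 0 := by
      unfold qf
      apply Finset.prod_eq_zero (Finset.mem_univ j)
      rw [Nat.descFactorial_of_lt hj]
      simp
    simp [this]

/-- The degree `d` simplex. -/
def SS (d : ℕ) : Finset ℕ := (simplexL d).toFinset

theorem ex_code (x y z t : ℕ) (h : x + y + z + t ≤ 13) :
    ex (x + 256 * y + 65536 * z + 16777216 * t) = ![x, y, z, t] := by
  have e0 : (x + 256 * y + 65536 * z + 16777216 * t) % 256 = x := by omega
  have e1 : (x + 256 * y + 65536 * z + 16777216 * t) / 256 % 256 = y := by
    have : (x + 256 * y + 65536 * z + 16777216 * t) / 256 = y + 256 * z + 65536 * t := by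
      rw [Nat.div_eq_iff (by norm_num)]
      omega
    omega
  have e2 : (x + 256 * y + 65536 * z + 16777216 * t) / 65536 % 256 = z := by
    have : (x + 256 * y + 65536 * z + 16777216 * t) / 65536 = z + 256 * t := by
      rw [Nat.div_eq_iff (by norm_num)]
      omega
    omega
  have e3 : (x + 256 * y + 65536 * z + 16777216 * t) / 16777216 % 256 = t := by
    have : (x + 256 * y + 65536 * z + 16777216 * t) / 16777216 = t := by
      rw [Nat.div_eq_iff (by norm_num)]
      omega
    omega
  simp only [ex, e0, e1, e2, e3]

theorem mem_SS {d a : ℕ} (hd : d ≤ 13) (h : a ∈ SS d) : ∑ j, ex a j = d ∧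
    a = ex a 0 + 256 * ex a 1 + 65536 * ex a 2 + 16777216 * ex a 3 := by
  obtain ⟨x, y, z, t, h1, h2⟩ := (mem_simplexL d a).1 (List.mem_toFinset.1 h)
  have := ex_code x y z t (by omega)
  rw [h2, this]
  simpa [Fin.sum_univ_four] using h1

theorem mc_inj {d a b : ℕ} (hd : d ≤ 13) (ha : a ∈ SS d) (hb : b ∈ SS d) (h : mc a = mc b) : a = b := by
  have hexab : ex a = ex b := by
    funext j
    rw [← mc_apply, h, mc_apply]
  rw [(mem_SS hd ha).2, (mem_SS hd hb).2, hexab]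

/-- The polynomial with the given coefficients. -/
noncomputable def polyOf (d : ℕ) : (SS d → ℚ) →ₗ[ℚ] MvPolynomial (Fin 4) ℚ :=
  ∑ a : SS d, (monomial (mc a)) ∘ₗ LinearMap.proj a

theorem polyOf_apply (d : ℕ) (c : SS d → ℚ) : polyOf d c = ∑ a : SS d, monomial (mc a) (c a) := by
  simp [polyOf]

theorem coeff_polyOf {d : ℕ} (hd : d ≤ 13) (c : SS d → ℚ) (a : SS d) : coeff (mc a) (polyOf d c) = c a := by
  rw [polyOf_apply, coeff_sum, Finset.sum_eq_single a]
  · simp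
  · intro b _ hb
    rw [coeff_monomial, if_neg]
    intro h
    exact hb (Subtype.ext (mc_inj hd b.2 a.2 h))
  · simp

theorem polyOf_injective {d : ℕ} (hd : d ≤ 13) : Function.Injective (polyOf d) := by
  intro c c' h
  funext a
  rw [← coeff_polyOf hd c, h, coeff_polyOf hd]

theorem le_range_polyOf {d : ℕ} (hd : d ≤ 13) :
    homogeneousSubmodule (Fin 4) ℚ d ≤ LinearMap.range (polyOf d) := by
  intro P hP
  rw [mem_homogeneousSubmodule] at hP
  refine ⟨fun a => coeff (mc a) P, ?_⟩
  ext e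
  by_cases he : e.degree = d
  · have hs : ∑ j, e j = d := by rw [← he, Finsupp.degree_eq_sum]
    rw [Fin.sum_univ_four] at hs
    have hmem : e 0 + 256 * e 1 + 65536 * e 2 + 16777216 * e 3 ∈ SS d :=
      List.mem_toFinset.2 ((mem_simplexL d _).2 ⟨_, _, _, _, hs, rfl⟩)
    have hmc : mc (e 0 + 256 * e 1 + 65536 * e 2 + 16777216 * e 3) = e := by
      ext j
      rw [mc_apply, ex_code _ _ _ _ (by omega)]
      fin_cases j <;> rfl
    have := coeff_polyOf hd (fun a : SS d => coeff (mc a) P) ⟨_, hmem⟩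
    rwa [hmc] at this
  · rw [hP.coeff_eq_zero he, polyOf_apply, coeff_sum]
    apply Finset.sum_eq_zero
    intro a _
    rw [coeff_monomial, if_neg]
    intro h
    apply he
    rw [← h, Finsupp.degree_eq_sum]
    exact (mem_SS hd a.2).1

theorem polyOf_mem {d : ℕ} (hd : d ≤ 13) (c : SS d → ℚ) :
    polyOf d c ∈ homogeneousSubmodule (Fin 4) ℚ d := by
  rw [polyOf_apply]
  refine Submodule.sum_mem _ fun a _ => ?_
  rw [mem_homogeneousSubmodule]
  apply isHomogeneous_monomial
  rw [Finsupp.degree_eq_sum]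
  exact (mem_SS hd a.2).1

theorem eval_polyOf (d : ℕ) (c : SS d → ℚ) (p : Fin 4 → ℚ) (ν : Fin 4 → ℕ) :
    mon p ν * aeval p (diffOp ν (polyOf d c)) = ∑ a : SS d, c a * (qf ν (ex a) * mon p (ex a)) := by
  rw [polyOf_apply, map_sum, map_sum, Finset.mul_sum]
  refine Finset.sum_congr rfl fun a _ => ?_
  rw [eval_diffOp_monomial]
  rfl

theorem mon_ne_zero {p : Fin 4 → ℚ} (hp : ∀ j, p j ≠ 0) (ν : Fin 4 → ℕ) : mon p ν ≠ 0 :=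
  Finset.prod_ne_zero_iff.2 fun j _ => pow_ne_zero _ (hp j)

theorem mem_system {d : ℕ} (hd : d ≤ 13) (ms : List ℕ) (pts : Fin ms.length → Fin 4 → ℚ)
    (hp : ∀ i j, pts i j ≠ 0) (c : SS d → ℚ) : polyOf d c ∈ systemSpace d ms pts ↔
      ∀ i, ∀ ν : Fin 4 → ℕ, ∑ j, ν j < ms.get i →
        ∑ a : SS d, c a * (qf ν (ex a) * mon (pts i) (ex a)) = 0 := by
  unfold systemSpace vanishingSpace
  simp only [Submodule.mem_inf, polyOf_mem hd, true_and, Submodule.mem_iInf, LinearMap.mem_ker,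
    LinearMap.comp_apply]
  refine forall_congr' fun i => forall_congr' fun ν => forall_congr' fun h => ?_
  rw [← eval_polyOf]
  simp only [mul_eq_zero, mon_ne_zero (hp i), false_or]
  rfl

/-- The coefficient vectors of the members of the linear system. -/
noncomputable def KK (d : ℕ) (ms : List ℕ) (pts : Fin ms.length → Fin 4 → ℚ) : Submodule ℚ (SS d → ℚ) :=
  (systemSpace d ms pts).comap (polyOf d)

theorem finrank_KK {d : ℕ} (hd : d ≤ 13) (ms : List ℕ) (pts : Fin ms.length → Fin 4 → ℚ) :
    Module.finrank ℚ (systemSpace d ms pts) = Module.finrank ℚ (KK d ms pts) := by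
  have h : (KK d ms pts).map (polyOf d) = systemSpace d ms pts := by
    unfold KK
    rw [Submodule.map_comap_eq, inf_eq_right]
    exact inf_le_left.trans (le_range_polyOf hd)
  rw [← h]
  exact ((KK d ms pts).equivMapOfInjective (polyOf d) (polyOf_injective hd)).finrank_eq.symm

theorem upper {d : ℕ} (hd : d ≤ 13) (ms : List ℕ) (pts : Fin ms.length → Fin 4 → ℚ)
    (hp : ∀ i j, pts i j ≠ 0) (D : Finset ℕ) (hD : D ⊆ SS d)
    (hK : ∀ c : ℕ → ℚ, (∀ i, ∀ ν : Fin 4 → ℕ, ∑ j, ν j < ms.get i →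
      ∑ a ∈ D, c a * (qf ν (ex a) * mon (pts i) (ex a)) = 0) → ∀ a ∈ D, c a = 0) :
    Module.finrank ℚ (KK d ms pts) + D.card ≤ (SS d).card := by
  let ρ : KK d ms pts →ₗ[ℚ] ((SS d \ D : Finset ℕ) → ℚ) :=
    (LinearMap.pi fun a : (SS d \ D : Finset ℕ) =>
      LinearMap.proj (⟨a.1, (Finset.mem_sdiff.1 a.2).1⟩ : SS d)) ∘ₗ (KK d ms pts).subtype
  have hρ : Function.Injective ρ := by
    rw [← LinearMap.ker_eq_bot, LinearMap.ker_eq_bot']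
    rintro ⟨c, hc⟩ h0
    have hz : ∀ a (h : a ∈ SS d), a ∉ D → c ⟨a, h⟩ = 0 := fun a h h' =>
      congrFun h0 ⟨a, Finset.mem_sdiff.2 ⟨h, h'⟩⟩
    let c' : ℕ → ℚ := fun a => if h : a ∈ SS d then c ⟨a, h⟩ else 0
    have hc' : ∀ a : SS d, c' a = c a := fun a => by simp [c']
    have hm := (mem_system hd ms pts hp c).1 hc
    have := hK c' (by
      intro i ν hν
      rw [← hm i ν hν, Finset.sum_subset hD]
      · rw [← Finset.sum_coe_sort (SS d)]
        exact Finset.sum_congr rfl fun a _ => by rw [hc']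
      · intro a h h'
        have : c' a = 0 := by simpa [c', h] using hz a h h'
        rw [this, zero_mul])
    apply Subtype.ext
    funext a
    change c a = 0
    by_cases h : a.1 ∈ D
    · rw [← hc']
      exact this _ h
    · exact hz a.1 a.2 h
  have h1 := LinearMap.finrank_le_finrank_of_injective hρ
  rw [Module.finrank_fintype_fun_eq_card, Fintype.card_coe, Finset.card_sdiff_of_subset hD] at h1
  have h2 := Finset.card_le_card hD
  omega

/-- The derivatives not involving the last variable, of order less than `m`. -/
def TT (m : ℕ) : Finset (ℕ × ℕ × ℕ) :=
  (Finset.range m ×ˢ Finset.range m ×ˢ Finset.range m).filter fun t => t.1 + t.2.1 + t.2.2 < m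

theorem qf_rec (d i j l k : ℕ) (e : Fin 4 → ℕ) (he : ∑ n, e n = d) :
    qf ![i, j, l, k + 1] e = ((d : ℚ) - k - i - j - l) * qf ![i, j, l, k] e -
      qf ![i + 1, j, l, k] e - qf ![i, j + 1, l, k] e - qf ![i, j, l + 1, k] e := by
  have key : ∀ n m : ℕ, ((n.descFactorial (m + 1) : ℕ) : ℚ) = ((n : ℚ) - m) * (n.descFactorial m : ℚ) := by
    intro n m
    rw [Nat.descFactorial_succ]
    by_cases h : m ≤ n
    · push_cast [Nat.cast_sub h]
      ring
    · rw [Nat.descFactorial_of_lt (not_le.1 h)]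
      simp
  subst he
  simp [qf, Fin.prod_univ_four, Fin.sum_univ_four, key, -Nat.descFactorial_succ]
  ring

theorem conds (d m : ℕ) (hd : d ≤ 13) (c : SS d → ℚ) (p : Fin 4 → ℚ)
    (h : ∀ i j l : ℕ, i + j + l < m → ∑ a : SS d, c a * (qf ![i, j, l, 0] (ex a) * mon p (ex a)) = 0) :
    ∀ k i j l : ℕ, i + j + l + k < m →
      ∑ a : SS d, c a * (qf ![i, j, l, k] (ex a) * mon p (ex a)) = 0 := by
  intro k
  induction k with
  | zero => exact fun i j l hl => h i j l (by omega)
  | succ k ih =>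
    intro i j l hl
    have h0 := ih i j l (by omega)
    have h1 := ih (i + 1) j l (by omega)
    have h2 := ih i (j + 1) l (by omega)
    have h3 := ih i j (l + 1) (by omega)
    have : ∑ a : SS d, c a * (qf ![i, j, l, k + 1] (ex a) * mon p (ex a)) =
        ((d : ℚ) - k - i - j - l) * ∑ a : SS d, c a * (qf ![i, j, l, k] (ex a) * mon p (ex a)) -
        ∑ a : SS d, c a * (qf ![i + 1, j, l, k] (ex a) * mon p (ex a)) -
        ∑ a : SS d, c a * (qf ![i, j + 1, l, k] (ex a) * mon p (ex a)) -
        ∑ a : SS d, c a * (qf ![i, j, l + 1, k] (ex a) * mon p (ex a)) := by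
      rw [Finset.mul_sum, ← Finset.sum_sub_distrib, ← Finset.sum_sub_distrib, ← Finset.sum_sub_distrib]
      refine Finset.sum_congr rfl fun a _ => ?_
      rw [qf_rec d i j l k _ (mem_SS hd a.2).1]
      ring
    rw [this, h0, h1, h2, h3]
    ring

theorem lower {d : ℕ} (hd : d ≤ 13) (ms : List ℕ) (pts : Fin ms.length → Fin 4 → ℚ)
    (hp : ∀ i j, pts i j ≠ 0) :
    (SS d).card ≤ Module.finrank ℚ (KK d ms pts) + ∑ i, (TT (ms.get i)).card := by
  let L : (SS d → ℚ) →ₗ[ℚ] ((Σ i : Fin ms.length, TT (ms.get i)) → ℚ) :=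
    LinearMap.pi fun r => ∑ a : SS d,
      (qf ![r.2.1.1, r.2.1.2.1, r.2.1.2.2, 0] (ex a) * mon (pts r.1) (ex a)) • LinearMap.proj a
  have hL : ∀ c r, L c r = ∑ a : SS d,
      c a * (qf ![r.2.1.1, r.2.1.2.1, r.2.1.2.2, 0] (ex a) * mon (pts r.1) (ex a)) := by
    intro c r
    simp [L, mul_comm]
  have hker : LinearMap.ker L ≤ KK d ms pts := by
    intro c hc
    refine (mem_system hd ms pts hp c).2 ?_
    intro i ν hν
    have hν' : ν = ![ν 0, ν 1, ν 2, ν 3] := by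
      funext j
      fin_cases j <;> rfl
    rw [Fin.sum_univ_four] at hν
    rw [hν']
    refine conds d (ms.get i) hd c (pts i) ?_ _ _ _ _ hν
    intro i' j' l' hl
    have hm : (i', j', l') ∈ TT (ms.get i) := by
      unfold TT
      rw [Finset.mem_filter, Finset.mem_product, Finset.mem_product, Finset.mem_range, Finset.mem_range,
        Finset.mem_range]
      exact ⟨⟨by simp only; omega, by simp only; omega, by simp only; omega⟩, hl⟩
    rw [← hL c ⟨i, ⟨_, hm⟩⟩, LinearMap.mem_ker.1 hc]
    rfl
  have h1 := LinearMap.finrank_range_add_finrank_ker L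
  have h2 := Submodule.finrank_mono hker
  have h3 := (LinearMap.range L).finrank_le
  rw [Module.finrank_fintype_fun_eq_card] at h1 h3
  rw [Fintype.card_sigma] at h3
  simp only [Fintype.card_coe] at h1 h3
  omega

theorem linInd {p q : Fin 4 → ℚ} (h : PDist p q) : LinearIndependent ℚ ![p, q] := by
  obtain ⟨i, j, h⟩ := h
  rw [LinearIndependent.pair_iff]
  intro s t hst
  have h1 : s * p i + t * q i = 0 := by simpa using congrFun hst i
  have h2 : s * p j + t * q j = 0 := by simpa using congrFun hst j
  have h' : p i * q j - p j * q i ≠ 0 := sub_ne_zero.2 h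
  constructor
  · have : s * (p i * q j - p j * q i) = 0 := by linear_combination q j * h1 - q i * h2
    exact (mul_eq_zero.1 this).resolve_right h'
  · have : t * (p i * q j - p j * q i) = 0 := by linear_combination p i * h2 - p j * h1
    exact (mul_eq_zero.1 this).resolve_right h'

theorem PDist_symm {p q : Fin 4 → ℚ} (h : PDist p q) : PDist q p := by
  obtain ⟨i, j, h⟩ := h
  exact ⟨i, j, fun h' => h (by linear_combination -h')⟩

theorem reorder {pts : List (ℕ × (Fin 4 → ℚ))} {l : List ℕ} (h : (pts.map Prod.fst).Perm l) :
    ∃ pts' : List (ℕ × (Fin 4 → ℚ)), pts'.Perm pts ∧ pts'.map Prod.fst = l := by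
  generalize hq : pts.map Prod.fst = q at h
  induction h generalizing pts with
  | nil => exact ⟨pts, List.Perm.refl _, hq⟩
  | cons a h ih =>
    obtain ⟨b, pts, rfl, rfl, hb⟩ := List.map_eq_cons_iff.1 hq
    obtain ⟨p', h1, h2⟩ := ih hb
    exact ⟨b :: p', h1.cons b, by simp [h2]⟩
  | swap a b l =>
    obtain ⟨u, pts, rfl, rfl, hb⟩ := List.map_eq_cons_iff.1 hq
    obtain ⟨v, pts, rfl, rfl, rfl⟩ := List.map_eq_cons_iff.1 hb
    exact ⟨v :: u :: pts, List.Perm.swap _ _ _, rfl⟩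
  | trans h1 h2 ih1 ih2 =>
    obtain ⟨p1, a1, a2⟩ := ih1 hq
    obtain ⟨p2, b1, b2⟩ := ih2 a2
    exact ⟨p2, b1.trans a1, b2⟩

theorem nonSpecial_of_QL (d x y z : ℕ) (hd : d ≤ 13) (hc : (simplexL d).length = (d + 3).choose 3)
    (h : QL (simplexL d).reverse (x • {4} + (y • {3} + z • {2}))) :
    nonSpecial d (List.replicate x 4 ++ List.replicate y 3 ++ List.replicate z 2) := by
  obtain ⟨D, hD, ⟨pts0, hf0, hn0, hpw0, hk0⟩, hcard⟩ := h
  have hmul : ((List.replicate x 4 ++ List.replicate y 3 ++ List.replicate z 2 : List ℕ) : Multiset ℕ) =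
      x • {4} + (y • {3} + z • {2}) := by
    simp only [Multiset.nsmul_singleton, ← Multiset.coe_replicate, Multiset.coe_add, List.append_assoc]
  rw [← hmul, Multiset.coe_eq_coe] at hf0
  obtain ⟨pts', hp', hf⟩ := reorder hf0
  have hwt : wt (x • {4} + (y • {3} + z • {2})) = x * 20 + (y * 10 + z * 4) := by
    rw [wt_add, wt_add, wt_nsmul, wt_nsmul, wt_nsmul]
    rfl
  rw [hwt, List.length_reverse, hc] at hcard
  have hall : ∀ m ∈ (List.replicate x 4 ++ List.replicate y 3 ++ List.replicate z 2), m = 4 ∨ m = 3 ∨ m = 2 := by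
    intro m hm
    simp only [List.mem_append, List.mem_replicate] at hm
    tauto
  have hsumn : ((List.replicate x 4 ++ List.replicate y 3 ++ List.replicate z 2).map
      fun m => (m + 2).choose 3).sum = x * 20 + (y * 10 + z * 4) := by
    simp only [List.map_append, List.sum_append, List.map_replicate, List.sum_replicate, smul_eq_mul, add_assoc]
    rfl
  have hsumz : ((List.replicate x 4 ++ List.replicate y 3 ++ List.replicate z 2).map
      fun m => ((m + 2).choose 3 : ℤ)).sum = (x : ℤ) * 20 + ((y : ℤ) * 10 + (z : ℤ) * 4) := by
    have := congrArg (Nat.cast : ℕ → ℤ) hsumn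
    rw [Nat.cast_list_sum, List.map_map] at this
    push_cast at this
    exact this
  generalize List.replicate x 4 ++ List.replicate y 3 ++ List.replicate z 2 = ms at *
  subst hf
  have hlen : (pts'.map Prod.fst).length = pts'.length := List.length_map _
  let P : Fin (pts'.map Prod.fst).length → Fin 4 → ℚ := fun i => (pts'.get (i.cast hlen)).2
  have hnz : ∀ i j, P i j ≠ 0 := fun i j => hn0 _ (hp'.subset (List.get_mem _ _)) j
  have hpw : pts'.Pairwise (fun s t => PDist s.2 t.2) :=
    (hp'.pairwise_iff (fun h => PDist_symm h)).2 hpw0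
  rw [List.pairwise_iff_get] at hpw
  refine ⟨P, fun i h0 => hnz i 0 (congrFun h0 0), ?_, ?_⟩
  · intro i j hij
    apply linInd
    rcases lt_or_gt_of_ne hij with h | h
    · exact hpw (i.cast hlen) (j.cast hlen) h
    · exact PDist_symm (hpw (j.cast hlen) (i.cast hlen) h)
  · have hSc : (SS d).card = (d + 3).choose 3 := by
      rw [← hc]
      exact List.toFinset_card_of_nodup (simplexL_nodup d hd)
    have hDS : D ⊆ SS d := by
      intro a ha
      have := hD ha
      simpa [SS] using this
    have hu := upper hd _ P hnz D hDS (by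
      intro c hcc
      apply hk0 c
      intro t ht ν hν
      obtain ⟨i, rfl⟩ := List.mem_iff_get.1 (hp'.symm.subset ht)
      exact hcc (i.cast hlen.symm) ν (by simpa using hν))
    have hl := lower hd _ P hnz
    have hT : ∑ i, (TT ((pts'.map Prod.fst).get i)).card = x * 20 + (y * 10 + z * 4) := by
      rw [← hsumn, ← Fin.sum_univ_fun_getElem]
      refine Finset.sum_congr rfl fun i _ => ?_
      have := hall _ (List.get_mem (pts'.map Prod.fst) i)
      change _ = ((pts'.map Prod.fst).get i + 2).choose 3
      generalize (pts'.map Prod.fst).get i = m at this ⊢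
      rcases this with rfl | rfl | rfl <;> decide
    rw [hT] at hl
    rw [finrank_KK hd, vdim, hsumz]
    rw [hSc] at hu hl
    have e : (((d + 3).choose 3 : ℕ) : ℤ) = (((d + 3).choose 3 : ℕ) : ℤ) := rfl
    generalize (d + 3).choose 3 = N at *
    omega

theorem chk_cert9 : chk 9 cert9 = true := by
  decide +kernel

theorem chk_cert10 : chk 10 cert10 = true := by
  decide +kernel

theorem chk_cert11 : chk 11 cert11 = true := by
  decide +kernel

theorem chk_cert12 : chk 12 cert12 = true := by
  decide +kernel

theorem chk_cert13 : chk 13 cert13 = true := by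
  decide +kernel

/-- `L_3(d; 4^{×x}, 3^{×y}, 2^{×z})` is non-special for `9 ≤ d ≤ 13`. -/
theorem nonSpecial_of_nine_le_le_thirteen (d x y z : ℕ) (hd1 : 9 ≤ d) (hd2 : d ≤ 13) :
    nonSpecial d (List.replicate x 4 ++ List.replicate y 3 ++ List.replicate z 2) := by
  have hlen : (simplexL d).length = (d + 3).choose 3 := by
    interval_cases d <;> decide +kernel
  refine nonSpecial_of_QL d x y z hd2 hlen ?_
  obtain rfl | rfl | rfl | rfl | rfl : d = 9 ∨ d = 10 ∨ d = 11 ∨ d = 12 ∨ d = 13 := by omega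
  · exact chk_sound 9 hd2 cert9 chk_cert9 x y z
  · exact chk_sound 10 hd2 cert10 chk_cert10 x y z
  · exact chk_sound 11 hd2 cert11 chk_cert11 x y z
  · exact chk_sound 12 hd2 cert12 chk_cert12 x y z
  · exact chk_sound 13 hd2 cert13 chk_cert13 x y z
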